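/- Let m, n, k, x be positive integers with x ≥ 2 and 3 ≤ k ≤ m. If (F_{m+1}^{(k)})^x − (F_{m-1}^{(k)})^x = F_n^{(k)}, then x < 7.1 · 10^{13} · m^5 · (log m)^3, where log denotes the natural logarithm. -/

import Mathlib

open Finset

/-- A determinant whose rows are combinations of `z ^ d t • r t z` is divisible by `z ^ n`. -/
lemma exists_det_eq_pow_mul {ι τ : Type*} [Fintype ι] [DecidableEq ι] [Fintype τ] [DecidableEq τ]
    (C : ι → τ → ℂ) (d : τ → ℕ) (r : τ → ι → ℂ → ℂ) (hr : ∀ t j, Differentiable ℂ (r t j))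
    (n : ℕ) (hn : ∀ f : ι → τ, Function.Injective f → n ≤ ∑ i, d (f i)) :
    ∃ h : ℂ → ℂ, Differentiable ℂ h ∧ ∀ z,
      Matrix.det (Matrix.of fun i j => ∑ t, C i t * z ^ d t * r t j z) = z ^ n * h z := by
  classical
  have key : ∀ f : ι → τ, ∃ h : ℂ → ℂ, Differentiable ℂ h ∧ ∀ z,
      Matrix.det (Matrix.of fun i j => C i (f i) * z ^ d (f i) * r (f i) j z) = z ^ n * h z := by
    intro f
    have hdet : ∀ z, Matrix.det (Matrix.of fun i j => C i (f i) * z ^ d (f i) * r (f i) j z)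
        = (∏ i, C i (f i)) * z ^ (∑ i, d (f i)) *
          Matrix.det (Matrix.of fun i j => r (f i) j z) := by
      intro z
      rw [← Finset.prod_pow_eq_pow_sum, ← Finset.prod_mul_distrib, ← Matrix.det_mul_column]
      rfl
    by_cases hf : Function.Injective f
    · refine ⟨fun z => (∏ i, C i (f i)) * z ^ (∑ i, d (f i) - n) *
          Matrix.det (Matrix.of fun i j => r (f i) j z), ?_, ?_⟩
      · simp only [Matrix.det_apply, Matrix.of_apply]
        fun_prop
      · intro z
        rw [hdet, ← Nat.add_sub_of_le (hn f hf), Nat.add_sub_cancel_left, pow_add]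
        ring
    · refine ⟨fun _ => 0, differentiable_const _, ?_⟩
      intro z
      rw [hdet]
      simp only [Function.Injective, not_forall] at hf
      obtain ⟨a, b, hab, hne⟩ := hf
      rw [Matrix.det_zero_of_row_eq hne (by ext j; simp [hab])]
      simp
  choose h hd hh using key
  refine ⟨fun z => ∑ f : ι → τ, h f z, ?_, ?_⟩
  · fun_prop
  · intro z
    rw [Finset.mul_sum]
    have := (Matrix.detRowAlternating (n := ι) (R := ℂ)).toMultilinearMap.map_sum
      (fun i t => (fun j => C i t * z ^ d t * r t j z : ι → ℂ))
    have e1 : (Matrix.of fun i j => ∑ t, C i t * z ^ d t * r t j z) =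
      fun i => ∑ t, (fun j => C i t * z ^ d t * r t j z : ι → ℂ) := by
      ext i j; simp
    rw [e1]
    refine (Eq.trans this ?_)
    refine Finset.sum_congr rfl fun f _ => ?_
    rw [← hh]
    rfl

/-- Taylor expansion with entire remainder. -/
lemma exists_taylor_remainder (H : ℕ) (φ : ℂ → ℂ) (hφ : Differentiable ℂ φ) :
    ∃ (t : ℕ → ℂ) (ρ : ℂ → ℂ), Differentiable ℂ ρ ∧
      ∀ z, φ z = ∑ p ∈ range H, t p * z ^ p + z ^ H * ρ z := by
  induction H with
  | zero => exact ⟨fun _ => 0, φ, hφ, by simp⟩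
  | succ H ih =>
    obtain ⟨t, ρ, hρ, h⟩ := ih
    refine ⟨fun p => if p = H then ρ 0 else t p, dslope ρ 0, ?_, ?_⟩
    · rw [← differentiableOn_univ]
      exact (Complex.differentiableOn_dslope Filter.univ_mem).2 hρ.differentiableOn
    · intro z
      have h1 : ρ z = ρ 0 + z * dslope ρ 0 z := by
        have := sub_smul_dslope ρ 0 z
        simp only [sub_zero, smul_eq_mul] at this
        rw [this]; ring
      rw [Finset.sum_range_succ, h z, h1]
      rw [Finset.sum_congr rfl (fun p hp => ?_)]
      · simp only [if_true]
        ring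
      · rw [if_neg (Finset.mem_range.1 hp).ne]

/-- `P u ζ` is a polynomial in `u` of degree less than `M` with entire coefficients in `ζ`. -/
def IsPolyEntire (M : ℕ) (P : ℂ → ℂ → ℂ) : Prop :=
  ∃ φ : ℕ → ℂ → ℂ, (∀ q, Differentiable ℂ (φ q)) ∧ ∀ u ζ, P u ζ = ∑ q ∈ range M, u ^ q * φ q ζ

lemma IsPolyEntire.monomial {M q : ℕ} (hq : q < M) {φ : ℂ → ℂ} (hφ : Differentiable ℂ φ) :
    IsPolyEntire M (fun u ζ => u ^ q * φ ζ) := by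
  refine ⟨fun r ζ => if r = q then φ ζ else 0, ?_, ?_⟩
  · intro r
    by_cases h : r = q <;> simp [h, hφ]
  · intro u ζ
    rw [Finset.sum_eq_single q]
    · simp
    · intro b _ hb; simp [hb]
    · intro h; exact absurd (Finset.mem_range.2 hq) h

lemma IsPolyEntire.sum {M : ℕ} {κ : Type*} (s : Finset κ) {P : κ → ℂ → ℂ → ℂ}
    (hP : ∀ a ∈ s, IsPolyEntire M (P a)) : IsPolyEntire M (fun u ζ => ∑ a ∈ s, P a u ζ) := by
  choose! φ hφ h using hP
  refine ⟨fun q ζ => ∑ a ∈ s, φ a q ζ, ?_, ?_⟩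
  · intro q
    exact Differentiable.fun_sum fun a ha => hφ a ha q
  · intro u ζ
    simp_rw [Finset.mul_sum]
    rw [Finset.sum_comm]
    exact Finset.sum_congr rfl fun a ha => h a ha u ζ

lemma sum_le_sum_of_injective_sum {ι τ : Type*} [Fintype ι] [DecidableEq ι] [Fintype τ]
    [DecidableEq τ] (hc : Fintype.card τ = Fintype.card ι) (H : ℕ) (d : τ → ℕ)
    (hd : ∀ t, d t ≤ H) (f : ι → τ ⊕ ι) (hf : Function.Injective f) :
    ∑ t, d t ≤ ∑ i, Sum.elim d (fun _ => H) (f i) := by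
  classical
  rw [← Finset.sum_image (s := univ) (g := f) (f := Sum.elim d (fun _ => H))
    (fun a _ b _ h => hf h)]
  set I := univ.image f with hI
  have hcard : I.card = Fintype.card τ := by
    rw [hc, hI, Finset.card_image_of_injective _ hf, Finset.card_univ]
  have h1 := Finset.sum_disjSum I.toLeft I.toRight (Sum.elim d (fun _ => H))
  rw [Finset.toLeft_disjSum_toRight] at h1
  have h2 := Finset.card_toLeft_add_card_toRight (u := I)
  rw [h1]
  simp only [Sum.elim_inl, Sum.elim_inr, Finset.sum_const, smul_eq_mul]
  rw [← Finset.sum_add_sum_compl I.toLeft]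
  have h3 : ∑ i ∈ I.toLeftᶜ, d i ≤ (I.toLeftᶜ).card * H := by
    rw [← smul_eq_mul]
    exact Finset.sum_le_card_nsmul _ _ _ fun t _ => hd t
  have h4 : (I.toLeftᶜ).card = I.toRight.card := by
    rw [Finset.card_compl]; omega
  rw [h4] at h3
  omega

/-- The size of an interpolation determinant with many vanishing Taylor coefficients. -/
lemma norm_det_mul_pow_le {ι : Type*} [Fintype ι] [DecidableEq ι] (M H : ℕ)
    (hcard : Fintype.card ι = M * H) (u v : ι → ℂ) (P : ι → ℂ → ℂ → ℂ)
    (hP : ∀ j, IsPolyEntire M (P j)) (c : ι → ι → ℂ) (E : ℝ) (hE : 1 < E) (D : ι → ℝ)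
    (hD : ∀ i j z, ‖z‖ = E → ‖P j (u i) (v i * z) * Complex.exp (c i j * z ^ H)‖ ≤ D j) :
    ‖Matrix.det (Matrix.of fun i j => P j (u i) (v i) * Complex.exp (c i j))‖ *
      E ^ (M * ∑ p ∈ range H, p) ≤ (Fintype.card ι).factorial * ∏ j, D j := by
  classical
  choose φ hφ hPφ using hP
  have hT := fun j q => exists_taylor_remainder H (φ j q) (hφ j q)
  choose t ρ hρ ht using hT
  obtain ⟨s0, sρ, hsρ, hs⟩ := exists_taylor_remainder 1 Complex.exp Complex.differentiable_exp
  have hs0 : s0 0 = 1 := by have := hs 0; simp at this; exact this.symm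
  have hs' : ∀ w, Complex.exp w = 1 + w * sρ w := by
    intro w; rw [hs w]; simp [hs0]
  let τ := Fin M × Fin H
  let C : ι → τ ⊕ ι → ℂ := fun i => Sum.elim (fun a => u i ^ (a.1 : ℕ) * v i ^ (a.2 : ℕ))
    (fun i' => if i' = i then 1 else 0)
  let d : τ ⊕ ι → ℕ := Sum.elim (fun a => (a.2 : ℕ)) (fun _ => H)
  let r : τ ⊕ ι → ι → ℂ → ℂ := Sum.elim (fun a j _ => t j a.1 a.2)
    (fun i j z => (∑ q ∈ range M, u i ^ q * (v i ^ H * ρ j q (v i * z))) +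
      (∑ q ∈ range M, u i ^ q * φ j q (v i * z)) * (c i j * sρ (c i j * z ^ H)))
  have hr : ∀ t j, Differentiable ℂ (r t j) := by
    rintro (a | i) j
    · simp only [r, Sum.elim_inl]; fun_prop
    · simp only [r, Sum.elim_inr]
      have h1 : ∀ q, Differentiable ℂ fun z => ρ j q (v i * z) := fun q =>
        (hρ j q).comp (by fun_prop)
      have h2 : ∀ q, Differentiable ℂ fun z => φ j q (v i * z) := fun q =>
        (hφ j q).comp (by fun_prop)
      have h3 : Differentiable ℂ fun z => sρ (c i j * z ^ H) := hsρ.comp (by fun_prop)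
      fun_prop
  obtain ⟨h, hh, hdet⟩ := exists_det_eq_pow_mul C d r hr (M * ∑ p ∈ range H, p) (by
    intro f hf
    refine le_trans (le_of_eq ?_) (sum_le_sum_of_injective_sum
      (by simp [τ, hcard]) H (fun a : τ => (a.2 : ℕ)) (fun a => a.2.2.le) f hf)
    rw [Fintype.sum_prod_type]
    simp [Finset.sum_range])
  have hentry : ∀ z i j, ∑ a, C i a * z ^ d a * r a j z
      = P j (u i) (v i * z) * Complex.exp (c i j * z ^ H) := by
    intro z i j
    rw [Fintype.sum_sum_type]
    simp only [C, d, r, Sum.elim_inl, Sum.elim_inr, ite_mul, one_mul, zero_mul,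
      Finset.sum_ite_eq', Finset.mem_univ, if_true]
    rw [hs', hPφ, Fintype.sum_prod_type]
    have : ∀ q : ℕ, u i ^ q * φ j q (v i * z) = (∑ p : Fin H, u i ^ q * v i ^ (p : ℕ) *
        z ^ (p : ℕ) * t j q p) + z ^ H * (u i ^ q * (v i ^ H * ρ j q (v i * z))) := by
      intro q
      rw [ht j q, mul_add, Finset.mul_sum, Finset.sum_range]
      congr 1
      · refine Finset.sum_congr rfl fun p _ => ?_
        ring
      · ring
    have h2 : ∑ q ∈ range M, u i ^ q * φ j q (v i * z) =
      (∑ q : Fin M, ∑ p : Fin H, u i ^ (q : ℕ) * v i ^ (p : ℕ) * z ^ (p : ℕ) * t j q p) +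
        z ^ H * ∑ q ∈ range M, (u i ^ q * (v i ^ H * ρ j q (v i * z))) := by
      rw [Finset.sum_congr rfl fun q _ => this q, Finset.sum_add_distrib, Finset.mul_sum,
        Finset.sum_range]
    rw [mul_add, mul_add, mul_one]
    nth_rewrite 2 [h2]
    ring
  have hE0 : 0 < E := by linarith
  have hbd : ∀ z, ‖z‖ = E → ‖h z‖ ≤ (Fintype.card ι).factorial * (∏ j, D j) /
      E ^ (M * ∑ p ∈ range H, p) := by
    intro z hz
    rw [le_div_iff₀ (by positivity)]
    have h1 := hdet z
    have h2 : ‖h z‖ * E ^ (M * ∑ p ∈ range H, p) =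
        ‖Matrix.det (Matrix.of fun i j => ∑ a, C i a * z ^ d a * r a j z)‖ := by
      rw [h1, norm_mul, norm_pow, hz, mul_comm]
    rw [h2, Matrix.det_apply]
    refine (norm_sum_le _ _).trans ?_
    have h3 : ∀ σ ∈ (univ : Finset (Equiv.Perm ι)),
        ‖Equiv.Perm.sign σ • ∏ i, (Matrix.of fun i j => ∑ a, C i a * z ^ d a * r a j z) (σ i) i‖
          ≤ ∏ j, D j := by
      intro σ _
      have : ‖Equiv.Perm.sign σ • ∏ i,
          (Matrix.of fun i j => ∑ a, C i a * z ^ d a * r a j z) (σ i) i‖ =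
          ‖∏ i, (Matrix.of fun i j => ∑ a, C i a * z ^ d a * r a j z) (σ i) i‖ := by
        rcases Int.units_eq_one_or (Equiv.Perm.sign σ) with h | h <;> simp [h]
      rw [this, norm_prod]
      refine Finset.prod_le_prod (fun _ _ => norm_nonneg _) fun i _ => ?_
      rw [Matrix.of_apply, hentry]
      exact hD _ _ _ hz
    refine (Finset.sum_le_card_nsmul _ _ _ h3).trans ?_
    rw [Finset.card_univ, Fintype.card_perm, nsmul_eq_mul]
  have hmax : ‖h 1‖ ≤ (Fintype.card ι).factorial * (∏ j, D j) /
      E ^ (M * ∑ p ∈ range H, p) := by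
    refine Complex.norm_le_of_forall_mem_frontier_norm_le (U := Metric.ball 0 E)
      Metric.isBounded_ball hh.diffContOnCl ?_ ?_
    · intro z hz
      rw [frontier_ball _ hE0.ne', mem_sphere_zero_iff_norm] at hz
      exact hbd z hz
    · apply subset_closure
      simpa using hE
  have h1 := hdet 1
  have h2 := hentry 1
  simp only [mul_one, one_pow] at h2
  simp only [one_pow, mul_one, one_mul, h2] at h1
  rw [h1]
  rwa [le_div_iff₀ (by positivity)] at hmax

section Casoratian
open Polynomial

lemma Polynomial.coeff_prod_sum_of_natDegree_le {ι R : Type*} [CommSemiring R] (s : Finset ι)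
    (f : ι → R[X]) (d : ι → ℕ) (h : ∀ i ∈ s, (f i).natDegree ≤ d i) :
    (∏ i ∈ s, f i).coeff (∑ i ∈ s, d i) = ∏ i ∈ s, (f i).coeff (d i) := by
  classical
  induction s using Finset.induction_on with
  | empty => simp
  | insert a s ha ih =>
    rw [Finset.prod_insert ha, Finset.sum_insert ha, Finset.prod_insert ha,
      coeff_mul_add_eq_of_natDegree_le (h a (by simp))
        ((natDegree_prod_le _ _).trans (Finset.sum_le_sum fun i hi => h i (by simp [hi]))),
      ih fun i hi => h i (by simp [hi])]

/-- The Casorati matrix of `t ↦ p j t * c j ^ t`, with the exponential factors removed. -/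
noncomputable def casoratiMatrix {I : Type*} (ν : ℕ) (e : Fin ν ≃ I) (c : I → ℝ) (p : I → ℝ[X]) :
    Matrix I I ℝ[X] :=
  Matrix.of fun i j => C (c j ^ (e.symm i : ℕ)) * (p j).comp (X + C ((e.symm i : ℕ) : ℝ))

set_option linter.unusedSectionVars false

variable {I : Type*} [Fintype I] [DecidableEq I] {ν : ℕ} (e : Fin ν ≃ I)

lemma natDegree_casoratiMatrix_le (c : I → ℝ) (p : I → ℝ[X]) (i j : I) :
    (casoratiMatrix ν e c p i j).natDegree ≤ (p j).natDegree := by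
  rw [casoratiMatrix, Matrix.of_apply]
  refine (natDegree_C_mul_le _ _).trans ?_
  rw [natDegree_comp, natDegree_X_add_C, mul_one]

lemma coeff_casoratiMatrix (c : I → ℝ) (p : I → ℝ[X]) (i j : I) :
    (casoratiMatrix ν e c p i j).coeff (p j).natDegree =
      c j ^ (e.symm i : ℕ) * (p j).leadingCoeff := by
  rw [casoratiMatrix, Matrix.of_apply, coeff_C_mul]
  congr 1
  have := coeff_comp_degree_mul_degree (p := p j) (q := X + C ((e.symm i : ℕ) : ℝ))
    (by rw [natDegree_X_add_C]; exact one_ne_zero)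
  rw [natDegree_X_add_C, mul_one] at this
  rw [this, leadingCoeff_X_add_C, one_pow, mul_one]

lemma det_casoratiMatrix_ne_zero (c : I → ℝ) (hc : Function.Injective c) (p : I → ℝ[X])
    (hp : ∀ j, p j ≠ 0) : (casoratiMatrix ν e c p).det ≠ 0 := by
  intro h0
  have h1 : (casoratiMatrix ν e c p).det.coeff (∑ j, (p j).natDegree) =
      Matrix.det (Matrix.of fun i j => c j ^ (e.symm i : ℕ) * (p j).leadingCoeff) := by
    rw [Matrix.det_apply, Matrix.det_apply, finsetSum_coeff]
    refine Finset.sum_congr rfl fun π _ => ?_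
    have : (∏ i, casoratiMatrix ν e c p (π i) i).coeff (∑ j, (p j).natDegree) =
        ∏ i, (c i ^ (e.symm (π i) : ℕ) * (p i).leadingCoeff) := by
      rw [coeff_prod_sum_of_natDegree_le _ _ _ fun i _ => natDegree_casoratiMatrix_le e c p _ i]
      exact Finset.prod_congr rfl fun i _ => coeff_casoratiMatrix e c p _ i
    rcases Int.units_eq_one_or (Equiv.Perm.sign π) with h | h <;> simp [h, this]
  rw [h0, coeff_zero] at h1
  have h2 : Matrix.det (Matrix.of fun i j => c j ^ (e.symm i : ℕ) * (p j).leadingCoeff) =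
      (∏ j, (p j).leadingCoeff) * Matrix.det (Matrix.of fun i j => c j ^ (e.symm i : ℕ)) := by
    rw [← Matrix.det_mul_row]
    congr 1; ext i j; simp [mul_comm]
  have h3 : Matrix.det (Matrix.of fun i j : I => c j ^ (e.symm i : ℕ)) =
      (Matrix.vandermonde (c ∘ e)).det := by
    rw [← Matrix.det_transpose, ← Matrix.det_submatrix_equiv_self e]
    congr 1; ext i j; simp [Matrix.vandermonde]
  rw [h2, h3] at h1
  have h4 := Matrix.det_vandermonde_ne_zero_iff.2 (hc.comp e.injective)
  have h5 : ∏ j, (p j).leadingCoeff ≠ 0 :=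
    Finset.prod_ne_zero_iff.2 fun j _ => leadingCoeff_ne_zero.2 (hp j)
  exact mul_ne_zero h5 h4 h1.symm

lemma natDegree_det_casoratiMatrix_le (c : I → ℝ) (p : I → ℝ[X]) :
    (casoratiMatrix ν e c p).det.natDegree ≤ ∑ j, (p j).natDegree := by
  rw [Matrix.det_apply]
  refine natDegree_sum_le_of_forall_le _ _ fun π _ => ?_
  have : (∏ i, casoratiMatrix ν e c p (π i) i).natDegree ≤ ∑ j, (p j).natDegree :=
    (natDegree_prod_le _ _).trans
      (Finset.sum_le_sum fun i _ => natDegree_casoratiMatrix_le e c p _ i)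
  rcases Int.units_eq_one_or (Equiv.Perm.sign π) with h | h <;> simpa [h] using this

end Casoratian

lemma Matrix.det_eq_zero_of_mulVec {I : Type*} [Fintype I] [DecidableEq I] {R : Type*} [CommRing R]
    [IsDomain R] (A : Matrix I I R) (η : I → R) (hη : η ≠ 0) (h : ∀ i, ∑ j, A i j * η j = 0) :
    A.det = 0 := by
  refine Matrix.exists_mulVec_eq_zero_iff.1 ⟨η, hη, ?_⟩
  ext i; exact h i

/-- An exponential polynomial in one variable with polynomial coefficients `p j`, not all zero,
cannot vanish on too many strings of consecutive integers. -/
lemma exponential_polynomial_eq_zero {L T : ℕ} (c : ℕ → ℝ) (hc : Set.InjOn c (Set.Iio L))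
    (p : ℕ → Polynomial ℝ) (hp : ∀ σ < L, p σ ≠ 0 → (p σ).natDegree < T)
    (Z : Finset ℝ) (hZ : L * (T - 1) < Z.card)
    (h : ∀ t ∈ Z, ∃ η : ℕ → ℝ, (∀ σ, η σ ≠ 0) ∧
      ∀ i < L, ∑ σ ∈ range L, (p σ).eval (t + i) * c σ ^ i * η σ = 0) :
    ∀ σ < L, p σ = 0 := by
  classical
  by_contra hcon
  push Not at hcon
  obtain ⟨σ0, hσ0, hne⟩ := hcon
  set S := (range L).filter (fun σ => p σ ≠ 0) with hS
  let I := {σ // σ ∈ S}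
  have hcardS : S.card ≤ L := by simpa using Finset.card_filter_le (range L) (fun σ => p σ ≠ 0)
  let e : Fin S.card ≃ I := S.equivFin.symm
  have hI : ∀ j : I, (j : ℕ) < L ∧ p j ≠ 0 := fun j => by
    have := Finset.mem_filter.1 j.2
    exact ⟨Finset.mem_range.1 this.1, this.2⟩
  set Δ := (casoratiMatrix S.card e (fun j : I => c j) (fun j : I => p j)).det with hΔ
  have hΔ0 : Δ ≠ 0 := by
    apply det_casoratiMatrix_ne_zero
    · intro a b hab
      exact Subtype.ext (hc (hI a).1 (hI b).1 hab)
    · exact fun j => (hI j).2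
  have hdeg : Δ.natDegree ≤ L * (T - 1) := by
    refine (natDegree_det_casoratiMatrix_le _ _ _).trans ?_
    refine (Finset.sum_le_card_nsmul _ _ (T - 1) fun j _ => ?_).trans ?_
    · have := hp j (hI j).1 (hI j).2; omega
    · rw [Finset.card_univ, Fintype.card_coe, smul_eq_mul]
      exact Nat.mul_le_mul_right _ hcardS
  have hroots : Z ⊆ Δ.roots.toFinset := by
    intro t ht
    obtain ⟨η, hη, hsum⟩ := h t ht
    rw [Multiset.mem_toFinset, Polynomial.mem_roots hΔ0, Polynomial.IsRoot.def, hΔ,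
      ← Polynomial.coe_evalRingHom, RingHom.map_det]
    refine Matrix.det_eq_zero_of_mulVec _ (fun j : I => η j) ?_ ?_
    · intro h0
      exact hη σ0 (congrFun h0 ⟨σ0, by simp [hS, hσ0, hne]⟩)
    · intro i
      have h1 := hsum (e.symm i) ((e.symm i).2.trans_le hcardS)
      have h2 :
          ∑ σ ∈ S, (p σ).eval (t + ((e.symm i : ℕ) : ℝ)) * c σ ^ (e.symm i : ℕ) * η σ = 0 := by
        rw [← h1]
        refine Finset.sum_subset (Finset.filter_subset _ _) fun σ hσ hσ' => ?_
        have : p σ = 0 := by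
          by_contra hne'
          exact hσ' (Finset.mem_filter.2 ⟨hσ, hne'⟩)
        simp [this]
      rw [← h2, ← Finset.sum_coe_sort S]
      refine Finset.sum_congr rfl fun j _ => ?_
      simp [casoratiMatrix, mul_comm]
  have h1 := Finset.card_le_card hroots
  have h2 := Multiset.toFinset_card_le Δ.roots
  have h3 := Polynomial.card_roots' Δ
  omega

section ShiftVars
open MvPolynomial

variable {σ : Type*}

/-- Translation of the variables of a polynomial by a real vector. -/
noncomputable def shiftVars (v : σ → ℝ) : MvPolynomial σ ℝ →ₐ[ℝ] MvPolynomial σ ℝ :=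
  aeval fun i => X i + C (v i)

lemma eval_shiftVars (v w : σ → ℝ) (p : MvPolynomial σ ℝ) :
    eval w (shiftVars v p) = eval (w + v) p := by
  induction p using MvPolynomial.induction_on with
  | C a => simp [shiftVars]
  | add p q hp hq => simp [hp, hq]
  | mul_X p i hp => simp [hp]; simp [shiftVars]

lemma shiftVars_shiftVars (u v : σ → ℝ) (p : MvPolynomial σ ℝ) :
    shiftVars u (shiftVars v p) = shiftVars (u + v) p := by
  induction p using MvPolynomial.induction_on with
  | C a => simp [shiftVars]
  | add p q hp hq => simp [hp, hq]
  | mul_X p i hp => simp only [map_mul, hp]; simp [shiftVars, add_assoc]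

@[simp] lemma shiftVars_zero (p : MvPolynomial σ ℝ) : shiftVars 0 p = p := by
  simp [shiftVars]

lemma shiftVars_neg_shiftVars (v : σ → ℝ) (p : MvPolynomial σ ℝ) :
    shiftVars (-v) (shiftVars v p) = p := by
  rw [shiftVars_shiftVars]; simp

lemma totalDegree_shiftVars_le (v : σ → ℝ) (p : MvPolynomial σ ℝ) :
    (shiftVars v p).totalDegree ≤ p.totalDegree := by
  rw [shiftVars, aeval_def, eval₂_eq]
  refine (totalDegree_finsetSum_le fun m hm => ?_)
  refine (totalDegree_mul _ _).trans ?_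
  have h1 : (algebraMap ℝ (MvPolynomial σ ℝ) (coeff m p)).totalDegree = 0 := totalDegree_C _
  rw [h1, zero_add]
  refine (totalDegree_finsetProd _ _).trans ?_
  refine le_trans (Finset.sum_le_sum (g := fun i => m i) fun i _ => ?_) (le_totalDegree hm)
  refine (totalDegree_pow _ _).trans ?_
  have : (X i + C (v i) : MvPolynomial σ ℝ).totalDegree ≤ 1 :=
    (totalDegree_add _ _).trans (by simp)
  calc m i * _ ≤ m i * 1 := Nat.mul_le_mul_left _ this
    _ = m i := mul_one _

lemma totalDegree_shiftVars (v : σ → ℝ) (p : MvPolynomial σ ℝ) :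
    (shiftVars v p).totalDegree = p.totalDegree :=
  (totalDegree_shiftVars_le v p).antisymm (by
    conv_lhs => rw [← shiftVars_neg_shiftVars v p]
    exact totalDegree_shiftVars_le _ _)

lemma shiftVars_ne_zero (v : σ → ℝ) {p : MvPolynomial σ ℝ} (hp : p ≠ 0) : shiftVars v p ≠ 0 := by
  intro h
  apply hp
  rw [← shiftVars_neg_shiftVars v p, h, map_zero]

/-- Restriction of a polynomial to the line `w + t κ`. -/
noncomputable def restrictLine (w κ : σ → ℝ) : MvPolynomial σ ℝ →ₐ[ℝ] Polynomial ℝ :=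
  aeval fun i => Polynomial.C (w i) + Polynomial.C (κ i) * Polynomial.X

lemma eval_restrictLine (w κ : σ → ℝ) (p : MvPolynomial σ ℝ) (t : ℝ) :
    (restrictLine w κ p).eval t = eval (w + t • κ) p := by
  induction p using MvPolynomial.induction_on with
  | C a => simp [restrictLine]
  | add p q hp hq => simp [hp, hq]
  | mul_X p i hp => simp [hp]; simp [restrictLine, mul_comm t]

lemma natDegree_restrictLine_le (w κ : σ → ℝ) (p : MvPolynomial σ ℝ) :
    (restrictLine w κ p).natDegree ≤ p.totalDegree := by
  rw [restrictLine, aeval_def, eval₂_eq]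
  refine Polynomial.natDegree_sum_le_of_forall_le _ _ fun m hm => ?_
  have h1 : (algebraMap ℝ (Polynomial ℝ) (coeff m p)) = Polynomial.C (coeff m p) := rfl
  rw [h1]
  refine (Polynomial.natDegree_C_mul_le _ _).trans ?_
  refine (Polynomial.natDegree_prod_le _ _).trans ?_
  refine le_trans (Finset.sum_le_sum (g := fun i => m i) fun i _ => ?_) (le_totalDegree hm)
  refine Polynomial.natDegree_pow_le.trans ?_
  have : (Polynomial.C (w i) + Polynomial.C (κ i) * Polynomial.X : Polynomial ℝ).natDegree ≤ 1 := by
    compute_degree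
  calc m i * _ ≤ m i * 1 := Nat.mul_le_mul_left _ this
    _ = m i := mul_one _

end ShiftVars

open MvPolynomial in
/-- A Casoratian in the first variable of an exponential polynomial in two variables. -/
lemma exists_casoratian {L T : ℕ} (c : ℕ → ℝ) (hc : Set.InjOn c (Set.Iio L))
    (p : ℕ → MvPolynomial (Fin 2) ℝ) (hp : ∀ σ < L, (p σ).totalDegree < T)
    {σ0 : ℕ} (hσ0 : σ0 < L) (hne : p σ0 ≠ 0) :
    ∃ Δ : MvPolynomial (Fin 2) ℝ, Δ ≠ 0 ∧ Δ.totalDegree ≤ L * (T - 1) ∧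
      ∀ w : Fin 2 → ℝ, (∃ η : ℕ → ℝ, (∀ σ, η σ ≠ 0) ∧ ∀ i < L, ∑ σ ∈ range L,
        eval (w + (i : ℝ) • ![1, 0]) (p σ) * c σ ^ i * η σ = 0) → eval w Δ = 0 := by
  classical
  set S := (range L).filter (fun σ => p σ ≠ 0) with hS
  let I := {σ // σ ∈ S}
  have hcardS : S.card ≤ L := by simpa using Finset.card_filter_le (range L) (fun σ => p σ ≠ 0)
  let e : Fin S.card ≃ I := S.equivFin.symm
  have hI : ∀ j : I, (j : ℕ) < L ∧ p j ≠ 0 := fun j => by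
    have := Finset.mem_filter.1 j.2
    exact ⟨Finset.mem_range.1 this.1, this.2⟩
  let A : Matrix I I (MvPolynomial (Fin 2) ℝ) := Matrix.of fun i j =>
    C (c j ^ (e.symm i : ℕ)) * shiftVars (((e.symm i : ℕ) : ℝ) • ![1, 0]) (p j)
  refine ⟨A.det, ?_, ?_, ?_⟩
  · have hprod : ∏ j : I, p j ≠ 0 := Finset.prod_ne_zero_iff.2 fun j _ => (hI j).2
    obtain ⟨w0, hw0⟩ : ∃ w0, eval w0 (∏ j : I, p j) ≠ 0 := by
      by_contra hcon
      push Not at hcon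
      exact hprod (MvPolynomial.funext fun x => by simpa using hcon x)
    intro hdet
    have h1 : (restrictLine w0 ![1, 0]).toRingHom A.det = 0 := by rw [hdet, map_zero]
    rw [RingHom.map_det] at h1
    refine det_casoratiMatrix_ne_zero e (fun j : I => c j) ?_
      (fun j : I => restrictLine w0 ![1, 0] (p j)) ?_ (Eq.trans ?_ h1)
    · intro a b hab
      exact Subtype.ext (hc (hI a).1 (hI b).1 hab)
    · intro j h0
      apply hw0
      rw [map_prod]
      refine Finset.prod_eq_zero (Finset.mem_univ j) ?_
      have := eval_restrictLine w0 ![1, 0] (p j) 0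
      rw [h0] at this
      simpa using this.symm
    · congr 1
      ext1 i j
      apply Polynomial.funext
      intro t
      simp only [casoratiMatrix, Matrix.of_apply, A, RingHom.mapMatrix_apply, Matrix.map_apply,
        AlgHom.toRingHom_eq_coe, RingHom.coe_coe, eval_restrictLine, map_mul, eval_shiftVars,
        Polynomial.eval_mul, Polynomial.eval_C, Polynomial.eval_comp, eval_C]
      have hw : w0 + (Polynomial.X + Polynomial.C ((e.symm i : ℕ) : ℝ)).eval t • ![1, 0] =
          w0 + t • ![1, 0] + ((e.symm i : ℕ) : ℝ) • ![1, 0] := by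
        simp only [Polynomial.eval_add, Polynomial.eval_X, Polynomial.eval_C, add_smul, add_assoc]
      rw [hw]
  · rw [Matrix.det_apply]
    refine totalDegree_finsetSum_le fun π _ => ?_
    have : (∏ i, A (π i) i).totalDegree ≤ L * (T - 1) := by
      refine (totalDegree_finsetProd _ _).trans ?_
      refine (Finset.sum_le_card_nsmul _ _ (T - 1) fun j _ => ?_).trans ?_
      · refine (totalDegree_mul _ _).trans ?_
        rw [totalDegree_C, zero_add, totalDegree_shiftVars]
        have := hp j (hI j).1
        omega
      · rw [Finset.card_univ, Fintype.card_coe, smul_eq_mul]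
        exact Nat.mul_le_mul_right _ hcardS
    rcases Int.units_eq_one_or (Equiv.Perm.sign π) with h | h <;> simpa [h] using this
  · rintro w ⟨η, hη, hsum⟩
    rw [RingHom.map_det]
    refine Matrix.det_eq_zero_of_mulVec _ (fun j : I => η j) ?_ ?_
    · intro h0
      exact hη σ0 (congrFun h0 ⟨σ0, by simp [hS, hσ0, hne]⟩)
    · intro i
      have h1 := hsum (e.symm i) ((e.symm i).2.trans_le hcardS)
      have h2 : ∑ σ ∈ S, eval (w + ((e.symm i : ℕ) : ℝ) • ![1, 0]) (p σ) *
          c σ ^ (e.symm i : ℕ) * η σ = 0 := by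
        refine Eq.trans ?_ h1
        refine Finset.sum_subset (Finset.filter_subset _ _) fun σ hσ hσ' => ?_
        have : p σ = 0 := by
          by_contra hne'
          exact hσ' (Finset.mem_filter.2 ⟨hσ, hne'⟩)
        simp [this]
      refine Eq.trans ?_ h2
      rw [← Finset.sum_coe_sort S]
      refine Finset.sum_congr rfl fun j _ => ?_
      simp only [A, RingHom.mapMatrix_apply, Matrix.map_apply, Matrix.of_apply, map_mul, eval_C,
        eval_shiftVars]
      ring

section Bezout
open MvPolynomial

lemma finrank_restrictTotalDegree_two (n : ℕ) :
    2 * Module.finrank ℝ (restrictTotalDegree (Fin 2) ℝ n) = (n + 1) * (n + 2) := by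
  rw [restrictTotalDegree, Module.finrank_eq_nat_card_basis (basisRestrictSupport ℝ
    {s : Fin 2 →₀ ℕ | (s.sum fun _ e => e) ≤ n})]
  have hsum : ∀ s : Fin 2 →₀ ℕ, (s.sum fun _ e => e) = s 0 + s 1 := by
    intro s
    rw [Finsupp.sum_fintype _ _ (fun _ => rfl), Fin.sum_univ_two]
  let T : Finset (ℕ × ℕ) := (range (n + 1)).biUnion fun k => antidiagonal k
  have hT : ∀ x, x ∈ T ↔ x.1 + x.2 ≤ n := by
    intro x
    simp only [T, Finset.mem_biUnion, Finset.mem_range, Finset.HasAntidiagonal.mem_antidiagonal]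
    constructor
    · rintro ⟨k, hk, h⟩; omega
    · intro h; exact ⟨_, by omega, rfl⟩
  have hcard : Nat.card {s : Fin 2 →₀ ℕ | (s.sum fun _ e => e) ≤ n} = T.card := by
    rw [← Nat.card_eq_finsetCard]
    refine Nat.card_congr ((Finsupp.equivFunOnFinite.trans (finTwoArrowEquiv ℕ)).subtypeEquiv ?_)
    intro s
    rw [hT, Set.mem_ofPred_eq, hsum]
    rfl
  have hcard2 : T.card = ∑ k ∈ range (n + 1), (k + 1) := by
    rw [Finset.card_biUnion]
    · simp
    · intro a _ b _ hab
      rw [Function.onFun, Finset.disjoint_left]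
      intro x hx hx'
      rw [Finset.HasAntidiagonal.mem_antidiagonal] at hx hx'
      omega
  rw [hcard, hcard2]
  clear * -
  induction n with
  | zero => simp
  | succ n ih => rw [Finset.sum_range_succ, mul_add, ih]; ring

lemma exists_interpolation {σ : Type*} [Nonempty σ] (Z : Finset (σ → ℝ)) (y : (σ → ℝ) → ℝ) :
    ∃ f : MvPolynomial σ ℝ, f.totalDegree ≤ Z.card ∧ ∀ z ∈ Z, eval z f = y z := by
  classical
  have hsep : ∀ z w : σ → ℝ, z ≠ w → ∃ i, z i ≠ w i := fun z w h => Function.ne_iff.1 h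
  choose! i hi using hsep
  let g : (σ → ℝ) → MvPolynomial σ ℝ := fun z =>
    ∏ w ∈ Z.erase z, (C (z (i z w) - w (i z w))⁻¹ * (X (i z w) - C (w (i z w))))
  refine ⟨∑ z ∈ Z, C (y z) * g z, ?_, ?_⟩
  · refine totalDegree_finsetSum_le fun z hz => ?_
    refine (totalDegree_mul _ _).trans ?_
    rw [totalDegree_C, zero_add]
    refine (totalDegree_finsetProd _ _).trans ?_
    refine (Finset.sum_le_card_nsmul _ _ 1 fun w _ => ?_).trans ?_
    · refine (totalDegree_mul _ _).trans ?_
      rw [totalDegree_C, zero_add]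
      refine (totalDegree_sub _ _).trans (by simp)
    · simpa using Finset.card_le_card (Finset.erase_subset z Z)
  · intro z hz
    rw [map_sum, Finset.sum_eq_single z]
    · simp only [g, map_mul, eval_C, map_prod, map_sub, eval_X]
      rw [Finset.prod_eq_one, mul_one]
      intro w hw
      exact inv_mul_cancel₀ (sub_ne_zero.2 (hi z w (Finset.ne_of_mem_erase hw).symm))
    · intro w hw hwz
      simp only [g, map_mul, eval_C, map_prod, map_sub, eval_X]
      rw [Finset.prod_eq_zero (Finset.mem_erase.2 ⟨hwz.symm, hz⟩) (by simp), mul_zero]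
    · intro h; exact absurd hz h

/-- A weak form of Bézout's theorem for affine plane curves. -/
lemma card_le_of_isRelPrime (f g : MvPolynomial (Fin 2) ℝ) (hf : f ≠ 0) (hg : g ≠ 0)
    (hfg : IsRelPrime f g) (Z : Finset (Fin 2 → ℝ)) (hZf : ∀ z ∈ Z, eval z f = 0)
    (hZg : ∀ z ∈ Z, eval z g = 0) : Z.card ≤ f.totalDegree * g.totalDegree := by
  classical
  set a := f.totalDegree with ha
  set b := g.totalDegree with hb
  set c := Z.card with hc
  let V : ℕ → Submodule ℝ (MvPolynomial (Fin 2) ℝ) := fun n => restrictTotalDegree (Fin 2) ℝ n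
  have hVfin : ∀ n, Module.Finite ℝ (V n) := fun n => by
    simp only [V]; infer_instance
  have hV : ∀ n p, p ∈ V n ↔ p.totalDegree ≤ n := fun n p => mem_restrictTotalDegree (Fin 2) n p
  have hVd : ∀ n, 2 * Module.finrank ℝ (V n) = (n + 1) * (n + 2) :=
    finrank_restrictTotalDegree_two
  let n := a + b + c
  let m : MvPolynomial (Fin 2) ℝ → MvPolynomial (Fin 2) ℝ →ₗ[ℝ] MvPolynomial (Fin 2) ℝ :=
    fun p => LinearMap.mulLeft ℝ p
  have hm : ∀ p, p ≠ 0 → Function.Injective (m p) := fun p hp x y h => mul_left_cancel₀ hp h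
  let W1 := (V (b + c)).map (m f)
  let W2 := (V (a + c)).map (m g)
  have hW1 : Module.finrank ℝ W1 = Module.finrank ℝ (V (b + c)) :=
    (Submodule.equivMapOfInjective _ (hm f hf) _).finrank_eq.symm
  have hW2 : Module.finrank ℝ W2 = Module.finrank ℝ (V (a + c)) :=
    (Submodule.equivMapOfInjective _ (hm g hg) _).finrank_eq.symm
  have hinf : W1 ⊓ W2 ≤ (V c).map (m (f * g)) := by
    rintro p ⟨⟨u, hu, hup⟩, ⟨v, hv, hvp⟩⟩
    have huv : f * u = g * v := hup.trans hvp.symm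
    have h1 : g ∣ u := hfg.symm.dvd_of_dvd_mul_left ⟨v, huv⟩
    obtain ⟨w, rfl⟩ := h1
    refine ⟨w, ?_, ?_⟩
    · rw [SetLike.mem_coe, hV]
      by_cases hw : w = 0
      · simp [hw]
      · have := (hV _ _).1 hu
        rw [totalDegree_mul_of_isDomain hg hw] at this
        omega
    · rw [← hup]; simp [m]
  let ev : MvPolynomial (Fin 2) ℝ →ₗ[ℝ] (Z → ℝ) :=
    LinearMap.pi fun z => (aeval (R := ℝ) (z : Fin 2 → ℝ)).toLinearMap
  have hev : ∀ p z, ev p z = eval (z : Fin 2 → ℝ) p := fun p z => by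
    simp [ev, aeval_eq_eval]
  have hsup : W1 ⊔ W2 ≤ (LinearMap.ker (ev.domRestrict (V n))).map (V n).subtype := by
    rw [sup_le_iff]
    constructor
    · rintro p ⟨u, hu, rfl⟩
      have hd : f * u ∈ V n := by
        rw [hV]
        have := (hV _ _).1 hu
        refine (totalDegree_mul _ _).trans ?_
        simp only [n]; omega
      refine ⟨⟨f * u, hd⟩, ?_, rfl⟩
      rw [SetLike.mem_coe, LinearMap.mem_ker]
      ext z
      rw [LinearMap.domRestrict_apply, hev, map_mul, hZf z z.2, zero_mul]; rfl
    · rintro p ⟨u, hu, rfl⟩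
      have hd : g * u ∈ V n := by
        rw [hV]
        have := (hV _ _).1 hu
        refine (totalDegree_mul _ _).trans ?_
        simp only [n]; omega
      refine ⟨⟨g * u, hd⟩, ?_, rfl⟩
      rw [SetLike.mem_coe, LinearMap.mem_ker]
      ext z
      rw [LinearMap.domRestrict_apply, hev, map_mul, hZg z z.2, zero_mul]; rfl
  have hsurj : LinearMap.range (ev.domRestrict (V n)) = ⊤ := by
    rw [LinearMap.range_eq_top]
    intro y
    obtain ⟨p, hp, hpy⟩ := exists_interpolation Z (fun z => if h : z ∈ Z then y ⟨z, h⟩ else 0)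
    refine ⟨⟨p, (hV _ _).2 (hp.trans (by simp only [n]; omega))⟩, ?_⟩
    ext z
    rw [LinearMap.domRestrict_apply, hev, hpy z z.2, dif_pos z.2]
  have r1 := LinearMap.finrank_range_add_finrank_ker (ev.domRestrict (V n))
  rw [hsurj, finrank_top, Module.finrank_fintype_fun_eq_card, Fintype.card_coe] at r1
  have r2 := Submodule.finrank_sup_add_finrank_inf_eq W1 W2
  have r3 := (Submodule.finrank_mono hinf).trans (Submodule.finrank_map_le _ _)
  have r4 := (Submodule.finrank_mono hsup).trans (Submodule.finrank_map_le _ _)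
  have e1 := hVd n
  have e2 := hVd (b + c)
  have e3 := hVd (a + c)
  have e4 := hVd c
  rw [hW1, hW2] at r2
  have key : 2 * c + 2 * Module.finrank ℝ (V (b + c)) + 2 * Module.finrank ℝ (V (a + c)) ≤
      2 * Module.finrank ℝ (V n) + 2 * Module.finrank ℝ (V c) := by omega
  rw [e1, e2, e3, e4] at key
  simp only [n] at key
  nlinarith [key]

end Bezout

section Planar
open MvPolynomial

/-- The planar cross product. -/
def cross (κ x : Fin 2 → ℝ) : ℝ := κ 0 * x 1 - κ 1 * x 0

lemma Polynomial.eval_eq_eval_zero_of_periodic (P : Polynomial ℝ) (c : ℝ)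
    (h : P.comp (Polynomial.X + Polynomial.C 1) = Polynomial.C c * P) (t : ℝ) :
    P.eval t = P.eval 0 := by
  by_cases hP : P = 0
  · simp [hP]
  have hc : c = 1 := by
    have h1 := congrArg Polynomial.leadingCoeff h
    rw [Polynomial.leadingCoeff_comp (by rw [Polynomial.natDegree_X_add_C]; exact one_ne_zero),
      Polynomial.leadingCoeff_X_add_C, one_pow, mul_one, Polynomial.leadingCoeff_mul,
      Polynomial.leadingCoeff_C] at h1
    exact (mul_right_cancel₀ (Polynomial.leadingCoeff_ne_zero.2 hP)
      (by rw [one_mul]; exact h1)).symm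
  have h1 : ∀ s, P.eval (s + 1) = P.eval s := fun s => by
    have := congrArg (Polynomial.eval s) h
    simpa [hc] using this
  have h2 : ∀ n : ℕ, P.eval (n : ℝ) = P.eval 0 := by
    intro n
    induction n with
    | zero => simp
    | succ n ih => rw [Nat.cast_succ, h1, ih]
  have h3 : P - Polynomial.C (P.eval 0) = 0 := by
    refine Polynomial.eq_zero_of_infinite_isRoot _ ?_
    refine Set.Infinite.mono (s := Set.range (fun n : ℕ => (n : ℝ))) ?_
      (Set.infinite_range_of_injective Nat.cast_injective)
    rintro _ ⟨n, rfl⟩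
    simp [Polynomial.IsRoot.def, h2]
  have := congrArg (Polynomial.eval t) h3
  simpa [sub_eq_zero] using this

lemma eval_add_smul_of_associated {q : MvPolynomial (Fin 2) ℝ} {κ : Fin 2 → ℝ}
    (h : Associated (shiftVars κ q) q) (w : Fin 2 → ℝ) (t : ℝ) :
    eval (w + t • κ) q = eval w q := by
  obtain ⟨u, hu⟩ := h.symm
  obtain ⟨c, -, hc⟩ := isUnit_iff_eq_C_of_isReduced.1 u.isUnit
  have h1 := Polynomial.eval_eq_eval_zero_of_periodic (restrictLine w κ q) c (by
    apply Polynomial.funext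
    intro s
    rw [Polynomial.eval_comp, Polynomial.eval_mul, Polynomial.eval_C, eval_restrictLine,
      eval_restrictLine]
    have := congrArg (eval (w + s • κ)) hu
    rw [hc, map_mul, eval_C, eval_shiftVars] at this
    rw [mul_comm, this]
    congr 1
    simp [add_smul, add_assoc]) t
  rw [eval_restrictLine, eval_restrictLine] at h1
  simpa using h1

lemma cross_eq_zero_of_associated {q : MvPolynomial (Fin 2) ℝ} (hq : Irreducible q)
    {κ κ' : Fin 2 → ℝ} (h : Associated (shiftVars κ q) q)
    (h' : Associated (shiftVars κ' q) q) : cross κ κ' = 0 := by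
  by_contra hne
  have hconst : ∀ w, eval w q = eval 0 q := by
    intro w
    have : w = (0 + (cross w κ' / cross κ κ') • κ) + (cross κ w / cross κ κ') • κ' := by
      have hne' : κ 0 * κ' 1 - κ 1 * κ' 0 ≠ 0 := hne
      ext i
      fin_cases i
      · change w 0 = 0 + (w 0 * κ' 1 - w 1 * κ' 0) / (κ 0 * κ' 1 - κ 1 * κ' 0) * κ 0
          + (κ 0 * w 1 - κ 1 * w 0) / (κ 0 * κ' 1 - κ 1 * κ' 0) * κ' 0
        rw [zero_add, div_mul_eq_mul_div, div_mul_eq_mul_div, ← add_div, eq_div_iff hne']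
        ring
      · change w 1 = 0 + (w 0 * κ' 1 - w 1 * κ' 0) / (κ 0 * κ' 1 - κ 1 * κ' 0) * κ 1
          + (κ 0 * w 1 - κ 1 * w 0) / (κ 0 * κ' 1 - κ 1 * κ' 0) * κ' 1
        rw [zero_add, div_mul_eq_mul_div, div_mul_eq_mul_div, ← add_div, eq_div_iff hne']
        ring
    rw [this, eval_add_smul_of_associated h', eval_add_smul_of_associated h]
  have hqC : q = C (eval 0 q) := MvPolynomial.funext fun w => by rw [hconst, eval_C]
  have hne0 : eval 0 q ≠ 0 := fun h0 => hq.ne_zero (by rw [hqC, h0, C_0])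
  exact hq.not_isUnit (isUnit_iff_eq_C_of_isReduced.2 ⟨_, hne0.isUnit, hqC⟩)

lemma Irreducible.totalDegree_pos {σ : Type*} {q : MvPolynomial σ ℝ} (hq : Irreducible q) :
    1 ≤ q.totalDegree := by
  by_contra h
  have h0 : q.totalDegree = 0 := by omega
  have h1 := totalDegree_eq_zero_iff_eq_C.1 h0
  refine hq.not_isUnit (isUnit_iff_eq_C_of_isReduced.2 ⟨_, ?_, h1⟩)
  refine IsUnit.mk0 _ fun h2 => hq.ne_zero ?_
  rw [h1, h2, C_0]

lemma irreducible_shiftVars {σ : Type*} {q : MvPolynomial σ ℝ} (hq : Irreducible q) (v : σ → ℝ) :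
    Irreducible (shiftVars v q) := by
  let e : MvPolynomial σ ℝ ≃* MvPolynomial σ ℝ :=
    { toFun := shiftVars v
      invFun := shiftVars (-v)
      left_inv := fun p => shiftVars_neg_shiftVars v p
      right_inv := fun p => by rw [shiftVars_shiftVars]; simp
      map_mul' := fun p q => map_mul _ p q }
  exact (MulEquiv.irreducible_iff e).2 hq

/-- A nonzero polynomial has few pairwise nonassociated irreducible factors. -/
lemma card_image_mk_le_totalDegree {σ τ : Type*} {f : MvPolynomial σ ℝ} (hf : f ≠ 0)
    (G : Finset τ) (q : τ → MvPolynomial σ ℝ) (hq : ∀ a ∈ G, Irreducible (q a))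
    (hqf : ∀ a ∈ G, q a ∣ f) [DecidableEq (Associates (MvPolynomial σ ℝ))] :
    (G.image fun a => Associates.mk (q a)).card ≤ f.totalDegree := by
  classical
  obtain ⟨G', hG', hinj, himg⟩ := Finset.exists_subset_injOn_image_eq_of_surjOn
    (f := fun a => Associates.mk (q a)) (s := (G : Set τ))
    (t := G.image fun a => Associates.mk (q a))
    (by intro x hx; simpa using hx)
  have hsub : ∀ a ∈ G', a ∈ G := fun a ha => hG' ha
  have hdvd : ∏ a ∈ G', q a ∣ f := by
    refine Finset.prod_dvd_of_isRelPrime ?_ fun a ha => hqf a (hsub a ha)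
    intro a ha b hb hab
    rw [Function.onFun, (hq a (hsub a ha)).isRelPrime_iff_not_dvd]
    intro h
    apply hab
    apply hinj ha hb
    exact Associates.mk_eq_mk_iff_associated.2
      ((hq a (hsub a ha)).associated_of_dvd (hq b (hsub b hb)) h)
  have h1 := totalDegree_le_of_dvd_of_isDomain hdvd hf
  have h2 : ∀ S ⊆ G', S.card ≤ (∏ a ∈ S, q a).totalDegree := by
    intro S
    induction S using Finset.induction_on with
    | empty => simp
    | insert a S ha ih =>
      intro hS
      have haG := hsub a (hS (Finset.mem_insert_self a S))
      have hSG : S ⊆ G' := fun b hb => hS (Finset.mem_insert_of_mem hb)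
      rw [Finset.prod_insert ha, Finset.card_insert_of_notMem ha,
        totalDegree_mul_of_isDomain (hq a haG).ne_zero
          (Finset.prod_ne_zero_iff.2 fun b hb => (hq b (hsub b (hSG hb))).ne_zero)]
      have := ih hSG
      have := (hq a haG).totalDegree_pos
      omega
  rw [← himg, Finset.card_image_of_injOn hinj]
  exact (h2 G' subset_rfl).trans h1

/-- A plane curve vanishing on a sumset `W + G` of large sets forces `G` to lie on few parallel
lines. -/
lemma exists_direction (f : MvPolynomial (Fin 2) ℝ) (hf : f ≠ 0) {d : ℕ} (hd : f.totalDegree ≤ d)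
    (W G : Finset (Fin 2 → ℝ)) (hW : d ^ 2 < W.card) (hG : d < G.card)
    (hv : ∀ w ∈ W, ∀ γ ∈ G, eval (w + γ) f = 0) :
    ∃ γ ∈ G, ∃ γ' ∈ G, γ ≠ γ' ∧ (G.image fun x => cross (γ - γ') x).card ≤ d := by
  classical
  obtain ⟨γ0, hγ0⟩ : G.Nonempty := Finset.card_pos.1 (by omega)
  obtain ⟨w0, hw0⟩ : W.Nonempty := Finset.card_pos.1 (by omega)
  set f1 := shiftVars γ0 f with hf1
  have hf10 : f1 ≠ 0 := shiftVars_ne_zero _ hf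
  have hvan : ∀ w ∈ W, ∀ γ ∈ G, eval w (shiftVars γ f) = 0 := fun w hw γ hγ => by
    rw [eval_shiftVars]; exact hv w hw γ hγ
  by_cases hcase : ∀ q, Irreducible q → q ∣ f1 → ∃ γ ∈ G, ¬ q ∣ shiftVars γ f
  · exfalso
    let Φ : ((Fin 2 → ℝ) → ℝ) →ₗ[ℝ] MvPolynomial (Fin 2) ℝ :=
      ∑ γ ∈ G, (LinearMap.proj γ).smulRight (shiftVars γ f)
    have hΦ : ∀ c, Φ c = ∑ γ ∈ G, c γ • shiftVars γ f := fun c => by simp [Φ]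
    let U : MvPolynomial (Fin 2) ℝ → Subspace ℝ ((Fin 2 → ℝ) → ℝ) := fun q =>
      ((Ideal.span {q}).restrictScalars ℝ).comap Φ
    have hU : ∀ q c, c ∈ U q ↔ q ∣ Φ c := fun q c => by
      simp [U, Ideal.mem_span_singleton]
    let F := (UniqueFactorizationMonoid.factors f1).toFinset
    have hFirr : ∀ q ∈ F, Irreducible q ∧ q ∣ f1 := fun q hq => by
      rw [Multiset.mem_toFinset] at hq
      exact ⟨UniqueFactorizationMonoid.irreducible_of_factor q hq,
        UniqueFactorizationMonoid.dvd_of_mem_factors hq⟩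
    have htop : ⊤ ∉ F.image U := by
      intro h
      obtain ⟨q, hq, hqU⟩ := Finset.mem_image.1 h
      obtain ⟨γ, hγ, hnd⟩ := hcase q (hFirr q hq).1 (hFirr q hq).2
      apply hnd
      have : (Pi.single γ 1 : (Fin 2 → ℝ) → ℝ) ∈ U q := by rw [hqU]; trivial
      rw [hU, hΦ, Finset.sum_eq_single γ] at this
      · simpa using this
      · intro b _ hb; simp [hb]
      · intro h; exact absurd hγ h
    obtain ⟨c, hc⟩ := (Set.ne_univ_iff_exists_notMem _).1
      (Subspace.biUnion_ne_univ_of_top_notMem htop)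
    have hc' : ∀ q ∈ F, ¬ q ∣ Φ c := by
      intro q hq hdvd
      apply hc
      simp only [Set.mem_iUnion]
      exact ⟨U q, Finset.mem_image_of_mem U hq, (hU q c).2 hdvd⟩
    have hc'' : ∀ q, Irreducible q → q ∣ f1 → ¬ q ∣ Φ c := by
      intro q hq hqf hdvd
      obtain ⟨q', hq', hass⟩ := UniqueFactorizationMonoid.exists_mem_factors_of_dvd hf10 hq hqf
      exact hc' q' (Multiset.mem_toFinset.2 hq') (hass.symm.dvd.trans hdvd)
    have hrel : IsRelPrime f1 (Φ c) :=
      WfDvdMonoid.isRelPrime_of_no_irreducible_factors (fun h => hf10 h.1) hc''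
    have hnu : ¬ IsUnit f1 := by
      intro hu
      obtain ⟨r, hr, hrC⟩ := isUnit_iff_eq_C_of_isReduced.1 hu
      have := hvan w0 hw0 γ0 hγ0
      rw [← hf1, hrC, eval_C] at this
      exact hr.ne_zero this
    have hΦ0 : Φ c ≠ 0 := by
      intro h0
      obtain ⟨q, hq, hqf⟩ := WfDvdMonoid.exists_irreducible_factor hnu hf10
      exact hc'' q hq hqf (by rw [h0]; exact dvd_zero q)
    have hbez := card_le_of_isRelPrime f1 (Φ c) hf10 hΦ0 hrel W
      (fun w hw => hvan w hw γ0 hγ0) (fun w hw => by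
        rw [hΦ, map_sum]
        refine Finset.sum_eq_zero fun γ hγ => ?_
        rw [smul_eval, hvan w hw γ hγ, mul_zero])
    have h1 : f1.totalDegree ≤ d := by rw [hf1, totalDegree_shiftVars]; exact hd
    have h2 : (Φ c).totalDegree ≤ d := by
      rw [hΦ]
      refine totalDegree_finsetSum_le fun γ _ => ?_
      refine (totalDegree_smul_le _ _).trans ?_
      rw [totalDegree_shiftVars]; exact hd
    have := Nat.mul_le_mul h1 h2
    rw [← pow_two] at this
    omega
  · push Not at hcase
    obtain ⟨q, hq, -, hqG⟩ := hcase
    have hdvd : ∀ γ ∈ G, shiftVars (-γ) q ∣ f := by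
      intro γ hγ
      have := map_dvd (shiftVars (-γ)) (hqG γ hγ)
      rwa [shiftVars_neg_shiftVars] at this
    have hcard := card_image_mk_le_totalDegree hf G (fun γ => shiftVars (-γ) q)
      (fun γ _ => irreducible_shiftVars hq _) hdvd
    have hper : ∀ γ γ' : Fin 2 → ℝ, Associates.mk (shiftVars (-γ) q) =
        Associates.mk (shiftVars (-γ') q) → Associated (shiftVars (γ - γ') q) q := by
      intro γ γ' h
      have h1 := (Associates.mk_eq_mk_iff_associated.1 h).symm.map (shiftVars γ)
      rw [shiftVars_shiftVars, shiftVars_shiftVars, add_neg_cancel, shiftVars_zero,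
        ← sub_eq_add_neg] at h1
      exact h1
    obtain ⟨γ, hγ, γ', hγ', hne, heq⟩ := Finset.exists_ne_map_eq_of_card_lt_of_maps_to
      (hcard.trans_lt (hd.trans_lt hG)) (fun γ hγ => Finset.mem_image_of_mem
        (fun γ => Associates.mk (shiftVars (-γ) q)) hγ)
    refine ⟨γ, hγ, γ', hγ', hne, ?_⟩
    refine le_trans ?_ (hcard.trans hd)
    refine Finset.card_le_card_of_surjOn (fun a => if h : ∃ x ∈ G, Associates.mk
      (shiftVars (-x) q) = a then cross (γ - γ') h.choose else 0) ?_
    intro y hy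
    obtain ⟨x, hx, rfl⟩ := Finset.mem_image.1 (Finset.mem_coe.1 hy)
    refine ⟨Associates.mk (shiftVars (-x) q), ?_, ?_⟩
    · exact Finset.mem_coe.2
        (Finset.mem_image_of_mem (fun γ => Associates.mk (shiftVars (-γ) q)) hx)
    · have hex : ∃ z ∈ G, Associates.mk (shiftVars (-z) q) = Associates.mk (shiftVars (-x) q) :=
        ⟨x, hx, rfl⟩
      simp only [dif_pos hex]
      have h1 := cross_eq_zero_of_associated hq (hper γ γ' heq) (hper _ _ hex.choose_spec.2)
      simp only [cross, Pi.sub_apply] at h1 ⊢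
      linarith

end Planar

section Counting

/-- The integral points of a box. -/
def boxPoints (r₁ r₂ r₃ : ℕ) : Finset (ℕ × ℕ × ℕ) := range r₁ ×ˢ range r₂ ×ˢ range r₃

lemma mem_boxPoints {r₁ r₂ r₃ : ℕ} {s : ℕ × ℕ × ℕ} :
    s ∈ boxPoints r₁ r₂ r₃ ↔ s.1 < r₁ ∧ s.2.1 < r₂ ∧ s.2.2 < r₃ := by
  simp [boxPoints]

lemma card_boxPoints (r₁ r₂ r₃ : ℕ) : (boxPoints r₁ r₂ r₃).card = r₁ * (r₂ * r₃) := by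
  simp [boxPoints]

/-- The integral linear form with coefficients `A`, `B`, `C`. -/
def intForm (A B C : ℤ) (s : ℕ × ℕ × ℕ) : ℤ := A * s.1 + B * s.2.1 + C * s.2.2

lemma Int.eq_of_dvd_sub_of_lt {c : ℤ} {n i j : ℕ} (hn : (n : ℤ) ≤ |c|) (hi : i < n) (hj : j < n)
    (h : c ∣ (i : ℤ) - j) : i = j := by
  have h1 := Int.eq_zero_of_abs_lt_dvd ((abs_dvd c _).2 h) (by rw [abs_lt]; omega)
  omega

lemma le_card_image_intForm_of_injOn {A B C : ℤ} {r₁ r₂ r₃ t₁ t₂ t₃ : ℕ} (h₁ : t₁ ≤ r₁)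
    (h₂ : t₂ ≤ r₂) (h₃ : t₃ ≤ r₃)
    (h : ∀ s ∈ boxPoints t₁ t₂ t₃, ∀ s' ∈ boxPoints t₁ t₂ t₃,
      intForm A B C s = intForm A B C s' → s = s') :
    t₁ * (t₂ * t₃) ≤ ((boxPoints r₁ r₂ r₃).image (intForm A B C)).card := by
  rw [← card_boxPoints, ← Finset.card_image_of_injOn (s := boxPoints t₁ t₂ t₃)
    (f := intForm A B C) (fun s hs s' hs' => h s hs s' hs')]
  refine Finset.card_le_card (Finset.image_subset_image fun s hs => ?_)
  rw [mem_boxPoints] at hs ⊢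
  omega

lemma min_mul_le_card_image_intForm {A B : ℤ} (C : ℤ) (hAB : IsCoprime A B) {r₁ r₂ r₃ : ℕ}
    (h₃ : 0 < r₃) :
    r₁ * min A.natAbs r₂ ≤ ((boxPoints r₁ r₂ r₃).image (intForm A B C)).card := by
  by_cases hA : A = 0
  · simp [hA]
  have := le_card_image_intForm_of_injOn (A := A) (B := B) (C := C) (t₁ := r₁)
    (t₂ := min A.natAbs r₂) (t₃ := 1) le_rfl (min_le_right _ r₂) h₃ (by
      rintro ⟨i, j, l⟩ hs ⟨i', j', l'⟩ hs' h
      rw [mem_boxPoints] at hs hs'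
      simp only [intForm] at h hs hs'
      obtain rfl : l = 0 := by omega
      obtain rfl : l' = 0 := by omega
      have hd : A ∣ B * ((j : ℤ) - j') := ⟨i' - i, by linear_combination h⟩
      have hj : j = j' := Int.eq_of_dvd_sub_of_lt (c := A) (n := min A.natAbs r₂)
        (by rw [Int.abs_eq_natAbs]; exact_mod_cast min_le_left _ _) hs.2.1 hs'.2.1
        (hAB.dvd_of_dvd_mul_left hd)
      subst hj
      have : A * ((i : ℤ) - i') = 0 := by linear_combination h
      have : i = i' := by
        rcases mul_eq_zero.1 this with h | h
        · exact absurd h hA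
        · omega
      rw [this])
  simpa using this

lemma min_mul_le_card_image_intForm' {A B : ℤ} (C : ℤ) (hAB : IsCoprime A B) {r₁ r₂ r₃ : ℕ}
    (h₃ : 0 < r₃) :
    min B.natAbs r₁ * r₂ ≤ ((boxPoints r₁ r₂ r₃).image (intForm A B C)).card := by
  by_cases hB : B = 0
  · simp [hB]
  have := le_card_image_intForm_of_injOn (A := A) (B := B) (C := C) (t₁ := min B.natAbs r₁)
    (t₂ := r₂) (t₃ := 1) (min_le_right _ r₁) le_rfl h₃ (by
      rintro ⟨i, j, l⟩ hs ⟨i', j', l'⟩ hs' h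
      rw [mem_boxPoints] at hs hs'
      simp only [intForm] at h hs hs'
      obtain rfl : l = 0 := by omega
      obtain rfl : l' = 0 := by omega
      have hd : B ∣ A * ((i : ℤ) - i') := ⟨j' - j, by linear_combination h⟩
      have hi : i = i' := Int.eq_of_dvd_sub_of_lt (c := B) (n := min B.natAbs r₁)
        (by rw [Int.abs_eq_natAbs]; exact_mod_cast min_le_left _ _) hs.1 hs'.1
        (hAB.symm.dvd_of_dvd_mul_left hd)
      subst hi
      have : B * ((j : ℤ) - j') = 0 := by linear_combination h
      have : j = j' := by
        rcases mul_eq_zero.1 this with h | h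
        · exact absurd h hB
        · omega
      rw [this])
  simpa using this

lemma natAbs_mul_le_card_image_intForm {A B C : ℤ} (hA : A ≠ 0) (hAB : IsCoprime A B)
    {r₁ r₂ r₃ : ℕ} (hA₂ : A.natAbs ≤ r₂)
    (h₁₃ : ((boxPoints r₁ r₂ r₃).image (intForm A B C)).card < r₁ * r₃) :
    C.natAbs * r₃ ≤ ((boxPoints r₁ r₂ r₃).image (intForm A B C)).card := by
  by_cases hC : C = 0
  · simp [hC]
  obtain ⟨A', hA'⟩ := Int.gcd_dvd_left A C
  obtain ⟨C', hC'⟩ := Int.gcd_dvd_right A C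
  set e := Int.gcd A C with he
  have hepos : 0 < e := Int.gcd_pos_of_ne_zero_left _ hA
  have hcop : IsCoprime A' C' := by
    have h1 : Int.gcd A C = e * Int.gcd A' C' := by
      conv_lhs => rw [hA', hC', Int.gcd_mul_left]
      simp
    rw [← he] at h1
    rw [Int.isCoprime_iff_gcd_eq_one]
    exact (Nat.mul_right_cancel hepos (by rw [one_mul, mul_comm]; exact h1)).symm
  have hC'0 : C' ≠ 0 := by rintro rfl; simp at hC'; exact hC hC'
  have heA : e ≤ r₂ := (Nat.le_of_dvd (Int.natAbs_pos.2 hA) (by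
    have := Int.natAbs_dvd_natAbs.2 (Dvd.intro _ hA'.symm); simpa using this)).trans hA₂
  have heB : IsCoprime (e : ℤ) B := hAB.of_isCoprime_of_dvd_left (Dvd.intro _ hA'.symm)
  have key := le_card_image_intForm_of_injOn (A := A) (B := B) (C := C) (t₁ := min C'.natAbs r₁)
    (t₂ := e) (t₃ := r₃) (min_le_right _ r₁) heA le_rfl (by
      rintro ⟨i, j, l⟩ hs ⟨i', j', l'⟩ hs' h
      rw [mem_boxPoints] at hs hs'
      simp only [intForm] at h hs hs'
      have hd : (e : ℤ) ∣ B * ((j : ℤ) - j') :=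
        ⟨A' * (i' - i) + C' * (l' - l), by
          rw [hA', hC'] at h; linear_combination h⟩
      have hj : j = j' := Int.eq_of_dvd_sub_of_lt (c := e) (n := e) (le_abs_self _) hs.2.1 hs'.2.1
        (heB.dvd_of_dvd_mul_left hd)
      subst hj
      have h2 : A' * ((i : ℤ) - i') + C' * ((l : ℤ) - l') = 0 := by
        have : (e : ℤ) * (A' * ((i : ℤ) - i') + C' * ((l : ℤ) - l')) = 0 := by
          rw [hA', hC'] at h; linear_combination h
        rcases mul_eq_zero.1 this with h | h
        · omega
        · exact h
      have hd' : C' ∣ A' * ((i : ℤ) - i') := ⟨l' - l, by linear_combination h2⟩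
      have hi : i = i' := Int.eq_of_dvd_sub_of_lt (c := C') (n := min C'.natAbs r₁)
        (by rw [Int.abs_eq_natAbs]; exact_mod_cast min_le_left _ _) hs.1 hs'.1
        (hcop.symm.dvd_of_dvd_mul_left hd')
      subst hi
      have : C' * ((l : ℤ) - l') = 0 := by linear_combination h2
      have : l = l' := by
        rcases mul_eq_zero.1 this with h | h
        · exact absurd h hC'0
        · omega
      rw [this])
  have hCabs : C.natAbs = e * C'.natAbs := by
    conv_lhs => rw [hC', Int.natAbs_mul]
    simp
  rcases le_total C'.natAbs r₁ with hle | hle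
  · rw [min_eq_left hle] at key
    calc C.natAbs * r₃ = C'.natAbs * (e * r₃) := by rw [hCabs]; ring
      _ ≤ _ := key
  · rw [min_eq_right hle] at key
    have : r₁ * r₃ ≤ r₁ * (e * r₃) := Nat.mul_le_mul_left _ (Nat.le_mul_of_pos_left _ hepos)
    omega

end Counting

section ZeroEstimate
open MvPolynomial

lemma cross_add (κ x y : Fin 2 → ℝ) : cross κ (x + y) = cross κ x + cross κ y := by
  simp only [cross, Pi.add_apply]; ring

lemma cross_smul (κ x : Fin 2 → ℝ) (t : ℝ) : cross κ (t • x) = t * cross κ x := by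
  simp only [cross, Pi.smul_apply, smul_eq_mul]; ring

lemma sq_add_sq_pos_of_ne_zero {κ : Fin 2 → ℝ} (hκ : κ ≠ 0) : 0 < κ 0 ^ 2 + κ 1 ^ 2 := by
  by_contra h
  apply hκ
  ext i
  fin_cases i
  · change κ 0 = 0; nlinarith [sq_nonneg (κ 0), sq_nonneg (κ 1)]
  · change κ 1 = 0; nlinarith [sq_nonneg (κ 0), sq_nonneg (κ 1)]

lemma exists_eq_add_smul_of_cross_eq {κ x v : Fin 2 → ℝ} (hκ : κ ≠ 0)
    (h : cross κ x = cross κ v) : ∃ t : ℝ, x = v + t • κ := by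
  have hD := sq_add_sq_pos_of_ne_zero hκ
  refine ⟨((x 0 - v 0) * κ 0 + (x 1 - v 1) * κ 1) / (κ 0 ^ 2 + κ 1 ^ 2), ?_⟩
  simp only [cross] at h
  ext i
  fin_cases i
  · change x 0 = v 0 + _ / _ * κ 0
    rw [← sub_eq_iff_eq_add', div_mul_eq_mul_div, eq_div_iff hD.ne']
    linear_combination -(κ 1) * h
  · change x 1 = v 1 + _ / _ * κ 1
    rw [← sub_eq_iff_eq_add', div_mul_eq_mul_div, eq_div_iff hD.ne']
    linear_combination (κ 0) * h

/-- A polynomial vanishing on more parallel lines than its degree is zero. -/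
lemma eq_zero_of_vanishing_on_lines {p : MvPolynomial (Fin 2) ℝ} {κ : Fin 2 → ℝ} (hκ : κ ≠ 0)
    (V : Finset (Fin 2 → ℝ)) (hV : p.totalDegree < (V.image (cross κ)).card)
    (h : ∀ v ∈ V, ∀ t : ℝ, eval (v + t • κ) p = 0) : p = 0 := by
  have hD := sq_add_sq_pos_of_ne_zero hκ
  refine MvPolynomial.funext fun w => ?_
  rw [map_zero]
  set u : Fin 2 → ℝ := ![-κ 1, κ 0] with hu
  have hcu : cross κ u = κ 0 ^ 2 + κ 1 ^ 2 := by simp [cross, hu]; ring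
  have h0 : restrictLine w u p = 0 := by
    refine Polynomial.eq_zero_of_natDegree_lt_card_of_eval_eq_zero' _
      ((V.image (cross κ)).image fun c => (c - cross κ w) / (κ 0 ^ 2 + κ 1 ^ 2)) ?_ ?_
    · intro t ht
      obtain ⟨c, hc, rfl⟩ := Finset.mem_image.1 ht
      obtain ⟨v, hv, rfl⟩ := Finset.mem_image.1 hc
      rw [eval_restrictLine]
      obtain ⟨t', ht'⟩ := exists_eq_add_smul_of_cross_eq (κ := κ) (v := v)
        (x := w + ((cross κ v - cross κ w) / (κ 0 ^ 2 + κ 1 ^ 2)) • u) hκ (by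
          rw [cross_add, cross_smul, hcu, div_mul_cancel₀ _ hD.ne']; ring)
      rw [ht']
      exact h v hv t'
    · rw [Finset.card_image_of_injective]
      · exact (natDegree_restrictLine_le _ _ _).trans_lt hV
      · intro a b hab
        simp only at hab
        rw [div_left_inj' hD.ne'] at hab
        linarith
  have := eval_restrictLine w u p 0
  rw [h0] at this
  simpa using this.symm

/-- The images of integral points in the plane. -/
def planePoint (N x : ℕ) (s : ℕ × ℕ × ℕ) : Fin 2 → ℝ := ![s.1 - N * s.2.2, s.2.1 + x * s.2.2]

lemma planePoint_add (N x : ℕ) (s t : ℕ × ℕ × ℕ) :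
    planePoint N x (s + t) = planePoint N x s + planePoint N x t := by
  ext i
  fin_cases i
  · simp [planePoint]; ring
  · simp [planePoint]; ring

lemma planePoint_injOn {N x r₁ r₂ r₃ : ℕ} (h : r₂ ≤ x) :
    Set.InjOn (planePoint N x) (boxPoints r₁ r₂ r₃) := by
  rintro ⟨i, j, l⟩ hs ⟨i', j', l'⟩ hs' he
  rw [Finset.mem_coe, mem_boxPoints] at hs hs'
  simp only at hs hs'
  have h1 := congrFun he 1
  have h0 := congrFun he 0
  simp only [planePoint, Matrix.cons_val_zero, Matrix.cons_val_one] at h0 h1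
  have h1' : (j : ℤ) + x * l = j' + x * l' := by exact_mod_cast h1
  have hj : j = j' := Int.eq_of_dvd_sub_of_lt (c := x) (n := r₂)
    (by rw [abs_of_nonneg (by positivity)]; exact_mod_cast h) hs.2.1 hs'.2.1
    ⟨l' - l, by linear_combination h1'⟩
  subst hj
  have hl : (x : ℤ) * (l - l') = 0 := by linear_combination h1'
  have hl : l = l' := by
    rcases mul_eq_zero.1 hl with h | h <;> omega
  subst hl
  have : i = i' := by
    have : (i : ℝ) = i' := by linarith
    exact_mod_cast this
  rw [this]

/-- The value at an integral point of the exponential monomial. -/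
noncomputable def expoPoint (α a g : ℝ) (s : ℕ × ℕ × ℕ) : ℝ := α ^ s.1 * a ^ s.2.1 * g ^ s.2.2

lemma expoPoint_add (α a g : ℝ) (s t : ℕ × ℕ × ℕ) :
    expoPoint α a g (s + t) = expoPoint α a g s * expoPoint α a g t := by
  simp only [expoPoint, Prod.fst_add, Prod.snd_add, pow_add]; ring

lemma cross_planePoint (N x : ℕ) {A B e : ℤ} {κ : Fin 2 → ℝ} (h0 : κ 0 = e * B)
    (h1 : κ 1 = -(e * A)) (s : ℕ × ℕ × ℕ) :
    cross κ (planePoint N x s) = e * (intForm A B (x * B - N * A) s : ℝ) := by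
  simp only [cross, h0, h1, planePoint, intForm, Matrix.cons_val_zero, Matrix.cons_val_one]
  push_cast
  ring

/-- If a plane curve of small degree vanishes on a large box of points, these points lie on few
parallel lines of some nonvertical and nonhorizontal integral direction. -/
lemma exists_integral_direction {N x d q₁ q₂ q₃ : ℕ} (hx : 2 * q₂ ≤ x) (hN : 2 * q₁ ≤ N)
    (h₁₂₃ : d ^ 2 < 8 * q₁ * q₂ * q₃) (h₁₃ : d < 4 * q₁ * q₃) (h₂₃ : d < 4 * q₂ * q₃)
    {f : MvPolynomial (Fin 2) ℝ} (hf : f ≠ 0) (hd : f.totalDegree ≤ d)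
    (hv : ∀ s ∈ boxPoints (4 * q₁) (4 * q₂) (4 * q₃), eval (planePoint N x s) f = 0) :
    ∃ A B : ℤ, 0 < A ∧ IsCoprime A B ∧
      ((boxPoints (2 * q₁) (2 * q₂) (2 * q₃)).image (intForm A B (x * B - N * A))).card ≤ d := by
  classical
  set G := (boxPoints (2 * q₁) (2 * q₂) (2 * q₃)).image (planePoint N x) with hG
  have hcard : G.card = 8 * q₁ * q₂ * q₃ := by
    rw [hG, Finset.card_image_of_injOn (planePoint_injOn hx), card_boxPoints]; ring
  have hdG : d < G.card := by
    rw [hcard]; exact (Nat.le_self_pow two_ne_zero d).trans_lt h₁₂₃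
  obtain ⟨_, hγ, _, hγ', hne, hle⟩ := exists_direction f hf hd G G (by rw [hcard]; exact h₁₂₃)
    hdG (by
      intro w hw γ hγ
      obtain ⟨s, hs, rfl⟩ := Finset.mem_image.1 hw
      obtain ⟨t, ht, rfl⟩ := Finset.mem_image.1 hγ
      rw [← planePoint_add]
      apply hv
      rw [mem_boxPoints] at hs ht ⊢
      simp only [Prod.fst_add, Prod.snd_add]
      omega)
  obtain ⟨s, hs, rfl⟩ := Finset.mem_image.1 hγ
  obtain ⟨t, ht, rfl⟩ := Finset.mem_image.1 hγ'
  set κ := planePoint N x s - planePoint N x t with hκ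
  have hκ0 : κ ≠ 0 := sub_ne_zero.2 hne
  obtain ⟨p, hp⟩ : ∃ p : ℤ, κ 1 = -(p : ℝ) :=
    ⟨(t.2.1 + x * t.2.2 : ℤ) - (s.2.1 + x * s.2.2), by
      simp only [hκ, planePoint, Pi.sub_apply, Matrix.cons_val_one]
      push_cast; ring⟩
  obtain ⟨q, hq⟩ : ∃ q : ℤ, κ 0 = (q : ℝ) :=
    ⟨(s.1 - N * s.2.2 : ℤ) - (t.1 - N * t.2.2), by
      simp only [hκ, planePoint, Pi.sub_apply, Matrix.cons_val_zero]
      push_cast; ring⟩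
  have hpq : ¬ (p = 0 ∧ q = 0) := by
    rintro ⟨rfl, rfl⟩
    apply hκ0
    ext i
    fin_cases i
    · simpa using hq
    · simpa using hp
  have himg : ∀ A B e : ℤ, e ≠ 0 → p = e * A → q = e * B →
      ((boxPoints (2 * q₁) (2 * q₂) (2 * q₃)).image (intForm A B (x * B - N * A))).card ≤ d := by
    intro A B e he hpA hqB
    refine le_trans ?_ hle
    rw [hG, Finset.image_image]
    refine Finset.card_le_card_of_surjOn (fun y => ⌊y / e⌋) ?_
    intro v hv
    obtain ⟨s, hs, rfl⟩ := Finset.mem_image.1 (Finset.mem_coe.1 hv)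
    refine ⟨_, Finset.mem_coe.2 (Finset.mem_image_of_mem _ hs), ?_⟩
    have he' : (e : ℝ) ≠ 0 := by exact_mod_cast he
    simp only [Function.comp]
    rw [cross_planePoint N x (A := A) (B := B) (e := e) (by rw [hq, hqB]; push_cast; rfl)
      (by rw [hp, hpA]; push_cast; rfl), mul_div_cancel_left₀ _ he', Int.floor_intCast]
  have hp0 : p ≠ 0 := by
    rintro rfl
    have hq0 : q ≠ 0 := fun h => hpq ⟨rfl, h⟩
    have h1 := himg 0 1 q hq0 (by simp) (by simp)
    have h2 := le_card_image_intForm_of_injOn (A := 0) (B := 1) (C := x * 1 - N * 0)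
      (r₁ := 2 * q₁) (r₂ := 2 * q₂) (r₃ := 2 * q₃) (t₁ := 1) (t₂ := 2 * q₂) (t₃ := 2 * q₃)
      (by by_contra h; have : q₁ = 0 := by omega
          subst this; simp at h₁₃) le_rfl le_rfl (by
        rintro ⟨i, j, l⟩ hs ⟨i', j', l'⟩ hs' h
        rw [mem_boxPoints] at hs hs'
        simp only [intForm] at h hs hs'
        have hj : j = j' := Int.eq_of_dvd_sub_of_lt (c := x) (n := 2 * q₂)
          (by rw [abs_of_nonneg (by positivity)]; exact_mod_cast hx) hs.2.1 hs'.2.1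
          ⟨l' - l, by linear_combination h⟩
        subst hj
        have hl : (x : ℤ) * (l - l') = 0 := by linear_combination h
        have hl : l = l' := by
          rcases mul_eq_zero.1 hl with h | h <;> omega
        have hi : i = i' := by omega
        rw [hl, hi])
    have h3 : 1 * (2 * q₂ * (2 * q₃)) = 4 * q₂ * q₃ := by ring
    omega
  have hq0 : q ≠ 0 := by
    rintro rfl
    have h1 := himg 1 0 p hp0 (by simp) (by simp)
    have h2 := le_card_image_intForm_of_injOn (A := 1) (B := 0) (C := x * 0 - N * 1)
      (r₁ := 2 * q₁) (r₂ := 2 * q₂) (r₃ := 2 * q₃) (t₁ := 2 * q₁) (t₂ := 1) (t₃ := 2 * q₃)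
      le_rfl (by by_contra h; have : q₂ = 0 := by omega
                 subst this; simp at h₂₃) le_rfl (by
        rintro ⟨i, j, l⟩ hs ⟨i', j', l'⟩ hs' h
        rw [mem_boxPoints] at hs hs'
        simp only [intForm] at h hs hs'
        have hi : i = i' := Int.eq_of_dvd_sub_of_lt (c := N) (n := 2 * q₁)
          (by rw [abs_of_nonneg (by positivity)]; exact_mod_cast hN) hs.1 hs'.1
          ⟨l - l', by linear_combination h⟩
        subst hi
        have hl : (N : ℤ) * (l - l') = 0 := by linear_combination -h
        have hl : l = l' := by
          rcases mul_eq_zero.1 hl with h | h <;> omega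
        have hj : j = j' := by omega
        rw [hl, hj])
    have h3 : 2 * q₁ * (1 * (2 * q₃)) = 4 * q₁ * q₃ := by ring
    omega
  obtain ⟨A', B', hcop, hA', hB'⟩ : ∃ A B : ℤ, IsCoprime A B ∧ p = Int.gcd p q * A ∧
      q = Int.gcd p q * B := by
    have hg : 0 < Int.gcd p q := Int.gcd_pos_of_ne_zero_left _ hp0
    refine ⟨p / Int.gcd p q, q / Int.gcd p q, ?_,
      (Int.mul_ediv_cancel' (Int.gcd_dvd_left _ _)).symm,
      (Int.mul_ediv_cancel' (Int.gcd_dvd_right _ _)).symm⟩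
    rw [Int.isCoprime_iff_gcd_eq_one]
    exact Int.gcd_ediv_gcd_ediv_gcd hg
  have hg0 : (Int.gcd p q : ℤ) ≠ 0 := by
    have : 0 < Int.gcd p q := Int.gcd_pos_of_ne_zero_left _ hp0
    omega
  have hA0 : A' ≠ 0 := by rintro rfl; exact hp0 (by rw [hA', mul_zero])
  rcases lt_or_gt_of_ne hA0 with h | h
  · refine ⟨-A', -B', by omega, hcop.neg_neg, himg _ _ (-Int.gcd p q) (neg_ne_zero.2 hg0) ?_ ?_⟩
    · rw [neg_mul_neg]; exact hA'
    · rw [neg_mul_neg]; exact hB'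
  · exact ⟨A', B', h, hcop, himg _ _ _ hg0 hA' hB'⟩

/-- Exponential polynomials vanishing along sufficiently many points of a line vanish on it. -/
lemma eval_line_eq_zero {α a g : ℝ} (hα : 0 < α) (ha : 0 < a) (hg : 0 < g) {N x L T A : ℕ} {B : ℤ}
    (hA : 0 < A) (hγ : α ^ B ≠ a ^ A) {p : ℕ → MvPolynomial (Fin 2) ℝ}
    (hp : ∀ σ < L, (p σ).totalDegree < T) (u : ℕ × ℕ × ℕ) (Z : Finset (ℕ × ℕ × ℕ))
    (hZinj : Set.InjOn (planePoint N x) Z)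
    (κ : Fin 2 → ℝ) (hκ : κ = ![(B : ℝ), -A]) (s₀ : ℕ × ℕ × ℕ)
    (hline : ∀ s ∈ Z, cross κ (planePoint N x s) = cross κ (planePoint N x s₀))
    (hZ : L * (T - 1) < Z.card)
    (hv : ∀ s ∈ Z, ∀ i < L, ∃ r : ℕ × ℕ × ℕ, (r.1 : ℤ) = s.1 + u.1 + i * B ∧
      r.2.1 + i * A = s.2.1 + u.2.1 ∧ r.2.2 = s.2.2 + u.2.2 ∧
      ∑ σ ∈ range L, eval (planePoint N x r) (p σ) * expoPoint α a g r ^ σ = 0) :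
    ∀ σ < L, ∀ t : ℝ, eval (planePoint N x (s₀ + u) + t • κ) (p σ) = 0 := by
  have hκ0 : κ ≠ 0 := by
    rintro h
    rw [h] at hκ
    have := congrFun hκ 1
    simp at this
    omega
  choose! τ hτ using fun s hs => exists_eq_add_smul_of_cross_eq hκ0 (hline s hs)
  have hγ1 : α ^ B / a ^ A ≠ 1 := by
    rwa [Ne, div_eq_one_iff_eq (by positivity)]
  have hγ0 : 0 < α ^ B / a ^ A := by positivity
  have key := exponential_polynomial_eq_zero (L := L) (T := T) (fun σ => (α ^ B / a ^ A) ^ σ)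
    ((pow_right_injective₀ hγ0 hγ1).injOn)
    (fun σ => restrictLine (planePoint N x (s₀ + u)) κ (p σ))
    (fun σ hσ _ => (natDegree_restrictLine_le _ _ _).trans_lt (hp σ hσ))
    (Z.image τ) (by
      rw [Finset.card_image_of_injOn]
      · exact hZ
      · intro s hs s' hs' h
        apply hZinj hs hs'
        rw [hτ s hs, hτ s' hs', h])
    (by
      intro t ht
      obtain ⟨s, hs, rfl⟩ := Finset.mem_image.1 ht
      refine ⟨fun σ => expoPoint α a g (s + u) ^ σ, fun σ => ?_, fun i hi => ?_⟩
      · unfold expoPoint; positivity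
      obtain ⟨r, h1, h2, h3, h4⟩ := hv s hs i hi
      rw [← h4]
      refine Finset.sum_congr rfl fun σ _ => ?_
      have h1r : (r.1 : ℝ) = s.1 + u.1 + i * B := by exact_mod_cast h1
      have h2r : (r.2.1 : ℝ) + i * A = s.2.1 + u.2.1 := by exact_mod_cast h2
      have h3r : (r.2.2 : ℝ) = s.2.2 + u.2.2 := by exact_mod_cast h3
      have hpt : planePoint N x (s₀ + u) + (τ s + (i : ℝ)) • κ = planePoint N x r := by
        have e1 : planePoint N x (s₀ + u) + (τ s + (i : ℝ)) • κ =
            planePoint N x (s + u) + (i : ℝ) • κ := by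
          rw [planePoint_add, planePoint_add, hτ s hs, add_smul]
          abel
        rw [e1, hκ]
        ext j
        fin_cases j
        · simp [planePoint, h1r, h3r]; ring
        · simp [planePoint, h3r]; linear_combination -h2r
      have hex : expoPoint α a g r = (α ^ B / a ^ A) ^ i * expoPoint α a g (s + u) := by
        have e1 : α ^ r.1 = α ^ (s.1 + u.1) * (α ^ B) ^ i := by
          rw [← zpow_natCast, h1, zpow_add₀ hα.ne', mul_comm (i : ℤ), zpow_mul]
          norm_cast
        have e2 : a ^ (s.2.1 + u.2.1) = a ^ r.2.1 * (a ^ A) ^ i := by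
          rw [← h2, pow_add, mul_comm i, pow_mul]
        unfold expoPoint
        simp only [Prod.fst_add, Prod.snd_add]
        rw [e1, e2, h3, div_pow]
        have : (a ^ A) ^ i ≠ 0 := by positivity
        field_simp
      rw [eval_restrictLine, hpt, hex, mul_pow, pow_right_comm]
      ring)
  intro σ hσ t
  have := congrArg (Polynomial.eval t) (key σ hσ)
  rwa [eval_restrictLine, Polynomial.eval_zero] at this

set_option maxHeartbeats 1000000 in
/-- The zero estimate for three multiplicatively generated parameters. -/
theorem eq_zero_or_degenerate {α a g : ℝ} (hα : 1 < α) (ha : 1 < a) (hg : 0 < g)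
    {N x L T q₁ q₂ q₃ : ℕ} (hL : 0 < L) (hT : 0 < T) (hind : ∀ A B : ℕ, 0 < A → α ^ B ≠ a ^ A)
    (hx : 2 * q₂ ≤ x) (hN : 2 * q₁ ≤ N) (h₁₂₃ : (L * T) ^ 2 ≤ 8 * q₁ * q₂ * q₃)
    (h₁₂ : L ^ 2 * T ≤ q₁ * q₂) (h₁₃ : L * T ≤ q₁ * q₃) (h₂₃ : L * T ≤ 4 * q₂ * q₃)
    (p : ℕ → MvPolynomial (Fin 2) ℝ) (hp : ∀ σ < L, (p σ).totalDegree < T)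
    (hv : ∀ s ∈ boxPoints (4 * q₁ + L) (4 * q₂) (4 * q₃),
      ∑ σ ∈ range L, eval (planePoint N x s) (p σ) * expoPoint α a g s ^ σ = 0) :
    (∀ σ < L, p σ = 0) ∨
      ∃ (A : ℕ) (B : ℤ), 0 < A ∧ A * q₁ < T ∧ (x * B - N * A).natAbs * q₃ < T := by
  classical
  by_contra hcon
  push Not at hcon
  obtain ⟨⟨σ₀, hσ₀, hne⟩, hnd⟩ := hcon
  have hα0 : 0 < α := by linarith
  have ha0 : 0 < a := by linarith
  have hLT : L * (T - 1) < L * T := Nat.mul_lt_mul_of_pos_left (by omega) hL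
  have hLTpos : 0 < L * T := Nat.mul_pos hL hT
  set d := L * (T - 1) with hd
  have hq₃ : 0 < q₃ := by
    by_contra h; have : q₃ = 0 := by omega
    subst this; simp at h₁₃; omega
  obtain ⟨Δ, hΔ, hΔd, hΔv⟩ := exists_casoratian (L := L) (T := T) (fun σ => α ^ σ)
    ((pow_right_injective₀ hα0 hα.ne').injOn) p hp hσ₀ hne
  obtain ⟨A, B, hA, hAB, hcard⟩ := exists_integral_direction (N := N) (x := x) (d := d) (q₁ := q₁)
    (q₂ := q₂) (q₃ := q₃) hx hN ((Nat.pow_lt_pow_left hLT two_ne_zero).trans_le h₁₂₃) (by nlinarith)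
    (hLT.trans_le h₂₃) hΔ hΔd (by
      intro s hs
      refine hΔv _ ⟨fun σ => expoPoint α a g s ^ σ, fun σ => by unfold expoPoint; positivity,
        fun i hi => ?_⟩
      have := hv (s + (i, 0, 0)) (by
        rw [mem_boxPoints] at hs ⊢
        simp only [Prod.fst_add, Prod.snd_add]
        omega)
      refine Eq.trans ?_ this
      refine Finset.sum_congr rfl fun σ _ => ?_
      rw [planePoint_add, expoPoint_add, mul_pow]
      have e1 : planePoint N x (i, 0, 0) = (i : ℝ) • ![1, 0] := by
        ext j
        fin_cases j <;> simp [planePoint]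
      have e2 : expoPoint α a g (i, 0, 0) = α ^ i := by simp [expoPoint]
      rw [e1, e2, pow_right_comm]
      ring)
  lift A to ℕ using hA.le
  have hA' : 0 < A := by exact_mod_cast hA
  set C : ℤ := x * B - N * A with hC
  have c1 := (min_mul_le_card_image_intForm C hAB (r₁ := 2 * q₁) (r₂ := 2 * q₂) (r₃ := 2 * q₃)
    (by omega)).trans hcard
  have c2 := (min_mul_le_card_image_intForm' C hAB (r₁ := 2 * q₁) (r₂ := 2 * q₂) (r₃ := 2 * q₃)
    (by omega)).trans hcard
  rw [Int.natAbs_natCast] at c1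
  have hd12 : L * d < 2 * (q₁ * q₂) := by nlinarith
  have hd12' : d < 2 * (q₁ * q₂) := lt_of_le_of_lt (Nat.le_mul_of_pos_left _ hL) hd12
  have hA1 : 2 * q₁ * A ≤ d := by
    rcases le_total A (2 * q₂) with h | h
    · rwa [min_eq_left h] at c1
    · rw [min_eq_right h] at c1; nlinarith
  have hB1 : B.natAbs * (2 * q₂) ≤ d := by
    rcases le_total B.natAbs (2 * q₁) with h | h
    · rwa [min_eq_left h] at c2
    · rw [min_eq_right h] at c2; nlinarith
  have hLA : L * A ≤ q₂ := by
    by_contra h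
    push Not at h
    have : q₁ * q₂ ≤ q₁ * (L * A) := Nat.mul_le_mul_left _ h.le
    have : L * (2 * q₁ * A) ≤ L * d := Nat.mul_le_mul_left _ hA1
    nlinarith
  have hLB : L * B.natAbs ≤ q₁ := by
    by_contra h
    push Not at h
    have : q₁ * q₂ ≤ (L * B.natAbs) * q₂ := Nat.mul_le_mul_right _ h.le
    have : L * (B.natAbs * (2 * q₂)) ≤ L * d := Nat.mul_le_mul_left _ hB1
    nlinarith
  have hAq₂ : A ≤ q₂ := (Nat.le_mul_of_pos_left _ hL).trans hLA
  have hγ : α ^ B ≠ a ^ A := by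
    rcases le_or_gt 0 B with h | h
    · lift B to ℕ using h
      rw [zpow_natCast]
      exact hind A B hA'
    · have h1 : α ^ B < 1 := zpow_lt_one_of_neg₀ hα h
      have h2 : 1 < a ^ A := one_lt_pow₀ ha hA'.ne'
      exact (h1.trans h2).ne
  -- many points on a line
  obtain ⟨v, -, hvcard⟩ : ∃ v ∈ (boxPoints (2 * q₁) (2 * q₂) (2 * q₃)).image (intForm A B C),
      d < ((boxPoints (2 * q₁) (2 * q₂) (2 * q₃)).filter fun s => intForm A B C s = v).card := by
    refine Finset.exists_lt_card_fiber_of_mul_lt_card_of_maps_to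
      (fun s hs => Finset.mem_image_of_mem _ hs) ?_
    rw [card_boxPoints]
    calc _ ≤ d * d := Nat.mul_le_mul_right _ hcard
      _ < (L * T) ^ 2 := by rw [← pow_two]; exact Nat.pow_lt_pow_left hLT two_ne_zero
      _ ≤ _ := by nlinarith
  set Z := (boxPoints (2 * q₁) (2 * q₂) (2 * q₃)).filter fun s => intForm A B C s = v with hZ
  have hZbox : ∀ s ∈ Z, s ∈ boxPoints (2 * q₁) (2 * q₂) (2 * q₃) := fun s hs =>
    (Finset.mem_filter.1 hs).1
  obtain ⟨s₀, hs₀⟩ : Z.Nonempty := Finset.card_pos.1 (by omega)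
  set κ : Fin 2 → ℝ := ![(B : ℝ), -A] with hκ
  have hcr : ∀ s, cross κ (planePoint N x s) = (intForm A B C s : ℝ) := fun s => by
    have := cross_planePoint N x (A := A) (B := B) (e := 1) (κ := κ) (by simp [hκ])
      (by simp [hκ]) s
    rw [this]; simp [hC]
  have hκ0 : κ ≠ 0 := by
    intro h
    have := congrFun h 1
    simp [hκ] at this
    omega
  obtain ⟨b, hb⟩ : ∃ b : ℕ, ∀ i < L, 0 ≤ (b : ℤ) + i * B ∧ (b : ℤ) + i * B ≤ q₁ := by
    have hiB : ∀ i < L, i * B.natAbs ≤ q₁ := fun i hi =>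
      (Nat.mul_le_mul_right _ hi.le).trans hLB
    rcases le_or_gt 0 B with h | h
    · refine ⟨0, fun i hi => ⟨by positivity, ?_⟩⟩
      have := hiB i hi
      zify at this
      rw [abs_of_nonneg h] at this
      simpa using this
    · refine ⟨q₁, fun i hi => ⟨?_, ?_⟩⟩
      · have := hiB i hi
        zify at this
        rw [abs_of_neg h] at this
        linarith
      · have : (i : ℤ) * B ≤ 0 := mul_nonpos_of_nonneg_of_nonpos (by positivity) h.le
        linarith
  have hlines : ∀ e ∈ boxPoints q₁ q₂ q₃, ∀ σ < L, ∀ t : ℝ,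
      eval (planePoint N x (s₀ + (e + (b, L * A, 0))) + t • κ) (p σ) = 0 := by
    intro e he
    refine eval_line_eq_zero hα0 ha0 hg hA' hγ hp (e + (b, L * A, 0)) Z
      ((planePoint_injOn (r₁ := 2 * q₁) (r₃ := 2 * q₃) hx).mono fun s hs => hZbox s hs) κ hκ s₀
      (fun s hs => by
        rw [hcr, hcr, (Finset.mem_filter.1 hs).2, (Finset.mem_filter.1 hs₀).2]) hvcard ?_
    intro s hs i hi
    have hsb := hZbox s hs
    rw [mem_boxPoints] at hsb he
    obtain ⟨hb1, hb2⟩ := hb i hi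
    have hiA : i * A ≤ L * A := Nat.mul_le_mul_right _ hi.le
    refine ⟨((s.1 + e.1 + (b + i * B)).toNat, s.2.1 + e.2.1 + (L * A - i * A), s.2.2 + e.2.2),
      ?_, ?_, ?_, ?_⟩
    · simp only [Prod.fst_add]
      rw [Int.toNat_of_nonneg (by positivity)]
      push_cast; ring
    · simp only [Prod.fst_add, Prod.snd_add]
      omega
    · simp only [Prod.snd_add]; omega
    · apply hv
      rw [mem_boxPoints]
      simp only
      omega
  -- there are few of these lines
  have hfew : ((boxPoints q₁ q₂ q₃).image (intForm A B C)).card < T := by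
    by_contra hmany
    push Not at hmany
    apply hne
    refine eq_zero_of_vanishing_on_lines hκ0 ((boxPoints q₁ q₂ q₃).image fun e =>
      planePoint N x (s₀ + (e + (b, L * A, 0)))) ?_ ?_
    · refine (hp σ₀ hσ₀).trans_le (hmany.trans ?_)
      rw [Finset.image_image]
      refine Finset.card_le_card_of_surjOn
        (fun y => ⌊y - cross κ (planePoint N x (s₀ + (b, L * A, 0)))⌋) ?_
      intro y hy
      obtain ⟨e, he, rfl⟩ := Finset.mem_image.1 (Finset.mem_coe.1 hy)
      refine ⟨_, Finset.mem_coe.2 (Finset.mem_image_of_mem _ he), ?_⟩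
      simp only [Function.comp]
      rw [add_left_comm, planePoint_add, cross_add, add_sub_cancel_right, hcr, Int.floor_intCast]
    · intro w hw t
      obtain ⟨e, he, rfl⟩ := Finset.mem_image.1 hw
      exact hlines e he σ₀ hσ₀ t
  have c3 := min_mul_le_card_image_intForm C hAB (r₁ := q₁) (r₂ := q₂) (r₃ := q₃) hq₃
  rw [Int.natAbs_natCast, min_eq_left hAq₂] at c3
  have c4 := natAbs_mul_le_card_image_intForm (C := C) (r₁ := q₁) (r₃ := q₃) hA.ne' hAB
    (by rwa [Int.natAbs_natCast]) (hfew.trans_le ((Nat.le_mul_of_pos_left _ hL).trans h₁₃))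
  have := hnd A B hA' (by rw [mul_comm]; omega)
  rw [← hC] at this
  omega

end ZeroEstimate

section Selection

lemma exists_det_ne_zero_of_forall_sum_eq_zero {S J : Type*} [Fintype S] [Fintype J]
    [DecidableEq J] (M : S → J → ℝ)
    (h : ∀ c : J → ℝ, (∀ s, ∑ j, M s j * c j = 0) → c = 0) :
    ∃ f : J → S, (Matrix.of fun i j => M (f i) j).det ≠ 0 := by
  classical
  have hrank : Module.finrank ℝ (Submodule.span ℝ (Set.range (Matrix.of M).row)) =
      Fintype.card J := by
    rw [← Matrix.rank_eq_finrank_span_row, Matrix.rank, LinearMap.finrank_range_of_inj]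
    · simp
    · rw [← LinearMap.ker_eq_bot, LinearMap.ker_eq_bot']
      intro c hc
      apply h
      intro s
      exact congrFun hc s
  obtain ⟨f, hf, -, hli⟩ := Submodule.exists_fun_fin_finrank_span_eq ℝ
    (Set.range (Matrix.of M).row)
  choose g hg using hf
  let e : J ≃ Fin (Module.finrank ℝ (Submodule.span ℝ (Set.range (Matrix.of M).row))) :=
    (Fintype.equivFin J).trans (finCongr hrank.symm)
  refine ⟨fun j => g (e j), ?_⟩
  have hli' := hli.comp e e.injective
  have : (Matrix.of fun i j => M (g (e i)) j).row = f ∘ e := by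
    ext i j
    have := congrFun (hg (e i)) j
    exact this
  rw [← this] at hli'
  exact ((Matrix.isUnit_iff_isUnit_det _).1
    (Matrix.linearIndependent_rows_iff_isUnit.1 hli')).ne_zero

end Selection

section DominantRoot

lemma sum_pow_lt_of_lt {k : ℕ} (hk : 0 < k) {r s : ℝ} (hr : 0 < r) (hrs : r < s) :
    r ^ k * ∑ i ∈ range k, s ^ i < s ^ k * ∑ i ∈ range k, r ^ i := by
  rw [mul_sum, mul_sum]
  refine Finset.sum_lt_sum_of_nonempty (Finset.nonempty_range_iff.2 hk.ne') fun i hi => ?_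
  obtain ⟨j, rfl⟩ := Nat.exists_eq_add_of_lt (Finset.mem_range.1 hi)
  have h1 : r ^ (j + 1) < s ^ (j + 1) := pow_lt_pow_left₀ hrs hr.le (by omega)
  have hs : 0 < s := hr.trans hrs
  calc r ^ (i + j + 1) * s ^ i = r ^ i * s ^ i * r ^ (j + 1) := by ring
    _ < r ^ i * s ^ i * s ^ (j + 1) := mul_lt_mul_of_pos_left h1 (by positivity)
    _ = _ := by ring

lemma pow_mul_two_sub_eq_one {R : Type*} [CommRing R] {k : ℕ} {z : R}
    (h : z ^ k = ∑ i ∈ range k, z ^ i) : z ^ k * (2 - z) = 1 := by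
  have := mul_geom_sum z k
  rw [← h] at this
  linear_combination -this

/-- The roots of `X ^ k - X ^ (k - 1) - ⋯ - 1` other than the dominant one lie in the closed unit
disc. -/
lemma norm_le_one_of_ne_dominant {k : ℕ} (hk : 0 < k) {α : ℝ} (hα : 0 < α)
    (hroot : α ^ k = ∑ i ∈ range k, α ^ i) {z : ℂ} (hz : z ^ k = ∑ i ∈ range k, z ^ i)
    (hne : z ≠ α) : ‖z‖ ≤ 1 := by
  by_contra hlt
  push Not at hlt
  set r := ‖z‖ with hr
  have hr0 : 0 < r := by linarith
  have h1 : r ^ k ≤ ∑ i ∈ range k, r ^ i := by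
    rw [hr, ← norm_pow, hz]
    refine (norm_sum_le _ _).trans_eq (Finset.sum_congr rfl fun i _ => norm_pow _ _)
  have h2 : r ^ k * ‖2 - z‖ = 1 := by
    rw [hr, ← norm_pow, ← norm_mul, pow_mul_two_sub_eq_one hz, norm_one]
  have h3 : 2 - r ≤ ‖2 - z‖ := by
    have := norm_sub_norm_le (2 : ℂ) z
    simpa using this
  have hrk : 0 < r ^ k := by positivity
  have h4 : r ^ k * (2 - r) ≤ 1 := by
    rw [← h2]; exact mul_le_mul_of_nonneg_left h3 hrk.le
  have h5 := mul_geom_sum r k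
  have h6 : r ^ k = ∑ i ∈ range k, r ^ i := by
    refine le_antisymm h1 ?_
    have : (r - 1) * ∑ i ∈ range k, r ^ i ≤ (r - 1) * r ^ k := by rw [h5]; linarith
    exact le_of_mul_le_mul_left this (by linarith)
  have h7 : r = α := by
    rcases lt_trichotomy r α with h | h | h
    · have := sum_pow_lt_of_lt hk hr0 h
      rw [← hroot, ← h6, mul_comm] at this
      exact absurd this (lt_irrefl _)
    · exact h
    · have := sum_pow_lt_of_lt hk hα h
      rw [← hroot, ← h6, mul_comm] at this
      exact absurd this (lt_irrefl _)
  have h8 : ‖2 - z‖ = 2 - r := by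
    have := pow_mul_two_sub_eq_one h6
    rw [← h2] at this
    exact (mul_left_cancel₀ hrk.ne' this).symm
  have h9 : ‖2 - z‖ ^ 2 = (2 - r) ^ 2 := by rw [h8]
  have h10 : r ^ 2 = z.re ^ 2 + z.im ^ 2 := by
    rw [hr, ← Complex.normSq_eq_norm_sq, Complex.normSq_apply]; ring
  rw [← Complex.normSq_eq_norm_sq, Complex.normSq_apply] at h9
  simp at h9
  have h11 : z.re = r := by nlinarith
  have h12 : z.im = 0 := by
    rw [h11] at h10
    nlinarith
  apply hne
  apply Complex.ext
  · rw [h11, h7, Complex.ofReal_re]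
  · rw [h12, Complex.ofReal_im]

open Polynomial in
lemma Polynomial.degree_sum_X_pow_lt (k : ℕ) :
    (∑ i ∈ range k, (X : ℤ[X]) ^ i).degree < k :=
  mem_degreeLT.1 (Submodule.sum_mem _ fun i hi => mem_degreeLT.2 (by
    rw [degree_X_pow]
    exact_mod_cast Finset.mem_range.1 hi))

open Polynomial IntermediateField in
/-- A Liouville inequality at an algebraic integer one of whose conjugates is distinguished. -/
lemma one_le_norm_aeval_mul_pow {k : ℕ} (hk : 0 < k) {α : ℂ}
    (hroot : α ^ k = ∑ i ∈ range k, α ^ i) (G : ℤ[X]) (hG : aeval α G ≠ 0) {B : ℝ} (hB : 1 ≤ B)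
    (hconj : ∀ z : ℂ, z ^ k = ∑ i ∈ range k, z ^ i → z ≠ α → ‖aeval z G‖ ≤ B) :
    1 ≤ ‖aeval α G‖ * B ^ (k - 1) := by
  classical
  set f : ℤ[X] := X ^ k - ∑ i ∈ range k, X ^ i with hf
  have hdeg := degree_sum_X_pow_lt k
  have hmonic : f.Monic := monic_X_pow_sub hdeg
  have hfk : f.natDegree = k := by
    rw [hf, natDegree_sub_eq_left_of_natDegree_lt, natDegree_X_pow]
    rw [natDegree_X_pow]
    by_cases h0 : (∑ i ∈ range k, (X : ℤ[X]) ^ i) = 0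
    · rw [h0]; simpa using hk
    · exact (natDegree_lt_iff_degree_lt h0).2 hdeg
  have hfz : ∀ z : ℂ, aeval z f = 0 ↔ z ^ k = ∑ i ∈ range k, z ^ i := fun z => by
    simp [hf, sub_eq_zero]
  have hα_integral : IsIntegral ℤ α := ⟨f, hmonic, (hfz α).2 hroot⟩
  have hα_integral_rat : IsIntegral ℚ α := hα_integral.tower_top
  have := adjoin.finiteDimensional hα_integral_rat
  set K := ℚ⟮α⟯ with hK
  set β : K := AdjoinSimple.gen ℚ α with hβ
  have hβα : (algebraMap K ℂ) β = α := AdjoinSimple.algebraMap_gen ℚ α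
  set γ : K := aeval β G with hγ
  have hσ : ∀ σ : K →ₐ[ℚ] ℂ, σ γ = aeval (σ β) G := fun σ => by
    rw [hγ]
    exact (aeval_algHom_apply (σ.restrictScalars ℤ) β G).symm
  have hβf : aeval β f = 0 := by
    apply (algebraMap K ℂ).injective
    rw [map_zero, ← aeval_algebraMap_apply, hβα]
    exact (hfz α).2 hroot
  have hσf : ∀ σ : K →ₐ[ℚ] ℂ, aeval (σ β) f = 0 := fun σ => by
    have := (aeval_algHom_apply (σ.restrictScalars ℤ) β f)
    rw [hβf, map_zero] at this
    exact this
  have hγ0 : γ ≠ 0 := by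
    intro h
    apply hG
    rw [← hβα, aeval_algebraMap_apply, ← hγ, h, map_zero]
  have hγint : IsIntegral ℤ γ := by
    have : IsIntegral ℤ β := ⟨f, hmonic, hβf⟩
    exact IsIntegral.of_mem_of_fg (Algebra.adjoin ℤ {β}) this.fg_adjoin_singleton _
      (aeval_mem_adjoin_singleton ℤ β)
  have hN : 1 ≤ ‖((Algebra.norm ℚ γ : ℚ) : ℂ)‖ := by
    have h1 := Algebra.isIntegral_norm ℚ hγint
    obtain ⟨n, hn⟩ := IsIntegrallyClosed.isIntegral_iff.1 h1
    have hn0 : n ≠ 0 := by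
      rintro rfl
      rw [map_zero] at hn
      exact hγ0 (Algebra.norm_eq_zero_iff.1 hn.symm)
    rw [← hn]
    simp only [eq_intCast, Rat.cast_intCast, Complex.norm_intCast]
    exact_mod_cast Int.one_le_abs hn0
  have hprod := Algebra.norm_eq_prod_embeddings ℚ ℂ γ
  rw [eq_ratCast] at hprod
  rw [hprod, norm_prod] at hN
  let σ₀ : K →ₐ[ℚ] ℂ := IsScalarTower.toAlgHom ℚ K ℂ
  have hcard : Fintype.card (K →ₐ[ℚ] ℂ) ≤ k := by
    rw [AlgHom.card, IntermediateField.adjoin.finrank hα_integral_rat, ← hfk]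
    have h1 : minpoly ℚ α ∣ f.map (algebraMap ℤ ℚ) := by
      apply minpoly.dvd
      rw [aeval_map_algebraMap]
      exact (hfz α).2 hroot
    have := natDegree_le_of_dvd h1 (hmonic.map _).ne_zero
    rwa [hmonic.natDegree_map] at this
  rw [← Finset.mul_prod_erase _ _ (Finset.mem_univ σ₀)] at hN
  refine hN.trans ?_
  have e0 : σ₀ γ = aeval α G := by
    rw [hσ]; congr 1
  rw [e0]
  refine mul_le_mul_of_nonneg_left ?_ (norm_nonneg _)
  refine (Finset.prod_le_prod (g := fun _ => B) (fun _ _ => norm_nonneg _) ?_).trans ?_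
  · intro σ hσmem
    rw [hσ]
    refine hconj _ ((hfz _).1 (hσf σ)) fun h => (Finset.mem_erase.1 hσmem).1 ?_
    refine IntermediateField.algHom_ext_of_eq_adjoin _ (s := ({α} : Set ℂ)) rfl ?_
    intro x hx
    obtain rfl := hx
    exact h
  · rw [Finset.prod_const]
    refine pow_le_pow_right₀ hB ?_
    rw [Finset.card_erase_of_mem (Finset.mem_univ _), Finset.card_univ]
    omega

/-- Powers of the dominant root are never powers of integers. -/
lemma pow_ne_natCast_pow {k : ℕ} (hk : 0 < k) {α : ℝ}
    (hroot : α ^ k = ∑ i ∈ range k, α ^ i) {a : ℕ} (ha : 2 ≤ a) (A B : ℕ) (hA : 0 < A) :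
    α ^ B ≠ (a : ℝ) ^ A := by
  intro h
  have hαi : IsIntegral ℤ α := by
    refine ⟨Polynomial.X ^ k - ∑ i ∈ range k, Polynomial.X ^ i,
      Polynomial.monic_X_pow_sub (Polynomial.degree_sum_X_pow_lt k), ?_⟩
    simp [hroot, Polynomial.eval₂_finsetSum]
  have hinv : α⁻¹ = α ^ (k - 1) * (2 - α) := by
    have := pow_mul_two_sub_eq_one hroot
    refine inv_eq_of_mul_eq_one_right ?_
    rw [← mul_assoc, mul_pow_sub_one hk.ne']
    exact this
  have h2i : IsIntegral ℤ (2 : ℝ) := by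
    simpa using (isIntegral_algebraMap (R := ℤ) (A := ℝ) (x := 2))
  have hinvi : IsIntegral ℤ (α⁻¹ ^ B) := by
    rw [hinv]
    exact ((hαi.pow _).mul (h2i.sub hαi)).pow _
  have hq : α⁻¹ ^ B = algebraMap ℚ ℝ (((a : ℚ) ^ A)⁻¹) := by
    rw [inv_pow, h]; simp
  rw [hq, isIntegral_algebraMap_iff (algebraMap ℚ ℝ).injective] at hinvi
  obtain ⟨n, hn⟩ := IsIntegrallyClosed.isIntegral_iff.1 hinvi
  have ha0 : (a : ℚ) ^ A ≠ 0 := by positivity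
  have h1 : (n : ℚ) * (a : ℚ) ^ A = 1 := by
    have : (n : ℚ) = ((a : ℚ) ^ A)⁻¹ := by simpa using hn
    rw [this, inv_mul_cancel₀ ha0]
  have h2 : n * (a : ℤ) ^ A = 1 := by exact_mod_cast h1
  have h3 : (a : ℤ) ^ A = 1 := by
    have := Int.isUnit_iff.1 (IsUnit.of_mul_eq_one_right n h2)
    rcases this with h | h
    · exact h
    · have : (0 : ℤ) ≤ (a : ℤ) ^ A := by positivity
      omega
  have h4 : 1 < (a : ℤ) ^ A := one_lt_pow₀ (by omega) hA.ne'
  omega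

end DominantRoot

section Master

lemma norm_det_le_factorial_mul_prod {ι : Type*} [Fintype ι] [DecidableEq ι] (A : Matrix ι ι ℂ)
    (D : ι → ℝ) (h : ∀ i j, ‖A i j‖ ≤ D j) :
    ‖A.det‖ ≤ (Fintype.card ι).factorial * ∏ j, D j := by
  rw [Matrix.det_apply]
  refine (norm_sum_le _ _).trans ?_
  rw [← Fintype.card_perm, ← nsmul_eq_mul]
  refine Finset.sum_le_card_nsmul _ _ _ fun τ _ => ?_
  rw [Units.smul_def, ← Int.cast_smul_eq_zsmul ℂ, norm_smul, norm_prod]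
  have h1 : ‖((Equiv.Perm.sign τ : ℤ) : ℂ)‖ = 1 := by
    rcases Int.units_eq_one_or (Equiv.Perm.sign τ) with h | h <;> simp [h]
  rw [h1, one_mul]
  exact Finset.prod_le_prod (fun _ _ => norm_nonneg _) fun j _ => h _ _

open Polynomial in
/-- Comparison of the analytic upper bound and the arithmetic lower bound for an interpolation
determinant with entries `c i j * y i ^ σ j`. -/
theorem pow_le_of_interpolation_determinant {k : ℕ} (hk : 0 < k) {α : ℝ}
    (hroot : α ^ k = ∑ i ∈ range k, α ^ i) {ι : Type*} [Fintype ι] [DecidableEq ι] {M H L : ℕ}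
    (hcard : Fintype.card ι = M * H) (c : ι → ι → ℤ) (σ : ι → ℕ) (hσ : ∀ j, σ j < L)
    (Y Z : ι → ℤ[X]) (y : ι → ℝ) {U : ℝ} (hZ : ∀ i, 0 < aeval α (Z i))
    (hZU : ∀ i, aeval α (Z i) ≤ U) (hy : ∀ i, y i * aeval α (Z i) = aeval α (Y i))
    (hdet : (Matrix.of fun i j => (c i j : ℝ) * y i ^ σ j).det ≠ 0)
    (u v : ι → ℂ) (P : ι → ℂ → ℂ → ℂ) (hP : ∀ j, IsPolyEntire M (P j)) (θ : ι → ι → ℂ)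
    (hent : ∀ i j, (((c i j : ℝ) * y i ^ σ j : ℝ) : ℂ) = P j (u i) (v i) * Complex.exp (θ i j))
    {E : ℝ} (hE : 1 < E) (D : ι → ℝ)
    (hD : ∀ i j z, ‖z‖ = E → ‖P j (u i) (v i * z) * Complex.exp (θ i j * z ^ H)‖ ≤ D j)
    (D' : ι → ℝ) (hD'1 : ∀ j, 1 ≤ D' j)
    (hD' : ∀ z : ℂ, z ^ k = ∑ i ∈ range k, z ^ i → z ≠ α → ∀ i j,
      |(c i j : ℝ)| * (‖aeval z (Y i)‖ ^ σ j * ‖aeval z (Z i)‖ ^ (L - 1 - σ j)) ≤ D' j) :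
    E ^ (M * ∑ p ∈ range H, p) ≤ ((Fintype.card ι).factorial * ∏ j, D j) *
      (U ^ (L - 1)) ^ Fintype.card ι * ((Fintype.card ι).factorial * ∏ j, D' j) ^ (k - 1) := by
  classical
  set K := Fintype.card ι with hK
  set A : Matrix ι ι ℤ[X] := Matrix.of fun i j =>
    C (c i j) * (Y i ^ σ j * Z i ^ (L - 1 - σ j)) with hA
  set N : Matrix ι ι ℝ := Matrix.of fun i j => (c i j : ℝ) * y i ^ σ j with hN
  have hAz : ∀ z : ℂ, aeval z A.det = (Matrix.of fun i j =>
      (c i j : ℂ) * (aeval z (Y i) ^ σ j * aeval z (Z i) ^ (L - 1 - σ j))).det := fun z => by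
    rw [AlgHom.map_det]
    congr 1
    ext i j
    simp [hA]
  have hreal : ∀ p : ℤ[X], aeval (α : ℂ) p = ((aeval α p : ℝ) : ℂ) := fun p => by
    have := aeval_algebraMap_apply ℂ α p
    simpa using this
  have hAα : aeval (α : ℂ) A.det = (((∏ i, aeval α (Z i) ^ (L - 1)) * N.det : ℝ) : ℂ) := by
    rw [hreal]
    rw [← Matrix.det_mul_column, AlgHom.map_det]
    congr 2
    ext i j
    have h1 : L - 1 = σ j + (L - 1 - σ j) := by have := hσ j; omega
    simp only [hA, hN, AlgHom.mapMatrix_apply, Matrix.map_apply, Matrix.of_apply, map_mul, map_pow,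
      ← hy, mul_pow]
    rw [aeval_C, eq_intCast]
    conv_rhs => rw [h1, pow_add]
    ring
  have hZpos : ∀ i, 0 < aeval α (Z i) ^ (L - 1) := fun i => pow_pos (hZ i) _
  have hne : aeval (α : ℂ) A.det ≠ 0 := by
    rw [hAα, Ne, Complex.ofReal_eq_zero]
    exact mul_ne_zero (Finset.prod_ne_zero_iff.2 fun i _ => (hZpos i).ne') hdet
  have hB : 1 ≤ (K.factorial : ℝ) * ∏ j, D' j := by
    have h1 : (1 : ℝ) ≤ K.factorial := by exact_mod_cast Nat.factorial_pos K
    have h2 : (1 : ℝ) ≤ ∏ j, D' j := by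
      simpa using Finset.prod_le_prod (s := Finset.univ) (f := fun _ : ι => (1 : ℝ)) (g := D')
        (fun _ _ => zero_le_one) fun j _ => hD'1 j
    nlinarith
  have hroot' : (α : ℂ) ^ k = ∑ i ∈ range k, (α : ℂ) ^ i := by
    exact_mod_cast congrArg Complex.ofReal hroot
  have hlow := one_le_norm_aeval_mul_pow hk hroot' A.det hne hB fun z hz hzα => by
    rw [hAz]
    refine norm_det_le_factorial_mul_prod _ D' fun i j => ?_
    refine le_trans (le_of_eq ?_) (hD' z hz hzα i j)
    simp only [Matrix.of_apply, norm_mul, norm_pow, Complex.norm_intCast]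
  have hNdet : ‖((N.det : ℝ) : ℂ)‖ * E ^ (M * ∑ p ∈ range H, p) ≤
      K.factorial * ∏ j, D j := by
    have := norm_det_mul_pow_le M H hcard u v P hP θ E hE D hD
    have h2 : ((N.det : ℝ) : ℂ) = (Matrix.of fun i j => P j (u i) (v i) *
        Complex.exp (θ i j)).det := by
      have : ((N.det : ℝ) : ℂ) = (Complex.ofRealHom.mapMatrix N).det :=
        RingHom.map_det Complex.ofRealHom N
      rw [this]
      congr 1
      ext i j
      exact hent i j
    rwa [h2]
  have hprod : ∏ i, aeval α (Z i) ^ (L - 1) ≤ (U ^ (L - 1)) ^ K := by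
    refine (Finset.prod_le_prod (fun i _ => (hZpos i).le)
      fun i _ => pow_le_pow_left₀ (hZ i).le (hZU i) (L - 1)).trans_eq ?_
    rw [Finset.prod_const, Finset.card_univ]
  have hnorm : ‖aeval (α : ℂ) A.det‖ ≤ (U ^ (L - 1)) ^ K * ‖((N.det : ℝ) : ℂ)‖ := by
    rw [hAα, Complex.ofReal_mul, norm_mul]
    refine mul_le_mul_of_nonneg_right ?_ (norm_nonneg _)
    rw [Complex.norm_real, Real.norm_of_nonneg (Finset.prod_nonneg fun i _ => (hZpos i).le)]
    exact hprod
  have hU : 0 ≤ (U ^ (L - 1)) ^ K := (Finset.prod_nonneg fun i _ => (hZpos i).le).trans hprod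
  have hE0 : 0 < E ^ (M * ∑ p ∈ range H, p) := by positivity
  have hBpow : 0 ≤ ((K.factorial : ℝ) * ∏ j, D' j) ^ (k - 1) := by positivity
  calc E ^ (M * ∑ p ∈ range H, p) = 1 * E ^ (M * ∑ p ∈ range H, p) := (one_mul _).symm
    _ ≤ (‖aeval (α : ℂ) A.det‖ * ((K.factorial : ℝ) * ∏ j, D' j) ^ (k - 1)) *
        E ^ (M * ∑ p ∈ range H, p) := mul_le_mul_of_nonneg_right hlow hE0.le
    _ ≤ ((U ^ (L - 1)) ^ K * ‖((N.det : ℝ) : ℂ)‖ * ((K.factorial : ℝ) * ∏ j, D' j) ^ (k - 1)) *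
        E ^ (M * ∑ p ∈ range H, p) := by gcongr
    _ = ‖((N.det : ℝ) : ℂ)‖ * E ^ (M * ∑ p ∈ range H, p) * ((U ^ (L - 1)) ^ K) *
        ((K.factorial : ℝ) * ∏ j, D' j) ^ (k - 1) := by ring
    _ ≤ _ := by gcongr

end Master

section Triangle
open MvPolynomial

/-- Exponents of the bivariate monomials of degree less than `T`. -/
abbrev TriangleIndex (T : ℕ) : Type := Σ n : Fin T, Fin (n + 1)

/-- The monomial attached to an exponent. -/
noncomputable def triangleExponent {T : ℕ} (q : TriangleIndex T) : Fin 2 →₀ ℕ :=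
  Finsupp.single 0 (q.2 : ℕ) + Finsupp.single 1 ((q.1 : ℕ) - q.2)

lemma triangleExponent_injective (T : ℕ) :
    Function.Injective (triangleExponent : TriangleIndex T → Fin 2 →₀ ℕ) := by
  rintro ⟨⟨n, hn⟩, ⟨i, hi⟩⟩ ⟨⟨n', hn'⟩, ⟨i', hi'⟩⟩ h
  simp only at hi hi'
  have h0 := DFunLike.congr_fun h 0
  have h1 := DFunLike.congr_fun h 1
  simp [triangleExponent] at h0 h1
  obtain rfl := h0
  obtain rfl : n = n' := by omega
  rfl

lemma eval_triangle_monomial {T : ℕ} (q : TriangleIndex T) (w : Fin 2 → ℝ) (c : ℝ) :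
    eval w (monomial (triangleExponent q) c) =
      c * (w 0 ^ (q.2 : ℕ) * w 1 ^ ((q.1 : ℕ) - q.2)) := by
  rw [eval_monomial, triangleExponent, Finsupp.prod_add_index' (by simp) (by simp [pow_add])]
  simp

lemma totalDegree_triangle_sum_lt {T : ℕ} (hT : 0 < T) (c : TriangleIndex T → ℝ) :
    (∑ q, monomial (triangleExponent q) (c q)).totalDegree < T := by
  have : (∑ q, monomial (triangleExponent q) (c q)).totalDegree ≤ T - 1 := by
    refine totalDegree_finsetSum_le fun q _ => (totalDegree_monomial_le _ _).trans ?_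
    rw [triangleExponent, Finsupp.sum_add_index' (by simp) (by simp),
      Finsupp.sum_single_index rfl, Finsupp.sum_single_index rfl]
    obtain ⟨⟨n, hn⟩, ⟨i, hi⟩⟩ := q
    simp only [id] at hi ⊢
    omega
  omega

lemma eq_zero_of_triangle_sum_eq_zero {T : ℕ} (c : TriangleIndex T → ℝ)
    (h : ∑ q, monomial (triangleExponent q) (c q) = 0) : c = 0 := by
  classical
  ext q
  have := congrArg (coeff (triangleExponent q)) h
  rw [coeff_sum, Finset.sum_eq_single q] at this
  · simpa using this
  · intro q' _ hne
    rw [coeff_monomial, if_neg fun h => hne (triangleExponent_injective T h)]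
  · intro h; exact absurd (Finset.mem_univ _) h

lemma card_triangleIndex (T : ℕ) : Fintype.card (TriangleIndex T) * 2 = T * (T + 1) := by
  rw [Fintype.card_sigma]
  simp only [Fintype.card_fin]
  rw [Fin.sum_univ_eq_sum_range (fun n => n + 1) T]
  have := Finset.sum_range_id_mul_two (T + 1)
  rw [Finset.sum_range_succ'] at this
  simpa [mul_comm] using this

lemma sum_degree_triangleIndex (T : ℕ) :
    3 * ∑ q : TriangleIndex T, (q.1 : ℕ) = (T - 1) * (T * (T + 1)) := by
  rw [Fintype.sum_sigma]
  simp only [Finset.sum_const, Finset.card_univ, Fintype.card_fin, smul_eq_mul]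
  rw [Fin.sum_univ_eq_sum_range (fun n => (n + 1) * n) T]
  induction T with
  | zero => simp
  | succ T ih =>
    rw [Finset.sum_range_succ, mul_add, ih]
    cases T with
    | zero => simp
    | succ T => simp; ring

/-- Either some interpolation determinant at integral points of the box does not vanish, or the
parameters are degenerate. -/
theorem exists_interpolation_det_ne_zero {α a g : ℝ} (hα : 1 < α) (ha : 1 < a) (hg : 0 < g)
    {N x L T q₁ q₂ q₃ : ℕ} (hL : 0 < L) (hT : 0 < T) (hind : ∀ A B : ℕ, 0 < A → α ^ B ≠ a ^ A)
    (hx : 2 * q₂ ≤ x) (hN : 2 * q₁ ≤ N) (h₁₂₃ : (L * T) ^ 2 ≤ 8 * q₁ * q₂ * q₃)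
    (h₁₂ : L ^ 2 * T ≤ q₁ * q₂) (h₁₃ : L * T ≤ q₁ * q₃) (h₂₃ : L * T ≤ 4 * q₂ * q₃) :
    (∃ s : TriangleIndex T × Fin L → ℕ × ℕ × ℕ,
      (∀ i, s i ∈ boxPoints (4 * q₁ + L) (4 * q₂) (4 * q₃)) ∧
      (Matrix.of fun i j : TriangleIndex T × Fin L =>
        (planePoint N x (s i) 0 ^ (j.1.2 : ℕ) * planePoint N x (s i) 1 ^ ((j.1.1 : ℕ) - j.1.2)) *
          expoPoint α a g (s i) ^ (j.2 : ℕ)).det ≠ 0) ∨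
      ∃ (A : ℕ) (B : ℤ), 0 < A ∧ A * q₁ < T ∧ (x * B - N * A).natAbs * q₃ < T := by
  classical
  by_cases hdeg : ∃ (A : ℕ) (B : ℤ), 0 < A ∧ A * q₁ < T ∧ (x * B - N * A).natAbs * q₃ < T
  · exact Or.inr hdeg
  left
  obtain ⟨f, hf⟩ := exists_det_ne_zero_of_forall_sum_eq_zero
    (S := boxPoints (4 * q₁ + L) (4 * q₂) (4 * q₃)) (J := TriangleIndex T × Fin L)
    (fun s j => (planePoint N x s 0 ^ (j.1.2 : ℕ) * planePoint N x s 1 ^ ((j.1.1 : ℕ) - j.1.2)) *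
          expoPoint α a g s ^ (j.2 : ℕ)) (by
      intro c hc
      let p : ℕ → MvPolynomial (Fin 2) ℝ := fun σ =>
        ∑ q, monomial (triangleExponent q) (if h : σ < L then c (q, ⟨σ, h⟩) else 0)
      have hp0 := (eq_zero_or_degenerate hα ha hg hL hT hind hx hN h₁₂₃ h₁₂ h₁₃ h₂₃ p
        (fun σ _ => totalDegree_triangle_sum_lt hT _) (by
          intro s hs
          refine Eq.trans ?_ (hc ⟨s, hs⟩)
          rw [Fintype.sum_prod_type_right, ← Fin.sum_univ_eq_sum_range
            (fun σ => eval (planePoint N x s) (p σ) * expoPoint α a g s ^ σ)]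
          refine Finset.sum_congr rfl fun σ _ => ?_
          rw [map_sum, Finset.sum_mul]
          refine Finset.sum_congr rfl fun q _ => ?_
          rw [eval_triangle_monomial, dif_pos σ.2]
          ring)).resolve_right hdeg
      ext ⟨q, σ⟩
      have := congrFun (eq_zero_of_triangle_sum_eq_zero _ (hp0 σ σ.2)) q
      simpa using this)
  exact ⟨fun i => f i, fun i => (f i).2, hf⟩

end Triangle

section TriangleFunction

/-- The exponential monomials in the coordinates adapted to the logarithms. -/
noncomputable def triangleFunction (l₁ l₂ : ℂ) (n i σ : ℕ) (u ζ : ℂ) : ℂ :=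
  ((ζ - u * l₂) / l₁) ^ i * u ^ (n - i) * Complex.exp (σ * ζ)

lemma isPolyEntire_triangleFunction (l₁ l₂ : ℂ) {T n i : ℕ} (hn : n < T) (hi : i ≤ n) (σ : ℕ) :
    IsPolyEntire T (triangleFunction l₁ l₂ n i σ) := by
  have h : triangleFunction l₁ l₂ n i σ = fun u ζ => ∑ r ∈ range (i + 1),
      u ^ ((i - r) + (n - i)) * (ζ ^ r * (-l₂) ^ (i - r) * (i.choose r) / l₁ ^ i *
        Complex.exp (σ * ζ)) := by
    funext u ζ
    rw [triangleFunction, div_pow, sub_eq_add_neg, ← mul_neg, add_pow, Finset.sum_div,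
      Finset.sum_mul, Finset.sum_mul]
    refine Finset.sum_congr rfl fun r _ => ?_
    rw [mul_pow, pow_add]
    ring
  rw [h]
  refine IsPolyEntire.sum _ fun r _ => IsPolyEntire.monomial (by omega) ?_
  fun_prop

end TriangleFunction

section ThreeLogarithms
open Polynomial

lemma Polynomial.aeval_C_mul_X_sub_C {R : Type*} [CommRing R] (z : R) (k : ℕ) :
    aeval z (C ((k : ℤ) + 1) * X - C (2 * (k : ℤ))) = (k + 1) * z - 2 * k := by
  rw [map_sub, map_mul, aeval_C, aeval_C, aeval_X, eq_intCast, eq_intCast]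
  push_cast
  ring

/-- The inequality resulting from a nonvanishing interpolation determinant for the three numbers
`α`, `a` and `(α - 1) / ((k + 1) * α - 2 * k)`. -/
theorem exponent_le_of_triangle_det_ne_zero {k : ℕ} (hk : 0 < k) {α : ℝ} (hα : 1 < α)
    (hα2 : α < 2) (hroot : α ^ k = ∑ i ∈ range k, α ^ i) {a b κ ν ξ N x L L' T S₁ S₂ S₃ : ℕ}
    (ha : 2 ≤ a) (hab : a ≤ 2 ^ b) (hκ : 3 * k + 1 ≤ 2 ^ κ) {g δ lam : ℝ}
    (hδ : δ = (k + 1) * α - 2 * k) (hδ0 : 0 < δ) (hδ2 : δ ≤ 2) (hgδ : g * δ = α - 1) (hg : 0 < g)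
    (hglog : |Real.log g| ≤ Real.log 2)
    (hlam : x * Real.log a - N * Real.log α - Real.log g = lam)
    (hL : L = 2 * L') (hL' : 0 < L') (hT : 0 < T)
    (hsmall : L * S₃ * |lam| * 8 ^ ((T + 1) * L') ≤ 1)
    (hcard : T * ((T + 1) * L') ≤ 2 ^ ξ)
    (s : TriangleIndex T × Fin L → ℕ × ℕ × ℕ) (hs : ∀ i, s i ∈ boxPoints S₁ S₂ S₃)
    (hw₁ : ∀ i, |planePoint N x (s i) 0| ≤ 2 ^ ν) (hw₂ : ∀ i, |planePoint N x (s i) 1| ≤ 2 ^ ν)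
    (hw : ∀ i, 8 * |planePoint N x (s i) 0| +
      9 * |planePoint N x (s i) 1| * (Real.log a / Real.log α) ≤ 2 ^ ν)
    (hdet : (Matrix.of fun i j : TriangleIndex T × Fin L =>
        (planePoint N x (s i) 0 ^ (j.1.2 : ℕ) * planePoint N x (s i) 1 ^ ((j.1.1 : ℕ) - j.1.2)) *
          expoPoint α a g (s i) ^ (j.2 : ℕ)).det ≠ 0) :
    3 * (T * ∑ p ∈ range ((T + 1) * L'), p) ≤
      (ξ * (T * ((T + 1) * L')) + ∑ j : TriangleIndex T × Fin L,
        (ν * (j.1.1 : ℕ) + 8 * (S₁ + b * S₂ + S₃) * (j.2 : ℕ) + 3)) +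
      S₃ * (L - 1) * (T * ((T + 1) * L')) +
      (ξ * (T * ((T + 1) * L')) + ∑ j : TriangleIndex T × Fin L,
        (ν * (j.1.1 : ℕ) + (b * S₂ + S₃) * (j.2 : ℕ) + κ * S₃ * (L - 1 - (j.2 : ℕ)))) *
          (k - 1) := by
  have hα0 : 0 < α := by linarith
  have ha1 : (1 : ℝ) < a := by exact_mod_cast ha
  have ha0 : (0 : ℝ) < a := by linarith
  set H := (T + 1) * L' with hH
  have hH1 : 1 ≤ H := Nat.mul_pos (by omega) hL'
  have hKcard : Fintype.card (TriangleIndex T × Fin L) = T * H := by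
    rw [Fintype.card_prod, Fintype.card_fin, hH, hL, ← mul_assoc, card_triangleIndex, mul_assoc]
  have hlα : 0 < Real.log α := Real.log_pos hα
  have hla : 0 < Real.log a := Real.log_pos ha1
  have hl2 : 0 < Real.log 2 := Real.log_pos one_lt_two
  have hlα2 : Real.log α ≤ Real.log 2 := Real.log_le_log hα0 hα2.le
  have hlab : Real.log a ≤ b * Real.log 2 := by
    rw [← Real.log_pow]
    exact Real.log_le_log ha0 (by exact_mod_cast hab)
  have hbox : ∀ i, (s i).1 < S₁ ∧ (s i).2.1 < S₂ ∧ (s i).2.2 < S₃ := fun i => mem_boxPoints.1 (hs i)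
  -- the determinant data
  set c : TriangleIndex T × Fin L → TriangleIndex T × Fin L → ℤ := fun i j =>
    ((s i).1 - N * (s i).2.2 : ℤ) ^ (j.1.2 : ℕ) *
      ((s i).2.1 + x * (s i).2.2 : ℤ) ^ ((j.1.1 : ℕ) - j.1.2) with hc
  have hcR : ∀ i j, (c i j : ℝ) = planePoint N x (s i) 0 ^ (j.1.2 : ℕ) *
      planePoint N x (s i) 1 ^ ((j.1.1 : ℕ) - j.1.2) := fun i j => by
    simp [hc, planePoint]
  have hcle : ∀ i j, |(c i j : ℝ)| ≤ (2 : ℝ) ^ (ν * (j.1.1 : ℕ)) := fun i j => by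
    rw [hcR, abs_mul, abs_pow, abs_pow, pow_mul]
    have hj : (j.1.2 : ℕ) ≤ j.1.1 := by have := j.1.2.2; omega
    calc _ ≤ ((2 : ℝ) ^ ν) ^ (j.1.2 : ℕ) * ((2 : ℝ) ^ ν) ^ ((j.1.1 : ℕ) - j.1.2) := by
          gcongr
          · exact hw₁ i
          · exact hw₂ i
      _ = _ := by rw [← pow_add, Nat.add_sub_cancel' hj]
  set v : TriangleIndex T × Fin L → ℝ := fun i => planePoint N x (s i) 0 * Real.log α +
    planePoint N x (s i) 1 * Real.log a with hv
  have hv' : ∀ i, v i = (s i).1 * Real.log α + (s i).2.1 * Real.log a +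
      (s i).2.2 * (Real.log g + lam) := fun i => by
    rw [hv, ← hlam]; simp [planePoint]; ring
  have hexpo : ∀ i, expoPoint α a g (s i) = Real.exp (v i - (s i).2.2 * lam) := fun i => by
    rw [hv', expoPoint]
    rw [show ((s i).1 * Real.log α + (s i).2.1 * Real.log a + (s i).2.2 * (Real.log g + lam) -
      (s i).2.2 * lam) = (s i).1 * Real.log α + (s i).2.1 * Real.log a + (s i).2.2 * Real.log g by
        ring, Real.exp_add, Real.exp_add, ← Real.log_pow, ← Real.log_pow, ← Real.log_pow,
      Real.exp_log (by positivity), Real.exp_log (by positivity), Real.exp_log (by positivity)]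
  have hvle : ∀ i, |v i| ≤ (S₁ + b * S₂ + S₃ : ℕ) * Real.log 2 + S₃ * |lam| := fun i => by
    obtain ⟨h1, h2, h3⟩ := hbox i
    have h1' : ((s i).1 : ℝ) ≤ S₁ := by exact_mod_cast h1.le
    have h2' : ((s i).2.1 : ℝ) ≤ S₂ := by exact_mod_cast h2.le
    have h3' : ((s i).2.2 : ℝ) ≤ S₃ := by exact_mod_cast h3.le
    rw [hv']
    calc _ ≤ |(s i).1 * Real.log α| + |(s i).2.1 * Real.log a| +
          |(s i).2.2 * (Real.log g + lam)| := abs_add_three _ _ _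
      _ = (s i).1 * Real.log α + (s i).2.1 * Real.log a + (s i).2.2 * |Real.log g + lam| := by
          rw [abs_mul, abs_mul, abs_mul, Nat.abs_cast, Nat.abs_cast, Nat.abs_cast,
            abs_of_pos hlα, abs_of_pos hla]
      _ ≤ S₁ * Real.log 2 + S₂ * (b * Real.log 2) + S₃ * (Real.log 2 + |lam|) := by
          gcongr
          exact (abs_add_le _ _).trans (add_le_add_left hglog _)
      _ = _ := by push_cast; ring
  have hLS : (L : ℝ) * S₃ * |lam| * 8 ≤ 1 := by
    refine le_trans ?_ hsmall
    refine mul_le_mul_of_nonneg_left ?_ (by positivity)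
    exact le_self_pow₀ (by norm_num) (by omega)
  have hσL : ∀ j : TriangleIndex T × Fin L, ((j.2 : ℕ) : ℝ) ≤ L := fun j => by
    exact_mod_cast j.2.2.le
  have hZ := Polynomial.aeval_C_mul_X_sub_C α k
  have hmaster := pow_le_of_interpolation_determinant hk hroot (M := T) (H := H) (L := L) hKcard c
    (fun j => (j.2 : ℕ)) (fun j => j.2.2)
    (fun i => X ^ (s i).1 * C (a : ℤ) ^ (s i).2.1 * (X - 1) ^ (s i).2.2)
    (fun i => (C ((k : ℤ) + 1) * X - C (2 * (k : ℤ))) ^ (s i).2.2)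
    (fun i => expoPoint α a g (s i)) (U := 2 ^ S₃)
    (fun i => by
      rw [map_pow, hZ, ← hδ]
      exact pow_pos hδ0 _)
    (fun i => by
      have e : aeval α ((C ((k : ℤ) + 1) * X - C (2 * (k : ℤ))) ^ (s i).2.2) = δ ^ (s i).2.2 := by
        rw [map_pow, hZ, ← hδ]
      rw [e]
      exact (pow_le_pow_left₀ hδ0.le hδ2 _).trans
        (pow_le_pow_right₀ one_le_two (hbox i).2.2.le))
    (fun i => by
      have e : aeval α ((C ((k : ℤ) + 1) * X - C (2 * (k : ℤ))) ^ (s i).2.2) = δ ^ (s i).2.2 := by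
        rw [map_pow, hZ, ← hδ]
      rw [e, expoPoint, mul_assoc, ← mul_pow, hgδ]
      simp)
    (by
      convert hdet using 5
      exact congrArg (· * _) (hcR _ _))
    (fun i => (planePoint N x (s i) 1 : ℂ)) (fun i => (v i : ℂ))
    (fun j => triangleFunction (Real.log α) (Real.log a) j.1.1 j.1.2 j.2)
    (fun j => isPolyEntire_triangleFunction _ _ j.1.1.2 (by have := j.1.2.2; omega) _)
    (fun i j => -((j.2 : ℕ) * (s i).2.2 * lam : ℝ))
    (fun i j => by
      rw [hcR, hexpo, triangleFunction]
      have e1 : ((v i : ℂ) - (planePoint N x (s i) 1 : ℂ) * (Real.log a : ℂ)) / (Real.log α : ℂ) =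
          (planePoint N x (s i) 0 : ℂ) := by
        rw [div_eq_iff (by exact_mod_cast hlα.ne'), hv]
        push_cast; ring
      rw [e1, mul_assoc _ (Complex.exp _), ← Complex.exp_add, ← Real.exp_nat_mul]
      push_cast
      congr 2
      ring)
    (E := 8) (by norm_num)
    (fun j => 2 ^ (ν * (j.1.1 : ℕ) + 8 * (S₁ + b * S₂ + S₃) * (j.2 : ℕ) + 3))
    (fun i j z hz => by
      rw [triangleFunction, mul_assoc, ← Complex.exp_add, norm_mul, norm_mul, norm_pow, norm_pow,
        pow_add, pow_add, mul_assoc ((2 : ℝ) ^ _)]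
      have hj : (j.1.2 : ℕ) ≤ j.1.1 := by have := j.1.2.2; omega
      refine mul_le_mul ?_ ?_ (norm_nonneg _) (by positivity)
      · rw [pow_mul]
        calc _ ≤ ((2 : ℝ) ^ ν) ^ (j.1.2 : ℕ) * ((2 : ℝ) ^ ν) ^ ((j.1.1 : ℕ) - j.1.2) := by
              gcongr
              · refine le_trans ?_ (hw i)
                have e1 : ((v i : ℂ) * z - (planePoint N x (s i) 1 : ℂ) * (Real.log a : ℂ)) /
                    (Real.log α : ℂ) = (planePoint N x (s i) 0 : ℂ) * z +
                      (planePoint N x (s i) 1 : ℂ) * ((Real.log a / Real.log α : ℝ) : ℂ) *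
                        (z - 1) := by
                  have : (Real.log α : ℂ) ≠ 0 := by exact_mod_cast hlα.ne'
                  rw [hv]
                  push_cast
                  field_simp
                  ring
                rw [e1]
                refine (norm_add_le _ _).trans ?_
                rw [norm_mul, norm_mul, norm_mul, hz, Complex.norm_real, Complex.norm_real,
                  Complex.norm_real, Real.norm_eq_abs, Real.norm_eq_abs,
                  Real.norm_of_nonneg (by positivity)]
                have : ‖z - 1‖ ≤ 9 := by
                  refine (norm_sub_le _ _).trans ?_
                  rw [hz, norm_one]; norm_num
                have h9 : |planePoint N x (s i) 1| * (Real.log a / Real.log α) * ‖z - 1‖ ≤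
                    |planePoint N x (s i) 1| * (Real.log a / Real.log α) * 9 :=
                  mul_le_mul_of_nonneg_left this (by positivity)
                linarith
              · rw [Complex.norm_real]; exact hw₂ i
          _ = _ := by rw [← pow_add, Nat.add_sub_cancel' hj]
      · rw [Complex.norm_exp]
        have h1 : (((j.2 : ℕ) : ℂ) * ((v i : ℂ) * z) +
            (-((j.2 : ℕ) * (s i).2.2 * lam : ℝ) : ℂ) * z ^ H).re ≤
            (8 * (S₁ + b * S₂ + S₃) * (j.2 : ℕ) : ℕ) * Real.log 2 + 2 := by
          refine (Complex.re_le_norm _).trans ((norm_add_le _ _).trans ?_)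
          rw [norm_mul, norm_mul, norm_mul, norm_neg, norm_pow, hz, Complex.norm_real,
            Complex.norm_natCast, Complex.norm_real, Real.norm_eq_abs, Real.norm_eq_abs, abs_mul,
            abs_mul, Nat.abs_cast, Nat.abs_cast]
          have h3' : ((s i).2.2 : ℝ) ≤ S₃ := by exact_mod_cast (hbox i).2.2.le
          have e1 : ((j.2 : ℕ) : ℝ) * (s i).2.2 * |lam| * 8 ^ H ≤ 1 := by
            refine le_trans ?_ hsmall
            gcongr
            exact j.2.2.le
          have e2 : ((j.2 : ℕ) : ℝ) * (|v i| * 8) ≤ ((j.2 : ℕ) : ℝ) *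
              (((S₁ + b * S₂ + S₃ : ℕ) * Real.log 2 + S₃ * |lam|) * 8) := by
            gcongr
            exact hvle i
          have e3 : ((j.2 : ℕ) : ℝ) * S₃ * |lam| * 8 ≤ 1 := by
            refine le_trans ?_ hLS
            gcongr
            exact j.2.2.le
          have e4 : ((j.2 : ℕ) : ℝ) *
              (((S₁ + b * S₂ + S₃ : ℕ) * Real.log 2 + S₃ * |lam|) * 8) =
              (8 * (S₁ + b * S₂ + S₃) * (j.2 : ℕ) : ℕ) * Real.log 2 +
                ((j.2 : ℕ) : ℝ) * S₃ * |lam| * 8 := by push_cast; ring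
          linarith
        refine (Real.exp_le_exp.2 h1).trans ?_
        rw [Real.exp_add, ← Real.log_pow, Real.exp_log (by positivity)]
        refine mul_le_mul_of_nonneg_left ?_ (by positivity)
        have := Real.exp_one_lt_d9
        have h2 : Real.exp 2 = Real.exp 1 ^ 2 := by rw [← Real.exp_nat_mul]; norm_num
        rw [h2]
        have := Real.exp_pos 1
        nlinarith)
    (fun j => 2 ^ (ν * (j.1.1 : ℕ) + (b * S₂ + S₃) * (j.2 : ℕ) + κ * S₃ * (L - 1 - (j.2 : ℕ))))
    (fun j => one_le_pow₀ one_le_two)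
    (fun z hz hzα i j => by
      have hz1 := norm_le_one_of_ne_dominant hk hα0 hroot hz hzα
      obtain ⟨h1, h2, h3⟩ := hbox i
      rw [pow_add, pow_add, mul_assoc ((2 : ℝ) ^ _), pow_mul, pow_mul, pow_mul]
      rw [← pow_mul 2 ν]
      refine mul_le_mul (hcle i j) ?_ (by positivity) (by positivity)
      refine mul_le_mul ?_ ?_ (by positivity) (by positivity)
      · refine pow_le_pow_left₀ (norm_nonneg _) ?_ _
        simp only [map_mul, map_pow, map_sub, aeval_X, aeval_C, map_one, norm_mul, norm_pow]
        have t1 : ‖z‖ ^ (s i).1 ≤ 1 := pow_le_one₀ (norm_nonneg _) hz1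
        have t2 : ‖(algebraMap ℤ ℂ) (a : ℤ)‖ ^ (s i).2.1 ≤ 2 ^ (b * S₂) := by
          rw [pow_mul]
          have e : ‖(algebraMap ℤ ℂ) (a : ℤ)‖ = a := by simp
          rw [e]
          calc (a : ℝ) ^ (s i).2.1 ≤ (2 ^ b) ^ (s i).2.1 :=
                pow_le_pow_left₀ ha0.le (by exact_mod_cast hab) _
            _ ≤ _ := pow_le_pow_right₀ (one_le_pow₀ one_le_two) h2.le
        have t3 : ‖z - 1‖ ^ (s i).2.2 ≤ 2 ^ S₃ := by
          have : ‖z - 1‖ ≤ 2 := by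
            refine (norm_sub_le _ _).trans ?_
            rw [norm_one]; linarith
          exact (pow_le_pow_left₀ (norm_nonneg _) this _).trans
            (pow_le_pow_right₀ one_le_two h3.le)
        rw [pow_add, ← one_mul ((2 : ℝ) ^ (b * S₂))]
        gcongr
      · refine pow_le_pow_left₀ (norm_nonneg _) ?_ _
        rw [map_pow, Polynomial.aeval_C_mul_X_sub_C, norm_pow, pow_mul]
        have : ‖((k : ℂ) + 1) * z - 2 * k‖ ≤ 2 ^ κ := by
          refine (norm_sub_le _ _).trans ?_
          rw [norm_mul, norm_mul, ← Nat.cast_add_one, Complex.norm_natCast, Complex.norm_natCast,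
            RCLike.norm_ofNat]
          have e3 : (3 * k + 1 : ℝ) ≤ 2 ^ κ := by exact_mod_cast hκ
          push_cast
          nlinarith [norm_nonneg z]
        exact (pow_le_pow_left₀ (norm_nonneg _) this _).trans
          (pow_le_pow_right₀ (one_le_pow₀ one_le_two) h3.le))
  have hfact : ((Fintype.card (TriangleIndex T × Fin L)).factorial : ℝ) ≤ 2 ^ (ξ * (T * H)) := by
    rw [hKcard, pow_mul]
    calc ((T * H).factorial : ℝ) ≤ ((T * H : ℕ) : ℝ) ^ (T * H) := by
          exact_mod_cast Nat.factorial_le_pow _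
      _ ≤ _ := pow_le_pow_left₀ (by positivity) (by exact_mod_cast hcard) _
  rw [Finset.prod_pow_eq_pow_sum, Finset.prod_pow_eq_pow_sum, hKcard] at hmaster
  rw [hKcard] at hfact
  have hfin : (2 : ℝ) ^ (3 * (T * ∑ p ∈ range H, p)) ≤ 2 ^ ((ξ * (T * H) +
      ∑ j : TriangleIndex T × Fin L,
        (ν * (j.1.1 : ℕ) + 8 * (S₁ + b * S₂ + S₃) * (j.2 : ℕ) + 3)) +
      S₃ * (L - 1) * (T * H) + (ξ * (T * H) + ∑ j : TriangleIndex T × Fin L,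
        (ν * (j.1.1 : ℕ) + (b * S₂ + S₃) * (j.2 : ℕ) + κ * S₃ * (L - 1 - (j.2 : ℕ)))) *
          (k - 1)) := by
    calc (2 : ℝ) ^ (3 * (T * ∑ p ∈ range H, p)) = 8 ^ (T * ∑ p ∈ range H, p) := by
          rw [pow_mul]; norm_num
      _ ≤ _ := hmaster
      _ ≤ _ := by
          rw [pow_mul] at hfact
          rw [pow_add, pow_add, pow_add, pow_mul _ _ (k - 1), pow_add, pow_mul _ ξ (T * H),
            pow_mul _ (S₃ * (L - 1)) (T * H), pow_mul _ S₃]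
          gcongr
  exact (pow_le_pow_iff_right₀ one_lt_two).1 hfin

end ThreeLogarithms

section TriangleSums

lemma sum_fst_triangleIndex_prod (T L : ℕ) :
    3 * ∑ j : TriangleIndex T × Fin L, (j.1.1 : ℕ) = L * ((T - 1) * (T * (T + 1))) := by
  rw [Fintype.sum_prod_type]
  simp only [Finset.sum_const, Finset.card_univ, Fintype.card_fin, smul_eq_mul]
  rw [← Finset.mul_sum, ← sum_degree_triangleIndex]
  ring

lemma sum_snd_triangleIndex_prod (T L : ℕ) :
    4 * ∑ j : TriangleIndex T × Fin L, (j.2 : ℕ) = T * (T + 1) * (L * (L - 1)) := by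
  rw [Fintype.sum_prod_type]
  simp only [Finset.sum_const, Finset.card_univ, smul_eq_mul]
  rw [← card_triangleIndex, Fin.sum_univ_eq_sum_range (fun i => i), ← Finset.sum_range_id_mul_two]
  ring

lemma sum_sub_snd_triangleIndex_prod (T L : ℕ) :
    4 * ∑ j : TriangleIndex T × Fin L, (L - 1 - (j.2 : ℕ)) = T * (T + 1) * (L * (L - 1)) := by
  rw [Fintype.sum_prod_type]
  simp only [Finset.sum_const, Finset.card_univ, smul_eq_mul]
  rw [← card_triangleIndex, Fin.sum_univ_eq_sum_range (fun i => L - 1 - i),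
    Finset.sum_range_reflect (fun i => i), ← Finset.sum_range_id_mul_two]
  ring

/-- The parameter choice making the interpolation determinant estimate contradictory. -/
lemma triangle_exponent_lt {k κ p R ℓ L L' T S₁ S₂ S₃ : ℕ} (hk : 0 < k) (hp : 0 < p)
    (hR : R = 10 + (k - 1) * (1 + κ)) (hℓ : 0 < ℓ) (hL' : L' = 2 * k * ℓ) (hL : L = 2 * L')
    (hT : T = 4096 * ((k + 7) * p * R * L ^ 2)) (hS₁ : S₁ = 128 * ((k + 7) * p * R * L ^ 2) + L)
    (hS₂ : S₂ = 1024 * (R * L ^ 2)) (hS₃ : S₃ = 1024 * ((k + 7) * p * L ^ 2)) :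
    (3 * ℓ * (T * ((T + 1) * L')) + ∑ j : TriangleIndex T × Fin L,
        (2 * ℓ * (j.1.1 : ℕ) + 8 * (S₁ + p * S₂ + S₃) * (j.2 : ℕ) + 3)) +
      S₃ * (L - 1) * (T * ((T + 1) * L')) +
      (3 * ℓ * (T * ((T + 1) * L')) + ∑ j : TriangleIndex T × Fin L,
        (2 * ℓ * (j.1.1 : ℕ) + (p * S₂ + S₃) * (j.2 : ℕ) + κ * S₃ * (L - 1 - (j.2 : ℕ)))) *
          (k - 1) < 3 * (T * ∑ q ∈ range ((T + 1) * L'), q) := by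
  have hL'1 : 0 < L' := by rw [hL']; positivity
  have hL1 : 2 ≤ L := by omega
  have hR1 : 10 ≤ R := by omega
  have hTL : 40960 * L ^ 2 ≤ T := by
    rw [hT]
    have : 1 ≤ (k + 7) * p := Nat.mul_pos (by omega) hp
    calc 40960 * L ^ 2 = 4096 * (1 * 10 * L ^ 2) := by ring
      _ ≤ _ := by gcongr
  have hT1 : 1 ≤ T := le_trans (Nat.succ_le_of_lt (by positivity)) hTL
  have e₁ := sum_fst_triangleIndex_prod T L
  have e₂ := sum_snd_triangleIndex_prod T L
  have e₃ := sum_sub_snd_triangleIndex_prod T L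
  have e₄ := Finset.sum_range_id_mul_two ((T + 1) * L')
  have hc : Fintype.card (TriangleIndex T × Fin L) = T * ((T + 1) * L') := by
    rw [Fintype.card_prod, Fintype.card_fin, hL, ← mul_assoc, card_triangleIndex, mul_assoc]
  simp only [Finset.sum_add_distrib, ← Finset.mul_sum, Finset.sum_const, Finset.card_univ, hc,
    smul_eq_mul]
  generalize ∑ j : TriangleIndex T × Fin L, (j.1.1 : ℕ) = X at *
  generalize ∑ j : TriangleIndex T × Fin L, (j.2 : ℕ) = Y at *
  generalize ∑ j : TriangleIndex T × Fin L, (L - 1 - (j.2 : ℕ)) = W at *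
  generalize ∑ q ∈ range ((T + 1) * L'), q = P at *
  clear hc
  obtain ⟨k', rfl⟩ : ∃ k', k = k' + 1 := ⟨k - 1, by omega⟩
  obtain ⟨M, rfl⟩ : ∃ M, L = M + 1 := ⟨L - 1, by omega⟩
  obtain ⟨t, ht⟩ : ∃ t, T = t + 1 := ⟨T - 1, by omega⟩
  obtain ⟨h, hh⟩ : ∃ h, (T + 1) * L' = h + 1 :=
    ⟨(T + 1) * L' - 1, by have : 0 < (T + 1) * L' := by positivity
                          omega⟩
  simp only [Nat.add_sub_cancel] at *
  have eK : 2 * (T * (h + 1)) = T * (T + 1) * (M + 1) := by rw [← hh, hL]; ring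
  rw [hh] at e₄ ⊢
  have hK : 0 < T * (h + 1) := by positivity
  simp only [Nat.add_sub_cancel] at e₄
  have f₁ : 3 * X = 2 * (T * (h + 1)) * t := by rw [e₁, eK, show T - 1 = t by omega]; ring
  have f₂ : 2 * Y = (T * (h + 1)) * M := by
    have : 4 * Y = 2 * (T * (h + 1)) * M := by rw [e₂, eK]; ring
    linarith
  have f₃ : 2 * W = (T * (h + 1)) * M := by
    have : 4 * W = 2 * (T * (h + 1)) * M := by rw [e₃, eK]; ring
    linarith
  have key : 18 * ((k' + 1) * ℓ) + 8 * ((k' + 1) * ℓ) * t + 24 * (S₁ + p * S₂ + S₃) * M + 18 +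
      6 * S₃ * M + 3 * (p * S₂ + S₃ + κ * S₃) * M * k' < 9 * h := by
    have g₁ : 4 * ((k' + 1) * ℓ) = M + 1 := by rw [hL, hL']; ring
    have g₂ : 4 * (24 * (S₁ + p * S₂ + S₃) + 6 * S₃ + 3 * (p * S₂ + S₃ + κ * S₃) * k') =
        9 * T + 96 * (M + 1) := by
      rw [hS₁, hS₂, hS₃, hT, hR]; ring
    have g₃ : 2 * (h + 1) = (T + 1) * (M + 1) := by rw [← hh, hL]; ring
    have g₄ : 4 * (18 * ((k' + 1) * ℓ) + 8 * ((k' + 1) * ℓ) * t + 24 * (S₁ + p * S₂ + S₃) * M +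
        18 + 6 * S₃ * M + 3 * (p * S₂ + S₃ + κ * S₃) * M * k') =
        18 * (M + 1) + 8 * (M + 1) * t + (9 * T + 96 * (M + 1)) * M + 72 := by
      rw [← g₂, ← g₁]; ring
    have g₅ : 36 * (h + 1) = 18 * ((T + 1) * (M + 1)) := by rw [← g₃]; ring
    have g₆ : 96 * M ^ 2 + 88 * M + 100 < 10 * T := by
      have : 40960 * (M + 1) ^ 2 = 40960 * M ^ 2 + 81920 * M + 40960 := by ring
      have := Nat.zero_le (M ^ 2)
      linarith
    rw [ht] at g₄ g₅ g₆
    have g₇ : 0 ≤ t * M := Nat.zero_le _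
    refine lt_of_mul_lt_mul_left (a := 4) ?_ (by norm_num)
    rw [g₄]
    linarith
  clear e₁ e₂ e₃ hS₁ hS₂ hS₃ hR hT hL hTL hL' hL1 hR1
  zify at *
  refine lt_of_mul_lt_mul_left (a := (6 : ℤ)) ?_ (by norm_num)
  linear_combination (T * (h + 1) : ℤ) * key + 4 * ℓ * (k' + 1) * f₁ +
    3 * (8 * (S₁ + p * S₂ + S₃) + (p * S₂ + S₃) * k') * f₂ + 3 * κ * S₃ * k' * f₃ - 9 * T * e₄

end TriangleSums

section ThreeLogarithms

lemma coordinate_bound {k p L x q : ℕ} (hk : 0 < k) (hp : 0 < p) (hL : 1 ≤ L)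
    (hq : q = 256 * ((k + 7) * p * L ^ 2)) (hx : 65536 * ((k + 7) * (p + 1) ^ 2 * L ^ 2) ≤ x) :
    8 * (x + 2 * x * (p + 1) * (4 * q)) + 18 * p * (x + x * (4 * q)) ≤ x * x := by
  have h1 : p + 1 ≤ (k + 7) * (p + 1) ^ 2 * L ^ 2 := by
    calc p + 1 = 1 * (p + 1) ^ 1 * 1 ^ 2 := by ring
      _ ≤ _ := by gcongr <;> omega
  have h2 : (p + 1) * q ≤ 256 * ((k + 7) * (p + 1) ^ 2 * L ^ 2) := by
    rw [hq]
    calc (p + 1) * (256 * ((k + 7) * p * L ^ 2)) =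
        256 * ((k + 7) * ((p + 1) * p) * L ^ 2) := by ring
      _ ≤ 256 * ((k + 7) * ((p + 1) * (p + 1)) * L ^ 2) := by gcongr; omega
      _ = _ := by ring
  have hqx : 136 * ((p + 1) * q) + 26 * (p + 1) ≤ x := by
    refine le_trans ?_ hx
    generalize (k + 7) * (p + 1) ^ 2 * L ^ 2 = D at *
    generalize (p + 1) * q = D' at *
    omega
  calc _ ≤ (136 * ((p + 1) * q) + 26 * (p + 1)) * x := by
        have h0 := Nat.zero_le (x * q)
        have h1 := Nat.zero_le (x * p)
        have h1 := Nat.zero_le (x * p * q)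
        nlinarith
    _ ≤ x * x := Nat.mul_le_mul_right _ hqx

set_option maxHeartbeats 1000000 in
/-- If the linear form in the logarithms of `a`, `α` and `g` is too small, then its coefficients
satisfy a linear relation of small height. -/
theorem exists_small_relation {k κ p R ℓ L N x a : ℕ} (hk : 0 < k) {α g δ lam : ℝ}
    (hα : 1 < α) (hα2 : α < 2) (hα3 : 2 ≤ α ^ 2) (hroot : α ^ k = ∑ i ∈ range k, α ^ i)
    (ha : 2 ≤ a) (hp : 0 < p) (hap : a ≤ 2 ^ p) (hκ : 3 * k + 1 ≤ 2 ^ κ)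
    (hδ : δ = (k + 1) * α - 2 * k) (hδ0 : 0 < δ) (hδ2 : δ ≤ 2) (hgδ : g * δ = α - 1) (hg : 0 < g)
    (hglog : |Real.log g| ≤ Real.log 2)
    (hlam : x * Real.log a - N * Real.log α - Real.log g = lam) (hlam_le : |lam| ≤ 4 / 2 ^ x)
    (hR : R = 10 + (k - 1) * (1 + κ)) (hℓ : 0 < ℓ) (hL : L = 4 * k * ℓ) (hxℓ : x ≤ 2 ^ ℓ)
    (hxN : x ≤ N) (hNx : N ≤ 2 * x * (p + 1)) (hx₁ : 8192 * ((k + 7) * p * R * L ^ 3) ≤ x)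
    (hx₂ : 65536 * ((k + 7) * (p + 1) ^ 2 * L ^ 2) ≤ x) :
    ∃ (A : ℕ) (B : ℤ), 0 < A ∧ A < 128 ∧ (x * B - N * A).natAbs < 16 * R := by
  have hR0 : 10 ≤ R := by omega
  have hL4 : 4 ≤ L := by
    rw [hL]
    have : 1 ≤ k * ℓ := Nat.mul_pos hk hℓ
    nlinarith
  have hk7 : 8 ≤ k + 7 := by omega
  obtain ⟨V, hV⟩ : ∃ V, V = (k + 7) * p * R * L ^ 2 := ⟨_, rfl⟩
  have hVx : 8192 * (V * L) ≤ x := by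
    rw [hV]; refine le_trans (le_of_eq ?_) hx₁; ring
  have hV1 : 0 < V := by rw [hV]; positivity
  have hVx' : 32768 * V ≤ x := by nlinarith
  have hLV : L ≤ V := by
    rw [hV]
    calc L = 1 * 1 * 1 * L ^ 1 := by ring
      _ ≤ _ := by gcongr <;> omega
  obtain ⟨q₁, hq₁⟩ : ∃ q₁, q₁ = 32 * V := ⟨_, rfl⟩
  obtain ⟨q₂, hq₂⟩ : ∃ q₂, q₂ = 256 * (R * L ^ 2) := ⟨_, rfl⟩
  obtain ⟨q₃, hq₃⟩ : ∃ q₃, q₃ = 256 * ((k + 7) * p * L ^ 2) := ⟨_, rfl⟩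
  obtain ⟨T, hT⟩ : ∃ T, T = 4096 * V := ⟨_, rfl⟩
  have hq₂V : q₂ ≤ 32 * V := by
    rw [hq₂, hV]
    calc 256 * (R * L ^ 2) = 32 * (8 * 1 * R * L ^ 2) := by ring
      _ ≤ _ := by gcongr; omega
  have hq₃V : q₃ ≤ 26 * V := by
    rw [hq₃, hV]
    nlinarith [Nat.mul_le_mul_left ((k + 7) * p * L ^ 2) hR0]
  have hTR : T = 16 * R * q₃ := by rw [hT, hq₃, hV]; ring
  have hT0 : 0 < T := by omega
  rcases exists_interpolation_det_ne_zero hα (a := a) (by exact_mod_cast ha) hg (N := N) (x := x)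
    (L := L) (T := T) (q₁ := q₁) (q₂ := q₂) (q₃ := q₃) (by omega) hT0
    (fun A B hA => pow_ne_natCast_pow hk hroot ha A B hA) (by omega) (by omega)
    (by
      refine le_of_eq ?_
      rw [hT, hq₁, hq₂, hq₃, hV]; ring)
    (by
      rw [hT, hq₁, hq₂]
      calc L ^ 2 * (4096 * V) = 32 * V * (128 * (1 * L ^ 2)) := by ring
        _ ≤ 32 * V * (256 * (R * L ^ 2)) := by gcongr <;> omega)
    (by
      rw [hT, hq₁, hq₃]
      calc L * (4096 * V) = 32 * V * (128 * (1 * 1 * L ^ 1)) := by ring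
        _ ≤ 32 * V * (256 * ((k + 7) * p * L ^ 2)) := by gcongr <;> omega)
    (by
      rw [hT, hq₂, hq₃, hV]
      calc L * (4096 * ((k + 7) * p * R * L ^ 2)) =
          4096 * ((k + 7) * p * R * L ^ 3) := by ring
        _ ≤ 262144 * ((k + 7) * p * R * L ^ 4) := by gcongr <;> omega
        _ = _ := by ring) with ⟨s, hs, hdet⟩ | ⟨A, B, hA, hAq, hBq⟩
  · exfalso
    have hbox := fun i => mem_boxPoints.1 (hs i)
    have hlα : 0 < Real.log α := Real.log_pos hα
    have hlog : Real.log a / Real.log α ≤ 2 * p := by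
      rw [div_le_iff₀ hlα]
      have h1 : Real.log a ≤ p * Real.log 2 := by
        rw [← Real.log_pow]
        exact Real.log_le_log (by positivity) (by exact_mod_cast hap)
      have h2 : Real.log 2 ≤ 2 * Real.log α := by
        have := Real.log_le_log (by norm_num) hα3
        rwa [Real.log_pow] at this
      nlinarith
    have hlog0 : 0 ≤ Real.log a / Real.log α := div_nonneg (Real.log_natCast_nonneg a) hlα.le
    have hw₁ : ∀ i, |planePoint N x (s i) 0| ≤ ((x + 2 * x * (p + 1) * (4 * q₃) : ℕ) : ℝ) := by
      intro i
      obtain ⟨h1, -, h3⟩ := hbox i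
      have h1' : (s i).1 ≤ x := by omega
      have h3' : N * (s i).2.2 ≤ 2 * x * (p + 1) * (4 * q₃) := by gcongr
      have h1'' : ((s i).1 : ℝ) ≤ x := by exact_mod_cast h1'
      have h3'' : (N * (s i).2.2 : ℝ) ≤ ((2 * x * (p + 1) * (4 * q₃) : ℕ) : ℝ) := by
        exact_mod_cast h3'
      have e : planePoint N x (s i) 0 = (s i).1 - N * (s i).2.2 := by simp [planePoint]
      rw [e, Nat.cast_add, abs_le]
      constructor
      · have : (0 : ℝ) ≤ (s i).1 := by positivity
        have : (0 : ℝ) ≤ x := by positivity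
        linarith
      · have : (0 : ℝ) ≤ N * (s i).2.2 := by positivity
        have : (0 : ℝ) ≤ ((2 * x * (p + 1) * (4 * q₃) : ℕ) : ℝ) := by positivity
        linarith
    have hw₂ : ∀ i, |planePoint N x (s i) 1| ≤ ((x + x * (4 * q₃) : ℕ) : ℝ) := by
      intro i
      obtain ⟨-, h2, h3⟩ := hbox i
      have e : planePoint N x (s i) 1 = (((s i).2.1 + x * (s i).2.2 : ℕ) : ℝ) := by
        simp [planePoint]
      rw [e, Nat.abs_cast]
      have h2' : (s i).2.1 ≤ x := by omega
      have : (s i).2.1 + x * (s i).2.2 ≤ x + x * (4 * q₃) := by gcongr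
      exact_mod_cast this
    have hpow : x * x ≤ 2 ^ (2 * ℓ) := by
      calc x * x ≤ 2 ^ ℓ * 2 ^ ℓ := Nat.mul_le_mul hxℓ hxℓ
        _ = _ := by ring
    have hbig : 8 * (x + 2 * x * (p + 1) * (4 * q₃)) + 18 * p * (x + x * (4 * q₃)) ≤
        2 ^ (2 * ℓ) := by
      exact (coordinate_bound hk hp (by omega) hq₃ hx₂).trans hpow
    have hbig' : ((8 * (x + 2 * x * (p + 1) * (4 * q₃)) + 18 * p * (x + x * (4 * q₃)) : ℕ) : ℝ) ≤
        2 ^ (2 * ℓ) := by exact_mod_cast hbig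
    push_cast at hbig' hw₁ hw₂
    have hxx : (0 : ℝ) ≤ x := by positivity
    have hH : 3 * ((T + 1) * (2 * k * ℓ)) + 2 * ℓ + 2 ≤ x := by
      have hℓL : ℓ ≤ L := by rw [hL]; nlinarith
      have e : 2 * (2 * k * ℓ) = L := by rw [hL]; ring
      have e2 : 2 * (3 * ((T + 1) * (2 * k * ℓ))) = 3 * (4096 * V + 1) * L := by
        rw [← e, hT]; ring
      have e3 : L ≤ V * L := Nat.le_mul_of_pos_left _ hV1
      have e4 : 3 * (4096 * V + 1) * L = 12288 * (V * L) + 3 * L := by ring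
      omega
    have hTℓ : T + 1 ≤ 2 ^ ℓ := by omega
    have hlt := triangle_exponent_lt (k := k) (κ := κ) (p := p) (R := R) (ℓ := ℓ) (L := L)
      (L' := 2 * k * ℓ) (T := T) (S₁ := 4 * q₁ + L) (S₂ := 4 * q₂) (S₃ := 4 * q₃) hk hp hR hℓ rfl
      (by rw [hL]; ring) (by rw [hT, hV]) (by rw [hq₁, hV]; ring) (by rw [hq₂]; ring)
      (by rw [hq₃]; ring)
    refine hlt.not_ge (exponent_le_of_triangle_det_ne_zero hk hα hα2 hroot ha hap hκ hδ hδ0 hδ2 hgδ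
      hg hglog hlam (by rw [hL]; ring) (by positivity) hT0 ?_ ?_ s hs ?_ ?_ ?_ hdet)
    · have hLℓ : L ≤ 2 ^ ℓ := by omega
      have hq₃ℓ : 4 * q₃ ≤ 2 ^ ℓ := by omega
      have h1 : (L : ℝ) * ((4 * q₃ : ℕ) : ℝ) ≤ 2 ^ ℓ * 2 ^ ℓ := by
        exact_mod_cast Nat.mul_le_mul hLℓ hq₃ℓ
      calc (L : ℝ) * ((4 * q₃ : ℕ) : ℝ) * |lam| * 8 ^ ((T + 1) * (2 * k * ℓ)) ≤
          2 ^ ℓ * 2 ^ ℓ * (4 / 2 ^ x) * 8 ^ ((T + 1) * (2 * k * ℓ)) := by gcongr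
        _ = 2 ^ (3 * ((T + 1) * (2 * k * ℓ)) + 2 * ℓ + 2) / 2 ^ x := by
            rw [pow_add, pow_add, pow_mul 2 3, two_mul ℓ, pow_add]
            ring
        _ ≤ 1 := by
            rw [div_le_one (by positivity)]
            exact pow_le_pow_right₀ one_le_two hH
    · have h2 : 2 * k * ℓ ≤ 2 ^ ℓ := by
        have : 2 * k * ℓ ≤ L := by rw [hL]; gcongr; omega
        omega
      calc T * ((T + 1) * (2 * k * ℓ)) ≤ 2 ^ ℓ * (2 ^ ℓ * 2 ^ ℓ) := by
            gcongr
            omega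
        _ = _ := by ring
    · intro i
      refine (hw₁ i).trans (le_trans ?_ hbig')
      have : (0 : ℝ) ≤ 18 * p * (x + x * (4 * q₃)) := by positivity
      have : (0 : ℝ) ≤ x + 2 * x * (p + 1) * (4 * q₃) := by positivity
      linarith
    · intro i
      refine (hw₂ i).trans (le_trans ?_ hbig')
      have h1 : (1 : ℝ) ≤ p := by exact_mod_cast hp
      have h2 : (0 : ℝ) ≤ x + x * (4 * q₃) := by positivity
      have : (0 : ℝ) ≤ x + 2 * x * (p + 1) * (4 * q₃) := by positivity
      nlinarith
    · intro i
      refine le_trans ?_ hbig'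
      have h3 : |planePoint N x (s i) 1| * (Real.log a / Real.log α) ≤
          (x + x * (4 * q₃)) * (2 * p) := mul_le_mul (hw₂ i) hlog hlog0 (by positivity)
      have := hw₁ i
      linarith
  · refine ⟨A, B, hA, ?_, ?_⟩
    · have : A * q₁ < 128 * q₁ := by omega
      exact lt_of_mul_lt_mul_right this (Nat.zero_le _)
    · rw [hTR] at hBq
      exact lt_of_mul_lt_mul_right hBq (Nat.zero_le _)

end ThreeLogarithms

section TwoVariableZeroEstimate
open Polynomial

lemma exists_power_det_ne_zero {γ ε : ℝ} (hγ : 0 < γ) (hγ1 : γ ≠ 1) (hε : ε ≠ 0)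
    {x I J L T : ℕ} (hIx : I ≤ x) (h : L * (T - 1) < (I - L) * J) :
    ∃ s : Fin T × Fin L → ℕ × ℕ, (∀ i, (s i).1 < I ∧ (s i).2 < J) ∧
      (Matrix.of fun i j : Fin T × Fin L => ((s i).1 + x * (s i).2 : ℝ) ^ (j.1 : ℕ) *
        (γ ^ (s i).1 * ε ^ (s i).2) ^ (j.2 : ℕ)).det ≠ 0 := by
  obtain ⟨f, hf⟩ := exists_det_ne_zero_of_forall_sum_eq_zero
    (S := {q : ℕ × ℕ // q ∈ range I ×ˢ range J}) (J := Fin T × Fin L)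
    (fun q j => ((q.1.1 : ℝ) + x * q.1.2) ^ (j.1 : ℕ) *
      (γ ^ q.1.1 * ε ^ q.1.2) ^ (j.2 : ℕ)) (by
    intro c hc
    set P : ℕ → ℝ[X] := fun σ => if hσ : σ < L then
      ∑ τ : Fin T, C (c (τ, ⟨σ, hσ⟩)) * X ^ (τ : ℕ) else 0 with hP
    have hPσ : ∀ σ : Fin L, P σ = ∑ τ : Fin T, C (c (τ, σ)) * X ^ (τ : ℕ) := fun σ => by
      simp [hP]
    have hcoeff : ∀ (σ : Fin L) (τ : Fin T), (P σ).coeff τ = c (τ, σ) := fun σ τ => by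
      rw [hPσ, finsetSum_coeff, Finset.sum_eq_single τ]
      · simp
      · intro b _ hb
        have : (τ : ℕ) ≠ b := fun e => hb (Fin.ext e.symm)
        simp [coeff_X_pow, this]
      · simp
    have hzero : ∀ σ < L, P σ = 0 := by
      refine exponential_polynomial_eq_zero (T := T) (fun σ => γ ^ σ) ?_ P ?_
        (((range (I - L) ×ˢ range J).image fun q : ℕ × ℕ => q.1 + x * q.2).image
          ((↑) : ℕ → ℝ)) ?_ ?_
      · intro σ _ τ _ hst
        exact pow_right_injective₀ hγ hγ1 hst
      · intro σ hσ hne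
        have hdeg : (P σ).degree < T := by
          rw [hPσ ⟨σ, hσ⟩]
          refine (degree_sum_le _ _).trans_lt ((Finset.sup_lt_iff (WithBot.bot_lt_coe T)).2 ?_)
          intro τ _
          exact (degree_C_mul_X_pow_le _ _).trans_lt ((Nat.cast_lt (α := WithBot ℕ)).2 τ.2)
        exact (natDegree_lt_iff_degree_lt hne).2 hdeg
      · rw [Finset.card_image_of_injective _ Nat.cast_injective, Finset.card_image_of_injOn,
          Finset.card_product, Finset.card_range, Finset.card_range]
        · exact h
        · rintro ⟨i, j⟩ hij ⟨i', j'⟩ hij' (e : i + x * j = i' + x * j')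
          simp only [Finset.coe_product, Set.mem_prod, Finset.mem_coe, Finset.mem_range] at hij hij'
          have hx : 0 < x := by omega
          have h1 : j = j' := by
            have h1 := congrArg (· / x) e
            simp only [Nat.add_mul_div_left _ _ hx] at h1
            rwa [Nat.div_eq_of_lt (by omega), Nat.div_eq_of_lt (by omega), zero_add,
              zero_add] at h1
          subst h1
          simpa using e
      · intro t ht
        simp only [Finset.mem_image, Finset.mem_product, Finset.mem_range] at ht
        obtain ⟨_, ⟨⟨i, j⟩, ⟨hi, hj⟩, rfl⟩, rfl⟩ := ht
        simp only at hi hj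
        refine ⟨fun σ => (γ ^ i * ε ^ j) ^ σ, fun σ => by positivity, fun r hr => ?_⟩
        have h0 := hc ⟨(i + r, j), by simp only [Finset.mem_product, Finset.mem_range]; omega⟩
        rw [Fintype.sum_prod_type_right] at h0
        rw [← Fin.sum_univ_eq_sum_range (fun σ => (P σ).eval (((i + x * j : ℕ) : ℝ) + r) *
          (γ ^ σ) ^ r * (γ ^ i * ε ^ j) ^ σ)]
        refine Eq.trans (Finset.sum_congr rfl fun σ _ => ?_) h0
        rw [hPσ, eval_finsetSum, Finset.sum_mul, Finset.sum_mul]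
        refine Finset.sum_congr rfl fun τ _ => ?_
        simp only [eval_mul, eval_C, eval_pow, eval_X]
        push_cast
        rw [← pow_mul, mul_comm (σ : ℕ) r, pow_mul γ r, mul_assoc, ← mul_pow, pow_add]
        ring
    funext ⟨τ, σ⟩
    rw [← hcoeff, hzero σ σ.2]
    simp)
  exact ⟨fun i => (f i).1, fun i => by
    simpa only [Finset.mem_product, Finset.mem_range] using (f i).2,
    hf⟩

end TwoVariableZeroEstimate

section TwoLogarithms
open Polynomial

/-- The inequality resulting from a nonvanishing interpolation determinant for two multiplicative
combinations of `α`, `a` and `(α - 1) / ((k + 1) * α - 2 * k)`. -/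
theorem exponent_le_of_power_det_ne_zero {k : ℕ} (hk : 0 < k) {α : ℝ} (hα : 1 < α)
    (hα2 : α < 2) (hroot : α ^ k = ∑ i ∈ range k, α ^ i)
    {a p κ ν ξ x L T I J A B C₁ C₂ V : ℕ}
    (ha : 2 ≤ a) (hap : a ≤ 2 ^ p) (hκ : 3 * k + 1 ≤ 2 ^ κ) {g δ γ ε mu : ℝ}
    (hδ : δ = (k + 1) * α - 2 * k) (hδ0 : 0 < δ) (hδ2 : δ ≤ 2) (hgδ : g * δ = α - 1)
    (hγ0 : 0 < γ) (hε0 : 0 < ε) (hγ1 : γ ≠ 1)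
    (hγ : γ * α ^ B = a ^ A) (hε : ε * α ^ C₁ = g ^ A * α ^ C₂)
    (hmu : x * Real.log γ - Real.log ε = mu) (hL : 0 < L) (hT : 0 < T)
    (hV : I * |Real.log γ| + J * |Real.log ε| ≤ V * Real.log 2)
    (hsmall : L * J * |mu| * 8 ^ (T * L) ≤ 1) (hcard : T * L ≤ 2 ^ ξ)
    (s : Fin T × Fin L → ℕ × ℕ) (hs : ∀ i, (s i).1 < I ∧ (s i).2 < J)
    (hw : 8 * (I + x * J) ≤ 2 ^ ν)
    (hdet : (Matrix.of fun i j : Fin T × Fin L => ((s i).1 + x * (s i).2 : ℝ) ^ (j.1 : ℕ) *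
        (γ ^ (s i).1 * ε ^ (s i).2) ^ (j.2 : ℕ)).det ≠ 0) :
    3 * ∑ q ∈ range (T * L), q ≤
      (ξ * (T * L) + ∑ j : Fin T × Fin L, (ν * (j.1 : ℕ) + 8 * V * (j.2 : ℕ) + 3)) +
      (B * I + C₁ * J + A * J) * (L - 1) * (T * L) +
      (ξ * (T * L) + ∑ j : Fin T × Fin L, (ν * (j.1 : ℕ) + (p * A * I + A * J) * (j.2 : ℕ) +
        κ * A * J * (L - 1 - (j.2 : ℕ)))) * (k - 1) := by
  have hα0 : 0 < α := by linarith
  have ha0 : (0 : ℝ) ≤ a := by positivity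
  have hH1 : 1 ≤ T * L := Nat.mul_pos hT hL
  have hKcard : Fintype.card (Fin T × Fin L) = T * L := by simp
  have hlγ : Real.log γ ≠ 0 := Real.log_ne_zero_of_pos_of_ne_one hγ0 hγ1
  set w : Fin T × Fin L → ℕ := fun i => (s i).1 + x * (s i).2 with hwdef
  have hwle : ∀ i, 8 * (w i : ℝ) ≤ 2 ^ ν := fun i => by
    obtain ⟨h1, h2⟩ := hs i
    have : 8 * w i ≤ 2 ^ ν := le_trans (by rw [hwdef]; dsimp only; gcongr) hw
    exact_mod_cast this
  have hwle' : ∀ i, (w i : ℝ) ≤ 2 ^ ν := fun i => by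
    have := hwle i
    have h0 : (0 : ℝ) ≤ w i := by positivity
    linarith
  set v : Fin T × Fin L → ℝ := fun i => w i * Real.log γ with hv
  have hv' : ∀ i, v i = (s i).1 * Real.log γ + (s i).2 * (Real.log ε + mu) := fun i => by
    rw [hv, ← hmu]; simp only [hwdef]; push_cast; ring
  have hexpo : ∀ i, γ ^ (s i).1 * ε ^ (s i).2 = Real.exp (v i - (s i).2 * mu) := fun i => by
    rw [hv', show ((s i).1 * Real.log γ + (s i).2 * (Real.log ε + mu) - (s i).2 * mu) =
      (s i).1 * Real.log γ + (s i).2 * Real.log ε by ring, Real.exp_add, ← Real.log_pow,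
      ← Real.log_pow, Real.exp_log (by positivity), Real.exp_log (by positivity)]
  have hvle : ∀ i, |v i| ≤ V * Real.log 2 + J * |mu| := fun i => by
    obtain ⟨h1, h2⟩ := hs i
    have h1' : ((s i).1 : ℝ) ≤ I := by exact_mod_cast h1.le
    have h2' : ((s i).2 : ℝ) ≤ J := by exact_mod_cast h2.le
    rw [hv']
    calc _ ≤ |(s i).1 * Real.log γ| + |(s i).2 * (Real.log ε + mu)| := abs_add_le _ _
      _ = (s i).1 * |Real.log γ| + (s i).2 * |Real.log ε + mu| := by
          rw [abs_mul, abs_mul, Nat.abs_cast, Nat.abs_cast]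
      _ ≤ I * |Real.log γ| + J * (|Real.log ε| + |mu|) := by
          gcongr
          exact abs_add_le _ _
      _ ≤ _ := by linarith
  have hLS : (L : ℝ) * J * |mu| * 8 ≤ 1 := by
    refine le_trans ?_ hsmall
    refine mul_le_mul_of_nonneg_left ?_ (by positivity)
    exact le_self_pow₀ (by norm_num) (by omega)
  have hZα : ∀ i, aeval α (X ^ (B * (s i).1 + C₁ * (s i).2) *
      (C ((k : ℤ) + 1) * X - C (2 * (k : ℤ))) ^ (A * (s i).2)) =
      α ^ (B * (s i).1 + C₁ * (s i).2) * δ ^ (A * (s i).2) := fun i => by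
    rw [map_mul, map_pow, map_pow, Polynomial.aeval_C_mul_X_sub_C, ← hδ, aeval_X]
  have hmaster := pow_le_of_interpolation_determinant hk hroot (M := 1) (H := T * L) (L := L)
    (by rw [hKcard, one_mul]) (fun i j => (w i : ℤ) ^ (j.1 : ℕ))
    (fun j => (j.2 : ℕ)) (fun j => j.2.2)
    (fun i => C (a : ℤ) ^ (A * (s i).1) * (X - 1) ^ (A * (s i).2) * X ^ (C₂ * (s i).2))
    (fun i => X ^ (B * (s i).1 + C₁ * (s i).2) *
      (C ((k : ℤ) + 1) * X - C (2 * (k : ℤ))) ^ (A * (s i).2))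
    (fun i => γ ^ (s i).1 * ε ^ (s i).2) (U := 2 ^ (B * I + C₁ * J + A * J))
    (fun i => by rw [hZα]; positivity)
    (fun i => by
      obtain ⟨h1, h2⟩ := hs i
      rw [hZα, pow_add _ (B * I + C₁ * J)]
      have t1 : α ^ (B * (s i).1 + C₁ * (s i).2) ≤ 2 ^ (B * I + C₁ * J) :=
        (pow_le_pow_left₀ hα0.le hα2.le _).trans (pow_le_pow_right₀ one_le_two (by gcongr))
      have t2 : δ ^ (A * (s i).2) ≤ 2 ^ (A * J) :=
        (pow_le_pow_left₀ hδ0.le hδ2 _).trans (pow_le_pow_right₀ one_le_two (by gcongr))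
      gcongr)
    (fun i => by
      rw [hZα]
      have e : aeval α (C (a : ℤ) ^ (A * (s i).1) * (X - 1) ^ (A * (s i).2) *
          X ^ (C₂ * (s i).2)) = (a : ℝ) ^ (A * (s i).1) * (α - 1) ^ (A * (s i).2) *
          α ^ (C₂ * (s i).2) := by simp
      rw [e, ← hgδ, pow_mul _ A, pow_mul _ A, pow_mul _ C₂, pow_add, pow_mul _ B, pow_mul _ C₁,
        pow_mul _ A, ← hγ, mul_pow g δ A, mul_pow (g ^ A), mul_pow γ]
      have e2 : (ε * α ^ C₁) ^ (s i).2 = (g ^ A * α ^ C₂) ^ (s i).2 := by rw [hε]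
      rw [mul_pow, mul_pow] at e2
      linear_combination γ ^ (s i).1 * (α ^ B) ^ (s i).1 * (δ ^ A) ^ (s i).2 * e2)
    (by
      convert hdet using 5
      simp [hwdef])
    (fun _ => 0) (fun i => (v i : ℂ))
    (fun j _ ζ => (ζ / Real.log γ) ^ (j.1 : ℕ) * Complex.exp ((j.2 : ℕ) * ζ))
    (fun j => by
      have := IsPolyEntire.monomial (M := 1) one_pos
        (φ := fun ζ : ℂ => (ζ / Real.log γ) ^ (j.1 : ℕ) * Complex.exp ((j.2 : ℕ) * ζ))
        (by fun_prop)
      simpa using this)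
    (fun i j => -((j.2 : ℕ) * (s i).2 * mu : ℝ))
    (fun i j => by
      rw [hexpo]
      have e1 : (v i : ℂ) / (Real.log γ : ℂ) = (w i : ℂ) := by
        rw [div_eq_iff (by exact_mod_cast hlγ), hv]
        push_cast; ring
      rw [e1, mul_assoc _ (Complex.exp _), ← Complex.exp_add, ← Real.exp_nat_mul]
      push_cast
      congr 2
      ring)
    (E := 8) (by norm_num)
    (fun j => 2 ^ (ν * (j.1 : ℕ) + 8 * V * (j.2 : ℕ) + 3))
    (fun i j z hz => by
      rw [mul_assoc, ← Complex.exp_add, norm_mul, norm_pow, pow_add, pow_add,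
        mul_assoc ((2 : ℝ) ^ _)]
      refine mul_le_mul ?_ ?_ (norm_nonneg _) (by positivity)
      · rw [pow_mul]
        refine pow_le_pow_left₀ (norm_nonneg _) (le_trans (le_of_eq ?_) (hwle i)) _
        have e1 : (v i : ℂ) * z / (Real.log γ : ℂ) = (w i : ℂ) * z := by
          rw [div_eq_iff (by exact_mod_cast hlγ), hv]
          push_cast; ring
        rw [e1, norm_mul, hz, Complex.norm_natCast, mul_comm]
      · rw [Complex.norm_exp]
        have h1 : (((j.2 : ℕ) : ℂ) * ((v i : ℂ) * z) +
            (-((j.2 : ℕ) * (s i).2 * mu : ℝ) : ℂ) * z ^ (T * L)).re ≤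
            (8 * V * (j.2 : ℕ) : ℕ) * Real.log 2 + 2 := by
          refine (Complex.re_le_norm _).trans ((norm_add_le _ _).trans ?_)
          rw [norm_mul, norm_mul, norm_mul, norm_neg, norm_pow, hz, Complex.norm_real,
            Complex.norm_natCast, Complex.norm_real, Real.norm_eq_abs, Real.norm_eq_abs,
            abs_mul _ mu, abs_mul _ ((s i).2 : ℝ), Nat.abs_cast, Nat.abs_cast]
          have h3' : ((s i).2 : ℝ) ≤ J := by exact_mod_cast (hs i).2.le
          have e1 : ((j.2 : ℕ) : ℝ) * (s i).2 * |mu| * 8 ^ (T * L) ≤ 1 := by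
            refine le_trans ?_ hsmall
            gcongr
            exact j.2.2.le
          have e2 : ((j.2 : ℕ) : ℝ) * (|v i| * 8) ≤ ((j.2 : ℕ) : ℝ) *
              ((V * Real.log 2 + J * |mu|) * 8) := by
            gcongr
            exact hvle i
          have e3 : ((j.2 : ℕ) : ℝ) * J * |mu| * 8 ≤ 1 := by
            refine le_trans ?_ hLS
            gcongr
            exact j.2.2.le
          have e4 : ((j.2 : ℕ) : ℝ) * ((V * Real.log 2 + J * |mu|) * 8) =
              (8 * V * (j.2 : ℕ) : ℕ) * Real.log 2 +
                ((j.2 : ℕ) : ℝ) * J * |mu| * 8 := by push_cast; ring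
          linarith
        refine (Real.exp_le_exp.2 h1).trans ?_
        rw [Real.exp_add, ← Real.log_pow, Real.exp_log (by positivity)]
        refine mul_le_mul_of_nonneg_left ?_ (by positivity)
        have := Real.exp_one_lt_d9
        have h2 : Real.exp 2 = Real.exp 1 ^ 2 := by rw [← Real.exp_nat_mul]; norm_num
        rw [h2]
        have := Real.exp_pos 1
        nlinarith)
    (fun j => 2 ^ (ν * (j.1 : ℕ) + (p * A * I + A * J) * (j.2 : ℕ) +
      κ * A * J * (L - 1 - (j.2 : ℕ))))
    (fun j => one_le_pow₀ one_le_two)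
    (fun z hz hzα i j => by
      have hz1 := norm_le_one_of_ne_dominant hk hα0 hroot hz hzα
      obtain ⟨h1, h2⟩ := hs i
      rw [pow_add (2 : ℝ), pow_add (2 : ℝ), mul_assoc ((2 : ℝ) ^ _), pow_mul (2 : ℝ) ν,
        pow_mul (2 : ℝ) (_ + _), pow_mul (2 : ℝ) (κ * A * J)]
      refine mul_le_mul ?_ ?_ (by positivity) (by positivity)
      · push_cast
        rw [abs_of_nonneg (by positivity)]
        exact pow_le_pow_left₀ (by positivity) (hwle' i) _
      refine mul_le_mul ?_ ?_ (by positivity) (by positivity)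
      · refine pow_le_pow_left₀ (norm_nonneg _) ?_ _
        simp only [map_mul, map_pow, map_sub, aeval_X, aeval_C, map_one, norm_mul, norm_pow]
        have t1 : ‖z‖ ^ (C₂ * (s i).2) ≤ 1 := pow_le_one₀ (norm_nonneg _) hz1
        have t2 : ‖(algebraMap ℤ ℂ) (a : ℤ)‖ ^ (A * (s i).1) ≤ 2 ^ (p * A * I) := by
          have e : ‖(algebraMap ℤ ℂ) (a : ℤ)‖ = a := by simp
          rw [e, mul_assoc p, pow_mul (2 : ℝ)]
          calc (a : ℝ) ^ (A * (s i).1) ≤ (2 ^ p) ^ (A * (s i).1) :=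
                pow_le_pow_left₀ ha0 (by exact_mod_cast hap) _
            _ ≤ _ := pow_le_pow_right₀ (one_le_pow₀ one_le_two) (by gcongr)
        have t3 : ‖z - 1‖ ^ (A * (s i).2) ≤ 2 ^ (A * J) := by
          have : ‖z - 1‖ ≤ 2 := by
            refine (norm_sub_le _ _).trans ?_
            rw [norm_one]; linarith
          exact (pow_le_pow_left₀ (norm_nonneg _) this _).trans
            (pow_le_pow_right₀ one_le_two (by gcongr))
        rw [pow_add]
        exact (mul_le_mul (mul_le_mul t2 t3 (by positivity) (by positivity)) t1 (by positivity)
          (by positivity)).trans_eq (mul_one _)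
      · refine pow_le_pow_left₀ (norm_nonneg _) ?_ _
        rw [map_mul, map_pow, map_pow, Polynomial.aeval_C_mul_X_sub_C, aeval_X, norm_mul, norm_pow,
          norm_pow]
        have t1 : ‖z‖ ^ (B * (s i).1 + C₁ * (s i).2) ≤ 1 := pow_le_one₀ (norm_nonneg _) hz1
        have : ‖((k : ℂ) + 1) * z - 2 * k‖ ≤ 2 ^ κ := by
          refine (norm_sub_le _ _).trans ?_
          rw [norm_mul, norm_mul, ← Nat.cast_add_one, Complex.norm_natCast, Complex.norm_natCast,
            RCLike.norm_ofNat]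
          have e3 : (3 * k + 1 : ℝ) ≤ 2 ^ κ := by exact_mod_cast hκ
          push_cast
          nlinarith [norm_nonneg z]
        have t2 : ‖((k : ℂ) + 1) * z - 2 * k‖ ^ (A * (s i).2) ≤ 2 ^ (κ * A * J) := by
          rw [mul_assoc κ, pow_mul (2 : ℝ)]
          exact (pow_le_pow_left₀ (norm_nonneg _) this _).trans
            (pow_le_pow_right₀ (one_le_pow₀ one_le_two) (by gcongr))
        rw [← one_mul ((2 : ℝ) ^ _)]
        gcongr)
  have hfact : ((T * L).factorial : ℝ) ≤ (2 ^ ξ) ^ (T * L) :=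
    calc ((T * L).factorial : ℝ) ≤ ((T * L : ℕ) : ℝ) ^ (T * L) := by
          exact_mod_cast Nat.factorial_le_pow _
      _ ≤ _ := pow_le_pow_left₀ (by positivity) (by exact_mod_cast hcard) _
  rw [Finset.prod_pow_eq_pow_sum, Finset.prod_pow_eq_pow_sum, hKcard, one_mul] at hmaster
  have hfin : (2 : ℝ) ^ (3 * ∑ q ∈ range (T * L), q) ≤ 2 ^ (
      (ξ * (T * L) + ∑ j : Fin T × Fin L, (ν * (j.1 : ℕ) + 8 * V * (j.2 : ℕ) + 3)) +
      (B * I + C₁ * J + A * J) * (L - 1) * (T * L) +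
      (ξ * (T * L) + ∑ j : Fin T × Fin L, (ν * (j.1 : ℕ) + (p * A * I + A * J) * (j.2 : ℕ) +
        κ * A * J * (L - 1 - (j.2 : ℕ)))) * (k - 1)) := by
    calc (2 : ℝ) ^ (3 * ∑ q ∈ range (T * L), q) = 8 ^ (∑ q ∈ range (T * L), q) := by
          rw [pow_mul]; norm_num
      _ ≤ _ := hmaster
      _ ≤ _ := by
          rw [pow_add _ (_ + _ * (T * L)), pow_add _ (ξ * _ + _), pow_add _ (ξ * _),
            pow_mul _ _ (k - 1), pow_add _ (ξ * _), pow_mul _ ξ (T * L),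
            pow_mul _ (_ * (L - 1)) (T * L), pow_mul _ _ (L - 1)]
          gcongr
  exact (pow_le_pow_iff_right₀ one_lt_two).1 hfin

end TwoLogarithms

section TwoLogarithms

lemma sum_fst_fin_prod (T L : ℕ) :
    2 * ∑ j : Fin T × Fin L, (j.1 : ℕ) = T * L * (T - 1) := by
  rw [Fintype.sum_prod_type]
  simp only [Finset.sum_const, Finset.card_univ, Fintype.card_fin, smul_eq_mul]
  rw [← Finset.mul_sum, Fin.sum_univ_eq_sum_range (fun i => i), mul_left_comm, mul_comm 2,
    Finset.sum_range_id_mul_two]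
  ring

lemma sum_snd_fin_prod (T L : ℕ) :
    2 * ∑ j : Fin T × Fin L, (j.2 : ℕ) = T * L * (L - 1) := by
  rw [Fintype.sum_prod_type]
  simp only [Finset.sum_const, Finset.card_univ, Fintype.card_fin, smul_eq_mul]
  rw [Fin.sum_univ_eq_sum_range (fun i => i), mul_left_comm, mul_comm 2,
    Finset.sum_range_id_mul_two]
  ring

lemma sum_sub_snd_fin_prod (T L : ℕ) :
    2 * ∑ j : Fin T × Fin L, (L - 1 - (j.2 : ℕ)) = T * L * (L - 1) := by
  rw [Fintype.sum_prod_type]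
  simp only [Finset.sum_const, Finset.card_univ, Fintype.card_fin, smul_eq_mul]
  rw [Fin.sum_univ_eq_sum_range (fun i => L - 1 - i), Finset.sum_range_reflect (fun i => i),
    mul_left_comm, mul_comm 2, Finset.sum_range_id_mul_two]
  ring

lemma power_height_le {k' κ p R L G A B C I J V : ℕ} (hk : 2 ≤ k')
    (hR : R = 10 + k' * (1 + κ)) (hL : 0 < L) (hG : G = (p + 1) * (k' + 3) * R * L)
    (hI : I = 1024 * (R * L)) (hJ : J = 512 * ((p + 1) * (k' + 3) * L)) (hA : A ≤ 127)
    (hB : B ≤ 255 * (p + 1)) (hC : C ≤ 16 * R) (hV : V = (J + 1) * (29 * R)) :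
    8 * V + 2 * (B * I + C * J + A * J) + (p * A * I + A * J + κ * A * J) * k' ≤
      380000 * G := by
  have hR10 : 10 ≤ R := by omega
  have hRJ : R * J = 512 * G := by rw [hJ, hG]; ring
  have hRG : R ≤ G := by
    rw [hG]
    calc R = 1 * 1 * R * 1 := by ring
      _ ≤ _ := by gcongr <;> omega
  have h1 : 8 * V ≤ 119016 * G := by
    calc 8 * V = 232 * (R * J) + 232 * R := by rw [hV]; ring
      _ ≤ 119016 * G := by rw [hRJ]; omega
  have h2 : 2 * (B * I) + p * A * I * k' ≤ 156468 * G := by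
    calc 2 * (B * I) + p * A * I * k' ≤
        2 * (255 * (p + 1) * I) + (p + 1) * 127 * I * k' := by gcongr; omega
      _ = (p + 1) * R * L * (522240 + 130048 * k') := by rw [hI]; ring
      _ ≤ (p + 1) * R * L * (156468 * (k' + 3)) := by gcongr; omega
      _ = _ := by rw [hG]; ring
  have h3 : 2 * (C * J) ≤ 16384 * G := by
    calc 2 * (C * J) ≤ 2 * (16 * R * J) := by gcongr
      _ = 32 * (R * J) := by ring
      _ = _ := by rw [hRJ]; ring
  have h4 : 2 * (A * J) + (A * J + κ * A * J) * k' ≤ 65024 * G := by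
    calc 2 * (A * J) + (A * J + κ * A * J) * k' = A * J * (2 + k' * (1 + κ)) := by ring
      _ ≤ 127 * J * R := by gcongr; omega
      _ = 127 * (R * J) := by ring
      _ = _ := by rw [hRJ]; ring
  calc _ = 8 * V + (2 * (B * I) + p * A * I * k') + 2 * (C * J) +
        (2 * (A * J) + (A * J + κ * A * J) * k') := by ring
    _ ≤ _ := by omega

/-- The parameter choice making the interpolation determinant estimate contradictory. -/
lemma power_exponent_lt {k κ p R ℓ L T G A B C I J V : ℕ} (hk : 3 ≤ k)
    (hR : R = 10 + (k - 1) * (1 + κ)) (hℓ : 0 < ℓ) (hL : L = 4 * k * ℓ)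
    (hG : G = (p + 1) * (k + 2) * R * L) (hT : T = 262144 * G)
    (hI : I = 1024 * (R * L)) (hJ : J = 512 * ((p + 1) * (k + 2) * L)) (hA : A ≤ 127)
    (hB : B ≤ 255 * (p + 1)) (hC : C ≤ 16 * R) (hV : V = (J + 1) * (29 * R)) :
    (2 * ℓ * (T * L) + ∑ j : Fin T × Fin L, (2 * ℓ * (j.1 : ℕ) + 8 * V * (j.2 : ℕ) + 3)) +
      (B * I + C * J + A * J) * (L - 1) * (T * L) +
      (2 * ℓ * (T * L) + ∑ j : Fin T × Fin L, (2 * ℓ * (j.1 : ℕ) +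
        (p * A * I + A * J) * (j.2 : ℕ) + κ * A * J * (L - 1 - (j.2 : ℕ)))) * (k - 1) <
    3 * ∑ q ∈ range (T * L), q := by
  have hL1 : 0 < L := by rw [hL]; positivity
  have hG1 : 0 < G := by rw [hG, hR]; positivity
  have e₁ := sum_fst_fin_prod T L
  have e₂ := sum_snd_fin_prod T L
  have e₃ := sum_sub_snd_fin_prod T L
  have e₄ := Finset.sum_range_id_mul_two (T * L)
  have hc : Fintype.card (Fin T × Fin L) = T * L := by simp
  simp only [Finset.sum_add_distrib, ← Finset.mul_sum, Finset.sum_const, Finset.card_univ, hc,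
    smul_eq_mul]
  generalize ∑ j : Fin T × Fin L, (j.1 : ℕ) = X at *
  generalize ∑ j : Fin T × Fin L, (j.2 : ℕ) = Y at *
  generalize ∑ j : Fin T × Fin L, (L - 1 - (j.2 : ℕ)) = W at *
  generalize ∑ q ∈ range (T * L), q = P at *
  clear hc
  obtain ⟨k', rfl⟩ : ∃ k', k = k' + 1 := ⟨k - 1, by omega⟩
  have hQ := power_height_le (k' := k') (by omega) hR hL1 hG hI hJ hA hB hC hV
  obtain ⟨M, rfl⟩ : ∃ M, L = M + 1 := ⟨L - 1, by omega⟩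
  obtain ⟨t, ht⟩ : ∃ t, T = t + 1 := ⟨T - 1, by omega⟩
  obtain ⟨h, hh⟩ : ∃ h, T * (M + 1) = h + 1 :=
    ⟨T * (M + 1) - 1, by have : 0 < T * (M + 1) := Nat.mul_pos (by omega) (by omega)
                         omega⟩
  rw [show T - 1 = t by omega] at e₁
  simp only [Nat.add_sub_cancel] at *
  rw [hh] at e₁ e₂ e₃ e₄ ⊢
  simp only [Nat.add_sub_cancel] at e₂ e₃ e₄ ⊢
  have key : 4 * ((k' + 1) * ℓ) + 2 * ((k' + 1) * ℓ) * t +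
      (8 * V + 2 * (B * I + C * J + A * J) + (p * A * I + A * J + κ * A * J) * k') * M + 6 <
      3 * h := by
    have g₁ : 4 * ((k' + 1) * ℓ) = M + 1 := by rw [hL]; ring
    generalize 8 * V + 2 * (B * I + C * J + A * J) + (p * A * I + A * J + κ * A * J) * k' = Q at *
    have g₂ : Q * M ≤ 380000 * G * M := by gcongr
    have g₃ : 2 * (4 * ((k' + 1) * ℓ) + 2 * ((k' + 1) * ℓ) * t + Q * M + 6) =
        2 * (M + 1) + (M + 1) * t + 2 * (Q * M) + 12 := by
      rw [← g₁]; ring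
    have g₄ : (M + 1) * t + (M + 1) = h + 1 := by rw [← hh, ht]; ring
    have g₅ : h + 1 = 262144 * (G * M) + 262144 * G := by rw [← hh, hT]; ring
    have g₆ : M ≤ G * M := Nat.le_mul_of_pos_left _ hG1
    have g₇ : 380000 * G * M = 380000 * (G * M) := by ring
    omega
  clear hR hT hL hL1 hG hI hJ hA hB hC hV hQ
  zify at *
  refine lt_of_mul_lt_mul_left (a := (2 : ℤ)) ?_ (by norm_num)
  linear_combination (h + 1 : ℤ) * key + 2 * ℓ * (k' + 1) * e₁ +
    (8 * V + (p * A * I + A * J) * k') * e₂ + κ * A * J * k' * e₃ - 3 * e₄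
end TwoLogarithms

section TwoLogarithms

set_option maxHeartbeats 1000000 in
/-- If the linear form in the logarithms of `a`, `α` and `g` is small, then its coefficients
satisfy no linear relation of small height. -/
theorem not_small_relation {k κ p R ℓ L N x a : ℕ} (hk : 3 ≤ k) {α g δ lam : ℝ}
    (hα : 1 < α) (hα2 : α < 2) (hroot : α ^ k = ∑ i ∈ range k, α ^ i)
    (ha : 2 ≤ a) (hp : 0 < p) (hap : a ≤ 2 ^ p) (hκ : 3 * k + 1 ≤ 2 ^ κ)
    (hδ : δ = (k + 1) * α - 2 * k) (hδ0 : 0 < δ) (hδ2 : δ ≤ 2) (hgδ : g * δ = α - 1) (hg : 0 < g)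
    (hglog : |Real.log g| ≤ Real.log 2)
    (hlam : x * Real.log a - N * Real.log α - Real.log g = lam) (hlam_le : |lam| ≤ 4 / 2 ^ x)
    (hR : R = 10 + (k - 1) * (1 + κ)) (hℓ : 0 < ℓ) (hL : L = 4 * k * ℓ) (hL192 : 192 ≤ L)
    (hxℓ : x ≤ 2 ^ ℓ) (hxN : x ≤ N) (hNx : N ≤ 2 * x * (p + 1))
    (hx₁ : 8192 * ((k + 7) * p * R * L ^ 3) ≤ x)
    {A : ℕ} {B : ℤ} (hA0 : 0 < A) (hA : A < 128) (hAB : (x * B - N * A).natAbs < 16 * R) :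
    False := by
  have hR0 : 10 ≤ R := by omega
  have hα0 : 0 < α := by linarith
  have hlα : 0 < Real.log α := Real.log_pos hα
  have hlα2 : Real.log α ≤ Real.log 2 := Real.log_le_log hα0 hα2.le
  have hl2 : 0 < Real.log 2 := Real.log_pos one_lt_two
  obtain ⟨I, hI⟩ : ∃ I, I = 1024 * (R * L) := ⟨_, rfl⟩
  obtain ⟨J, hJ⟩ : ∃ J, J = 512 * ((p + 1) * (k + 2) * L) := ⟨_, rfl⟩
  obtain ⟨G, hG⟩ : ∃ G, G = (p + 1) * (k + 2) * R * L := ⟨_, rfl⟩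
  obtain ⟨T, hT⟩ : ∃ T, T = 262144 * G := ⟨_, rfl⟩
  have hL0 : 0 < L := by omega
  have hG0 : 0 < G := by rw [hG]; positivity
  have hℓL : 12 * ℓ ≤ L := by rw [hL]; gcongr; omega
  have hLG : L ≤ G := by
    rw [hG]
    calc L = 1 * 1 * 1 * L := by ring
      _ ≤ _ := by gcongr <;> omega
  have hRL : R * L ≤ G := by
    rw [hG]
    calc R * L = 1 * 1 * R * L := by ring
      _ ≤ _ := by gcongr <;> omega
  have hJG : J * 10 ≤ 512 * G := by
    rw [hJ, hG]
    calc 512 * ((p + 1) * (k + 2) * L) * 10 ≤ 512 * ((p + 1) * (k + 2) * L) * R := by gcongr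
      _ = _ := by ring
  have hxG : 786432 * (G * L) + 1000 * L ≤ x := by
    refine le_trans ?_ hx₁
    have h1 : 192 * L ^ 2 ≤ L ^ 3 := by rw [pow_succ' L 2]; gcongr
    have h2 : L ≤ p * R * L ^ 2 := by
      calc L = 1 * 1 * L ^ 1 := by ring
        _ ≤ _ := by gcongr <;> omega
    calc 786432 * (G * L) + 1000 * L
        ≤ 786432 * (G * L) + 1000 * (p * R * L ^ 2) := by gcongr
      _ = (786432 * ((p + 1) * (k + 2)) + 1000 * p) * (R * L ^ 2) := by rw [hG]; ring
      _ ≤ (1572864 * ((k + 7) * p)) * (R * L ^ 2) := by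
          gcongr
          nlinarith
      _ = 8192 * ((k + 7) * p * R * (192 * L ^ 2)) := by ring
      _ ≤ _ := by gcongr
  have hGL : 192 * G ≤ G * L := by rw [mul_comm]; gcongr
  have hIx : 16 * I ≤ x := by omega
  have hJx : 16 * J ≤ x := by omega
  have hx0 : 0 < x := by omega
  have hRx : 16 * R ≤ x := by
    have : R ≤ R * L := Nat.le_mul_of_pos_right _ hL0
    omega
  have hAB' : |(x : ℤ) * B - N * A| < 16 * R := by rw [Int.abs_eq_natAbs]; exact_mod_cast hAB
  obtain ⟨hAB1, hAB2⟩ := abs_lt.1 hAB'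
  have hxA : (x : ℤ) ≤ N * A := by
    calc (x : ℤ) ≤ N * 1 := by exact_mod_cast (by omega : x ≤ N * 1)
      _ ≤ N * A := by gcongr; exact_mod_cast hA0
  have hRxZ : 16 * (R : ℤ) ≤ x := by exact_mod_cast hRx
  have hxZ : (0 : ℤ) < x := by exact_mod_cast hx0
  have hB0 : 0 < B := pos_of_mul_pos_right (by omega : 0 < (x : ℤ) * B) hxZ.le
  lift B to ℕ using hB0.le
  have hNA : N * A ≤ 2 * x * (p + 1) * 127 := by gcongr; omega
  have hBp : B ≤ 255 * (p + 1) := by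
    have h1 : x * B ≤ x * (254 * (p + 1) + 1) := by
      have : x * B < N * A + 16 * R := by zify; linarith
      have e : x * (254 * (p + 1) + 1) = 2 * x * (p + 1) * 127 + x := by ring
      omega
    have := Nat.le_of_mul_le_mul_left h1 hx0
    omega
  obtain ⟨C₁, hC₁⟩ : ∃ C₁, C₁ = ((x : ℤ) * B - N * A).toNat := ⟨_, rfl⟩
  obtain ⟨C₂, hC₂⟩ : ∃ C₂, C₂ = (-((x : ℤ) * B - N * A)).toNat := ⟨_, rfl⟩
  have hC : (C₁ : ℝ) - C₂ = x * B - N * A := by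
    have : (C₁ : ℤ) - C₂ = x * B - N * A := by rw [hC₁, hC₂]; exact Int.toNat_sub_toNat_neg _
    exact_mod_cast this
  have hC₁R : C₁ ≤ 16 * R := by omega
  have hC₂R : C₂ ≤ 16 * R := by omega
  have ha0 : (0 : ℝ) < a := by positivity
  obtain ⟨γ, hγ⟩ : ∃ γ : ℝ, γ = a ^ A / α ^ B := ⟨_, rfl⟩
  obtain ⟨ε, hε⟩ : ∃ ε : ℝ, ε = g ^ A * α ^ C₂ / α ^ C₁ := ⟨_, rfl⟩
  have hγ0 : 0 < γ := by rw [hγ]; positivity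
  have hε0 : 0 < ε := by rw [hε]; positivity
  have hγα : γ * α ^ B = a ^ A := by rw [hγ]; field_simp
  have hεα : ε * α ^ C₁ = g ^ A * α ^ C₂ := by rw [hε]; field_simp
  have hγ1 : γ ≠ 1 := fun h => by
    rw [h, one_mul] at hγα
    exact pow_ne_natCast_pow (by omega) hroot ha A B hA0 hγα
  have hlγ : Real.log γ = A * Real.log a - B * Real.log α := by
    rw [hγ, Real.log_div (by positivity) (by positivity), Real.log_pow, Real.log_pow]
  have hlε : Real.log ε = A * Real.log g - (x * B - N * A) * Real.log α := by
    rw [hε, Real.log_div (by positivity) (by positivity),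
      Real.log_mul (by positivity) (by positivity), Real.log_pow, Real.log_pow, Real.log_pow, ← hC]
    ring
  have hmu : x * Real.log γ - Real.log ε = A * lam := by rw [hlγ, hlε, ← hlam]; ring
  have hAr : (A : ℝ) ≤ 127 := by exact_mod_cast (by omega : A ≤ 127)
  have hmu_le : |A * lam| ≤ 2 ^ 9 / 2 ^ x := by
    rw [abs_mul, Nat.abs_cast]
    calc (A : ℝ) * |lam| ≤ 127 * (4 / 2 ^ x) := by gcongr
      _ = 508 / 2 ^ x := by ring
      _ ≤ 2 ^ 9 / 2 ^ x := by gcongr; norm_num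
  have hmu_log : |A * lam| ≤ Real.log 2 := by
    refine hmu_le.trans ?_
    have h1 : (2 : ℝ) ^ 10 ≤ 2 ^ x := pow_le_pow_right₀ one_le_two (by omega)
    have h2 := Real.log_two_gt_d9
    calc (2 : ℝ) ^ 9 / 2 ^ x ≤ 2 ^ 9 / 2 ^ 10 := by gcongr
      _ ≤ Real.log 2 := by norm_num; linarith
  have hlε_le : |Real.log ε| ≤ (127 + 16 * R) * Real.log 2 := by
    have h1 : |(x * B - N * A : ℝ)| ≤ 16 * R := by exact_mod_cast hAB'.le
    rw [hlε]
    calc |A * Real.log g - (x * B - N * A) * Real.log α|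
        ≤ |A * Real.log g| + |(x * B - N * A) * Real.log α| := abs_sub _ _
      _ = A * |Real.log g| + |(x * B - N * A : ℝ)| * Real.log α := by
          rw [abs_mul, abs_mul, Nat.abs_cast, abs_of_pos hlα]
      _ ≤ 127 * Real.log 2 + 16 * R * Real.log 2 := by gcongr
      _ = _ := by ring
  have hV : I * |Real.log γ| + J * |Real.log ε| ≤
      (((J + 1) * (29 * R) : ℕ) : ℝ) * Real.log 2 := by
    have h1 : x * |Real.log γ| ≤ |Real.log ε| + |A * lam| := by
      calc x * |Real.log γ| = |Real.log ε + A * lam| := by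
            rw [← hmu, add_sub_cancel, abs_mul, Nat.abs_cast]
        _ ≤ _ := abs_add_le _ _
    have h2 : (I : ℝ) * |Real.log γ| ≤ x * |Real.log γ| := by
      gcongr
      omega
    have h3 : (10 : ℝ) ≤ R := by exact_mod_cast hR0
    calc I * |Real.log γ| + J * |Real.log ε|
        ≤ (J + 1) * |Real.log ε| + |A * lam| := by linarith
      _ ≤ (J + 1) * ((127 + 16 * R) * Real.log 2) + (J + 1) * Real.log 2 := by
          gcongr
          have : (0 : ℝ) ≤ J * Real.log 2 := by positivity
          linarith
      _ = (J + 1) * (128 + 16 * R) * Real.log 2 := by ring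
      _ ≤ (J + 1) * (29 * R) * Real.log 2 := by gcongr; linarith
      _ = _ := by push_cast; ring
  have hpow : x * x ≤ 2 ^ (2 * ℓ) := by
    calc x * x ≤ 2 ^ ℓ * 2 ^ ℓ := Nat.mul_le_mul hxℓ hxℓ
      _ = _ := by ring
  have hTL : 3 * (T * L) = 786432 * (G * L) := by rw [hT]; ring
  have hT0 : 0 < T := by omega
  obtain ⟨s, hs, hdet⟩ := exists_power_det_ne_zero hγ0 hγ1 hε0.ne' (x := x) (I := I) (J := J)
    (L := L) (T := T) (by omega) (by
      have h1 : I - L = (1024 * R - 1) * L := by rw [hI, Nat.sub_mul]; ring_nf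
      calc L * (T - 1) < L * T := Nat.mul_lt_mul_of_pos_left (by omega) hL0
        _ = (512 * R) * L * J := by rw [hT, hG, hJ]; ring
        _ ≤ (I - L) * J := by
            rw [h1]
            gcongr
            omega)
  have hlt := power_exponent_lt (k := k) (κ := κ) (p := p) (R := R) (ℓ := ℓ) (L := L) (T := T)
    (A := A) hk hR hℓ hL hG hT hI hJ (by omega) hBp hC₁R rfl
  refine hlt.not_ge (exponent_le_of_power_det_ne_zero (by omega) hα hα2 hroot ha hap hκ hδ hδ0 hδ2
    hgδ hγ0 hε0 hγ1 hγα hεα hmu hL0 hT0 hV ?_ ?_ s hs ?_ hdet)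
  · have hLℓ : L ≤ 2 ^ ℓ := by omega
    have hJℓ : J ≤ 2 ^ ℓ := by omega
    have h1 : (L : ℝ) * J ≤ 2 ^ ℓ * 2 ^ ℓ := by exact_mod_cast Nat.mul_le_mul hLℓ hJℓ
    calc (L : ℝ) * J * |A * lam| * 8 ^ (T * L)
        ≤ 2 ^ ℓ * 2 ^ ℓ * (2 ^ 9 / 2 ^ x) * 8 ^ (T * L) := by gcongr
      _ = 2 ^ (3 * (T * L) + 2 * ℓ + 9) / 2 ^ x := by
          rw [pow_add (2 : ℝ), pow_add (2 : ℝ), pow_mul (2 : ℝ) 3, two_mul ℓ, pow_add (2 : ℝ)]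
          norm_num
          ring
      _ ≤ 1 := by
          rw [div_le_one (by positivity)]
          exact pow_le_pow_right₀ one_le_two (by omega)
  · have : x ≤ x * x := Nat.le_mul_of_pos_left _ hx0
    omega
  · have h1 : x ≤ x * x := Nat.le_mul_of_pos_left _ hx0
    have h2 : x * (16 * J) ≤ x * x := by gcongr
    have h3 : x * (16 * J) = 16 * (x * J) := by ring
    omega

end TwoLogarithms

section Binet

lemma exists_dominant_root {k : ℕ} (hk : 3 ≤ k) :
    ∃ α : ℝ, 9 / 5 < α ∧ α < 2 ∧ α ^ k = ∑ i ∈ range k, α ^ i := by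
  have hc : ContinuousOn (fun t : ℝ => t ^ k * (2 - t)) (Set.Icc (9 / 5) 2) := by fun_prop
  have h1 : (1 : ℝ) < (9 / 5) ^ k * (2 - 9 / 5) := by
    have : (9 / 5 : ℝ) ^ 3 ≤ (9 / 5) ^ k := pow_le_pow_right₀ (by norm_num) hk
    norm_num at this ⊢
    linarith
  obtain ⟨α, ⟨hα1, hα2⟩, hα⟩ := intermediate_value_Ioo' (by norm_num) hc
    (show (1 : ℝ) ∈ Set.Ioo _ _ from ⟨by norm_num, h1⟩)
  refine ⟨α, hα1, hα2, ?_⟩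
  have h2 := mul_geom_sum α k
  dsimp only at hα
  refine mul_left_cancel₀ (sub_ne_zero.2 (by linarith : α ≠ 1)) ?_
  rw [h2]
  linear_combination -hα

lemma natCast_mul_two_sub_le_one {k : ℕ} (hk : 3 ≤ k) {α : ℝ} (hα : 9 / 5 < α)
    (hroot : α ^ k = ∑ i ∈ range k, α ^ i) : k * (2 - α) ≤ 1 := by
  have h1 := pow_mul_two_sub_eq_one hroot
  have h2 : ∀ n : ℕ, 3 ≤ n → (n : ℝ) ≤ (9 / 5) ^ n := by
    intro n hn
    induction n, hn using Nat.le_induction with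
    | base => norm_num
    | succ n hn ih =>
      have : (3 : ℝ) ≤ n := by exact_mod_cast hn
      rw [pow_succ]
      push_cast
      linarith
  have h3 : (9 / 5 : ℝ) ^ k ≤ α ^ k := by gcongr
  have h4 : 0 < 2 - α := pos_of_mul_pos_right (by rw [h1]; exact one_pos) (by positivity)
  rw [← h1]
  gcongr
  exact (h2 k hk).trans h3

lemma sum_inv_pow_succ_eq_one {k : ℕ} {α : ℝ} (hα : α ≠ 0)
    (hroot : α ^ k = ∑ i ∈ range k, α ^ i) : ∑ t ∈ range k, (α⁻¹) ^ (t + 1) = 1 := by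
  have h1 : ∑ t ∈ range k, α ^ k * (α⁻¹) ^ (t + 1) = ∑ t ∈ range k, α ^ (k - 1 - t) := by
    refine Finset.sum_congr rfl fun t ht => ?_
    have : k = (k - 1 - t) + (t + 1) := by have := mem_range.1 ht; omega
    rw [inv_pow, ← div_eq_mul_inv, div_eq_iff (by positivity), ← pow_add, ← this]
  rw [Finset.sum_range_reflect (fun j => α ^ j), ← Finset.mul_sum, ← hroot] at h1
  exact mul_left_cancel₀ (pow_ne_zero k hα) (by rw [h1, mul_one])

lemma sum_eq_zero_of_recurrence {k : ℕ} {α : ℝ} (hα : α ≠ 0)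
    (hroot : α ^ k = ∑ i ∈ range k, α ^ i) {D : ℕ → ℝ}
    (hD : ∀ i, D (i + k) = ∑ j ∈ range k, D (i + j))
    (h0 : ∑ j ∈ range k, (∑ t ∈ range (j + 1), (α⁻¹) ^ (t + 1)) * D j = 0) (i : ℕ) :
    ∑ j ∈ range k, (∑ t ∈ range (j + 1), (α⁻¹) ^ (t + 1)) * D (i + j) = 0 := by
  obtain ⟨w, hw⟩ : ∃ w : ℕ → ℝ, ∀ j, w j = ∑ t ∈ range j, (α⁻¹) ^ (t + 1) := ⟨_, fun _ => rfl⟩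
  simp only [← hw] at h0 ⊢
  have hw0 : w 0 = 0 := by simp [hw]
  have hws : ∀ j, w (j + 1) = α⁻¹ * (w j + 1) := by
    intro j
    rw [hw, hw, Finset.sum_range_succ', mul_add, Finset.mul_sum]
    simp [pow_succ, mul_comm]
  have hwk : w k = 1 := by rw [hw, sum_inv_pow_succ_eq_one hα hroot]
  induction i with
  | zero => simpa using h0
  | succ i ih =>
    have key : ∑ j ∈ range k, w (j + 1) * D (i + 1 + j) =
        α * ∑ j ∈ range k, w (j + 1) * D (i + j) := by
      have e1 : ∑ j ∈ range k, w (j + 1) * D (i + 1 + j) =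
          ∑ j ∈ range (k + 1), w j * D (i + j) := by
        rw [Finset.sum_range_succ', hw0, zero_mul, add_zero]
        refine Finset.sum_congr rfl fun j _ => ?_
        rw [add_right_comm, add_assoc]
      rw [e1, Finset.sum_range_succ, hwk, one_mul, hD, ← Finset.sum_add_distrib, Finset.mul_sum]
      refine Finset.sum_congr rfl fun j _ => ?_
      rw [hws]
      field_simp
    rw [key, ih, mul_zero]

lemma abs_le_one_of_recurrence {k : ℕ} {α : ℝ} (hα : 0 < α)
    (hroot : α ^ k = ∑ i ∈ range k, α ^ i) {D : ℕ → ℝ}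
    (hD : ∀ i, D (i + k) = ∑ j ∈ range k, D (i + j))
    (h0 : ∑ j ∈ range k, (∑ t ∈ range (j + 1), (α⁻¹) ^ (t + 1)) * D j = 0)
    (hini : ∀ i < k, |D i| ≤ 1) (i : ℕ) : |D i| ≤ 1 := by
  have hQ := sum_eq_zero_of_recurrence hα.ne' hroot hD h0
  induction i using Nat.strong_induction_on with
  | _ i ih =>
    rcases lt_or_ge i k with h | h
    · exact hini i h
    obtain ⟨i, rfl⟩ := Nat.exists_eq_add_of_le' h
    have e1 := sum_inv_pow_succ_eq_one hα.ne' hroot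
    have e2 : D (i + k) = ∑ j ∈ range k, (α⁻¹) ^ (j + 1) * D (i + j) := by
      have h1 := hQ (i + 1)
      have h2 := hQ i
      have h3 : ∑ j ∈ range k, (∑ t ∈ range (j + 1), (α⁻¹) ^ (t + 1)) * D (i + 1 + j) =
          ∑ j ∈ range (k + 1), (∑ t ∈ range j, (α⁻¹) ^ (t + 1)) * D (i + j) := by
        rw [Finset.sum_range_succ', range_zero, Finset.sum_empty, zero_mul, add_zero]
        refine Finset.sum_congr rfl fun j _ => ?_
        rw [add_right_comm, add_assoc]
      rw [h3, Finset.sum_range_succ, e1, one_mul] at h1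
      simp only [Finset.sum_range_succ _ (_ : ℕ), add_mul, Finset.sum_add_distrib] at h2
      linarith
    rw [e2]
    calc |∑ j ∈ range k, (α⁻¹) ^ (j + 1) * D (i + j)|
        ≤ ∑ j ∈ range k, |(α⁻¹) ^ (j + 1) * D (i + j)| := Finset.abs_sum_le_sum_abs _ _
      _ ≤ ∑ j ∈ range k, (α⁻¹) ^ (j + 1) := by
          refine Finset.sum_le_sum fun j hj => ?_
          rw [abs_mul, abs_of_pos (by positivity)]
          exact mul_le_of_le_one_right (by positivity)
            (ih _ (by have := mem_range.1 hj; omega))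
      _ = 1 := e1

/-- The dominant term of the Binet formula for the `k`-generalized Fibonacci sequence, with the
index shifted so that the initial zeros sit at `0, …, k - 2`. -/
lemma abs_sub_dominant_le_one {k : ℕ} (hk : 3 ≤ k) {α g δ : ℝ} (hα : 9 / 5 < α)
    (hroot : α ^ k = ∑ i ∈ range k, α ^ i) (hδ : δ = (k + 1) * α - 2 * k)
    (hgδ : g * δ = α - 1) (hg : 0 < g) (hg1 : g ≤ 1) {u : ℕ → ℝ} (hu0 : ∀ i < k - 1, u i = 0)
    (hu1 : u (k - 1) = 1) (hu : ∀ i, u (i + k) = ∑ j ∈ range k, u (i + j)) (i : ℕ) :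
    |u i - g / α ^ (k - 1) * α ^ i| ≤ 1 := by
  obtain ⟨n, rfl⟩ : ∃ n, k = n + 1 := ⟨k - 1, by omega⟩
  simp only [Nat.add_sub_cancel] at *
  have hα0 : 0 < α := by linarith
  refine abs_le_one_of_recurrence (D := fun i => u i - g / α ^ n * α ^ i) hα0 hroot ?_ ?_ ?_ i
  · intro i
    rw [Finset.sum_sub_distrib, hu, ← Finset.mul_sum]
    congr 2
    rw [pow_add, hroot, Finset.mul_sum]
    simp only [pow_add]
  · have hw : ∀ j, (α - 1) * ∑ t ∈ range (j + 1), (α⁻¹) ^ (t + 1) = 1 - (α⁻¹) ^ (j + 1) := by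
      intro j
      have := mul_geom_sum α⁻¹ (j + 1)
      have e : α * α⁻¹ = 1 := mul_inv_cancel₀ hα0.ne'
      have e2 : ∑ t ∈ range (j + 1), (α⁻¹) ^ (t + 1) =
          α⁻¹ * ∑ t ∈ range (j + 1), (α⁻¹) ^ t := by
        rw [Finset.mul_sum]
        exact Finset.sum_congr rfl fun _ _ => pow_succ' _ _
      rw [e2]
      linear_combination (∑ t ∈ range (j + 1), (α⁻¹) ^ t) * e - this
    have h1 := pow_mul_two_sub_eq_one hroot
    have hsum : ∑ j ∈ range (n + 1), (α - 1) * (∑ t ∈ range (j + 1), (α⁻¹) ^ (t + 1)) *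
        (u j - g / α ^ n * α ^ j) = 0 := by
      simp only [hw, mul_sub, Finset.sum_sub_distrib]
      have s1 : ∑ j ∈ range (n + 1), (1 - (α⁻¹) ^ (j + 1)) * u j = 1 - (α⁻¹) ^ (n + 1) := by
        rw [Finset.sum_range_succ, hu1, mul_one, Finset.sum_eq_zero, zero_add]
        intro j hj
        rw [hu0 j (mem_range.1 hj), mul_zero]
      have s2 : ∑ j ∈ range (n + 1), (1 - (α⁻¹) ^ (j + 1)) * (g / α ^ n * α ^ j) =
          g / α ^ n * (α ^ (n + 1) - (n + 1) * α⁻¹) := by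
        rw [hroot, mul_sub, Finset.mul_sum]
        have : ∀ j, (1 - (α⁻¹) ^ (j + 1)) * (g / α ^ n * α ^ j) =
            g / α ^ n * α ^ j - g / α ^ n * α⁻¹ := by
          intro j
          have : (α⁻¹) ^ j * α ^ j = 1 := by rw [← mul_pow, inv_mul_cancel₀ hα0.ne', one_pow]
          rw [pow_succ]
          linear_combination (-(α⁻¹ * g / α ^ n)) * this
        simp only [this, Finset.sum_sub_distrib, Finset.sum_const, Finset.card_range, nsmul_eq_mul]
        push_cast
        ring
      rw [s1, s2]
      push_cast at hδ
      rw [hδ] at hgδ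
      have hX : α ^ n ≠ 0 := by positivity
      rw [inv_pow, pow_succ] at *
      generalize α ^ n = X at *
      refine mul_left_cancel₀ (mul_ne_zero hX hα0.ne') ?_
      have e : X * α * (1 - (X * α)⁻¹ - g / X * (X * α - (n + 1) * α⁻¹)) =
          X * α - 1 - g * (X * α ^ 2 - (n + 1)) := by field_simp
      rw [e]
      linear_combination (-(X * α)) * hgδ + (1 - g * (n + 1)) * h1
    simp only [mul_assoc] at hsum
    rw [← Finset.mul_sum] at hsum
    exact (mul_eq_zero.1 hsum).resolve_left (by linarith)
  · intro i hi
    have h1 : g / α ^ n * α ^ i ≤ g := by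
      rw [div_mul_eq_mul_div, div_le_iff₀ (by positivity)]
      have : α ^ i ≤ α ^ n := pow_le_pow_right₀ (by linarith) (by omega)
      gcongr
    have h2 : 0 < g / α ^ n * α ^ i := by positivity
    rcases Nat.lt_succ_iff_lt_or_eq.1 hi with h | rfl
    · rw [hu0 i h, abs_le]; constructor <;> linarith
    · rw [hu1, abs_le]; constructor <;> linarith

end Binet

section KFib

variable {k : ℕ} {F : ℤ → ℤ}

lemma kFib_shift_recurrence
    (hFrec : ∀ i, 2 ≤ i → F i = ∑ j ∈ Finset.Icc (1 : ℤ) k, F (i - j)) (i : ℕ) :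
    F ((i + k : ℕ) + 2 - k) = ∑ j ∈ range k, F ((i + j : ℕ) + 2 - k) := by
  rw [show ((i + k : ℕ) : ℤ) + 2 - k = i + 2 by push_cast; ring, hFrec _ (by omega)]
  refine Finset.sum_nbij' (fun j => (k - j).toNat) (fun j => (k : ℤ) - j) ?_ ?_ ?_ ?_ ?_
  · intro j hj
    rw [Finset.mem_Icc] at hj
    rw [mem_range]
    omega
  · intro j hj
    rw [mem_range] at hj
    rw [Finset.mem_Icc]
    omega
  · intro j hj
    rw [Finset.mem_Icc] at hj
    omega
  · intro j hj
    rw [mem_range] at hj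
    omega
  · intro j hj
    rw [Finset.mem_Icc] at hj
    congr 1
    push_cast
    rw [Int.toNat_of_nonneg (by omega)]
    ring

/-- Elementary growth properties of the `k`-generalized Fibonacci sequence. -/
lemma kFib_growth (hk : 3 ≤ k) (hF0 : ∀ i, 2 - (k : ℤ) ≤ i → i ≤ 0 → F i = 0) (hF1 : F 1 = 1)
    (hFrec : ∀ i, 2 ≤ i → F i = ∑ j ∈ Finset.Icc (1 : ℤ) k, F (i - j)) :
    (∀ n : ℕ, 1 ≤ F (n + 1)) ∧ (∀ n : ℕ, F (n + 1) ≤ F (n + 2)) ∧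
      (∀ n : ℕ, F (n + 2) ≤ 2 ^ n) ∧ (∀ n : ℕ, 2 * F (n + 1) ≤ F (n + 3)) ∧ F 4 = 4 := by
  obtain ⟨u, hu⟩ : ∃ u : ℕ → ℤ, ∀ i, u i = F (i + 2 - k) := ⟨_, fun _ => rfl⟩
  have hrec : ∀ i, u (i + k) = ∑ j ∈ range k, u (i + j) := by
    intro i
    simp only [hu]
    exact kFib_shift_recurrence hFrec i
  obtain ⟨l, rfl⟩ : ∃ l, k = l + 2 := ⟨k - 2, by omega⟩
  have hF : ∀ n : ℕ, F n = u (n + l) := by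
    intro n
    rw [hu]
    congr 1
    push_cast
    ring
  have h0 : ∀ i ≤ l, u i = 0 := fun i hi => by
    rw [hu]
    exact hF0 _ (by push_cast; linarith) (by push_cast; omega)
  have h1 : u (l + 1) = 1 := by rw [add_comm, ← hF]; exact hF1
  have hnn : ∀ i, 0 ≤ u i := by
    intro i
    induction i using Nat.strong_induction_on with
    | _ i ih =>
      rcases lt_or_ge i (l + 2) with h | h
      · rcases Nat.lt_succ_iff_lt_or_eq.1 h with h | rfl
        · rw [h0 i (by omega)]
        · rw [h1]; norm_num
      · obtain ⟨i, rfl⟩ := Nat.exists_eq_add_of_le' h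
        rw [hrec]
        exact Finset.sum_nonneg fun j hj => ih _ (by have := mem_range.1 hj; omega)
  have htwo : ∀ i, u (i + l) + u (i + l + 1) ≤ u (i + l + 2) := by
    intro i
    rw [add_assoc i l 2, hrec, Finset.sum_range_succ, Finset.sum_range_succ]
    have : 0 ≤ ∑ j ∈ range l, u (i + j) := Finset.sum_nonneg fun _ _ => hnn _
    rw [← add_assoc]
    linarith
  have hdouble : ∀ i, u (i + l + 3) = 2 * u (i + l + 2) - u i := by
    intro i
    have e1 := hrec i
    have e2 := hrec (i + 1)
    rw [Finset.sum_range_succ' _ (l + 1)] at e1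
    rw [Finset.sum_range_succ _ (l + 1)] at e2
    have e3 : ∀ j, i + 1 + j = i + (j + 1) := fun j => by ring
    simp only [e3] at e2
    rw [show i + (l + 1 + 1) = i + l + 2 by ring, add_zero] at *
    rw [show i + (l + 2 + 1) = i + l + 3 by ring] at *
    linarith
  have hmono : ∀ n : ℕ, u (n + 1 + l) ≤ u (n + 2 + l) := by
    intro n
    have := htwo n
    have := hnn (n + l)
    rw [show n + 1 + l = n + l + 1 by ring, show n + 2 + l = n + l + 2 by ring]
    linarith
  have h2 : u (l + 2) = 1 := by
    have := hrec 0
    simp only [zero_add] at this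
    rw [this, Finset.sum_range_succ, h1, Finset.sum_eq_zero, zero_add]
    intro j hj
    exact h0 j (by have := mem_range.1 hj; omega)
  have hF' : ∀ n c : ℕ, F (n + c) = u (n + c + l) := fun n c => by
    rw [← hF]; push_cast; rfl
  have hF'1 : ∀ n : ℕ, F (n + 1) = u (n + 1 + l) := fun n => by exact_mod_cast hF' n 1
  have hF'2 : ∀ n : ℕ, F (n + 2) = u (n + 2 + l) := fun n => by exact_mod_cast hF' n 2
  have hF'3 : ∀ n : ℕ, F (n + 3) = u (n + 3 + l) := fun n => by exact_mod_cast hF' n 3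
  refine ⟨fun n => ?_, fun n => ?_, fun n => ?_, fun n => ?_, ?_⟩
  · rw [hF'1]
    induction n with
    | zero => rw [zero_add, add_comm, h1]
    | succ n ih => exact ih.trans (hmono n)
  · rw [hF'1, hF'2]
    exact hmono n
  · rw [hF'2]
    induction n with
    | zero => rw [zero_add, add_comm, h2, pow_zero]
    | succ n ih =>
      rw [show n + 1 + 2 + l = n + l + 3 by ring, hdouble, pow_succ]
      rw [show n + 2 + l = n + l + 2 by ring] at ih
      have := hnn n
      linarith
  · rw [hF'1, hF'3]
    have e1 := htwo (n + 1)
    have e2 := hmono n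
    rw [show n + 1 + l + 2 = n + 3 + l by ring, show n + 1 + l + 1 = n + 2 + l by ring] at e1
    linarith
  · rw [show (4 : ℤ) = ((4 : ℕ) : ℤ) by norm_num, hF]
    have e1 := hdouble 0
    have e2 := hdouble 1
    rw [h0 0 (by omega), zero_add, h2] at e1
    rw [h0 1 (by omega), show 1 + l + 3 = 4 + l by ring, show 1 + l + 2 = l + 3 by ring, e1] at e2
    rw [e2]
    norm_num

lemma kFib_abs_sub_le_one (hk : 3 ≤ k) (hF0 : ∀ i, 2 - (k : ℤ) ≤ i → i ≤ 0 → F i = 0)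
    (hF1 : F 1 = 1) (hFrec : ∀ i, 2 ≤ i → F i = ∑ j ∈ Finset.Icc (1 : ℤ) k, F (i - j))
    {α g δ : ℝ} (hα : 9 / 5 < α) (hroot : α ^ k = ∑ i ∈ range k, α ^ i)
    (hδ : δ = (k + 1) * α - 2 * k) (hgδ : g * δ = α - 1) (hg : 0 < g) (hg1 : g ≤ 1) (n : ℕ) :
    |(F (n + 1) : ℝ) - g * α ^ n| ≤ 1 := by
  have h := abs_sub_dominant_le_one hk hα hroot hδ hgδ hg hg1
    (u := fun i => (F ((i : ℤ) + 2 - k) : ℝ)) (fun i hi => by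
      rw [hF0 _ (by omega) (by omega), Int.cast_zero])
    (by
      rw [show ((k - 1 : ℕ) : ℤ) + 2 - k = 1 by omega, hF1, Int.cast_one])
    (fun i => by exact_mod_cast kFib_shift_recurrence hFrec i) (n + (k - 1))
  have e : ((n + (k - 1) : ℕ) : ℤ) + 2 - k = n + 1 := by omega
  have hα0 : 0 < α := by linarith
  rwa [e, pow_add, div_mul_eq_mul_div, mul_comm (α ^ n), ← mul_assoc, mul_right_comm,
    mul_div_assoc, div_self (by positivity), mul_one] at h

end KFib

section LinearForm

lemma Real.abs_log_le_two_mul {y : ℝ} (hy : |y - 1| ≤ 1 / 2) : |Real.log y| ≤ 2 * |y - 1| := by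
  obtain ⟨h1, h2⟩ := abs_le.1 hy
  have hy0 : 0 < y := by linarith
  have h3 := Real.log_le_sub_one_of_pos hy0
  have h4 := Real.one_sub_inv_le_log_of_pos hy0
  have h5 : 1 - y⁻¹ = (y - 1) * y⁻¹ := by field_simp
  have h6 : y⁻¹ ≤ 2 := by
    rw [inv_le_comm₀ hy0 two_pos]; linarith
  have h7 : |(y - 1) * y⁻¹| ≤ 2 * |y - 1| := by
    rw [abs_mul, abs_of_pos (inv_pos.2 hy0), mul_comm]
    gcongr
  rw [h5] at h4
  obtain ⟨h8, h9⟩ := abs_le.1 h7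
  rw [abs_le]
  exact ⟨by linarith, by linarith [le_abs_self (y - 1), abs_nonneg (y - 1)]⟩

lemma abs_linearForm_le {α g : ℝ} (hα : 0 < α) (hg : 0 < g) {a b : ℝ} (hb : 1 ≤ b)
    (hab : 2 * b ≤ a) {x N : ℕ} (hx : 2 ≤ x) (h : |a ^ x - b ^ x - g * α ^ N| ≤ 1) :
    |x * Real.log a - N * Real.log α - Real.log g| ≤ 4 / 2 ^ x := by
  have ha : 0 < a := by linarith
  have hbx : b ^ x ≤ a ^ x / 2 ^ x := by
    rw [← div_pow]
    gcongr
    linarith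
  have hb1 : 1 ≤ b ^ x := one_le_pow₀ hb
  have e : |g * α ^ N / a ^ x - 1| ≤ 2 / 2 ^ x := by
    have : g * α ^ N / a ^ x - 1 = -(a ^ x - g * α ^ N) / a ^ x := by field_simp; ring
    rw [this, abs_div, abs_neg, abs_of_pos (by positivity : 0 < a ^ x),
      div_le_iff₀ (by positivity)]
    calc |a ^ x - g * α ^ N| = |(a ^ x - b ^ x - g * α ^ N) + b ^ x| := by congr 1; ring
      _ ≤ |a ^ x - b ^ x - g * α ^ N| + |b ^ x| := abs_add_le _ _
      _ ≤ 2 * (a ^ x / 2 ^ x) := by rw [abs_of_pos (by positivity : 0 < b ^ x)]; linarith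
      _ = _ := by ring
  have e2 : (2 : ℝ) / 2 ^ x ≤ 1 / 2 := by
    rw [div_le_div_iff₀ (by positivity) (by positivity)]
    have : (2 : ℝ) ^ 2 ≤ 2 ^ x := pow_le_pow_right₀ one_le_two hx
    linarith
  have h1 := Real.abs_log_le_two_mul (e.trans e2)
  rw [Real.log_div (by positivity) (by positivity), Real.log_mul (by positivity) (by positivity),
    Real.log_pow, Real.log_pow] at h1
  rw [← abs_neg]
  calc |-(x * Real.log a - N * Real.log α - Real.log g)|
      = |Real.log g + N * Real.log α - x * Real.log a| := by congr 1; ring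
    _ ≤ 2 * (2 / 2 ^ x) := by linarith
    _ = _ := by ring

/-- If `k` is large compared with `log x`, the linear form cannot be small. -/
lemma two_pow_lt_of_abs_linearForm_le {k x m N : ℕ} (hk : 3 ≤ k) (hkx : k ≤ x) (hx : 1024 ≤ x)
    (hkm : k ≤ m) {α g δ a : ℝ} (hα : 9 / 5 < α) (hα2 : α < 2)
    (hroot : α ^ k = ∑ i ∈ range k, α ^ i) (hδ : δ = (k + 1) * α - 2 * k)
    (hgδ : g * δ = α - 1) (hg : 1 / 2 ≤ g) (ha : |a - g * α ^ m| ≤ 1)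
    (hlam : |x * Real.log a - N * Real.log α - Real.log g| ≤ 4 / 2 ^ x) : 2 ^ k < 16 * k * x := by
  by_contra! hcon
  have hk3 : (3 : ℝ) ≤ k := by exact_mod_cast hk
  have hx3 : (1024 : ℝ) ≤ x := by exact_mod_cast hx
  have hα0 : 0 < α := by linarith
  obtain ⟨η, hη⟩ : ∃ η, η = 2 - α := ⟨_, rfl⟩
  have hη0 : 0 < η := by linarith
  have hkη1 : k * η ≤ 1 := by rw [hη]; exact natCast_mul_two_sub_le_one hk hα hroot
  have hαη : α ^ k * η = 1 := by rw [hη]; exact pow_mul_two_sub_eq_one hroot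
  have hη2k : η * 2 ^ k ≤ 2 := by
    have h1 := one_add_mul_le_pow (a := -(η / 2)) (by linarith) k
    have h2 : α ^ k = 2 ^ k * (1 + -(η / 2)) ^ k := by
      rw [← mul_pow]; congr 1; rw [hη]; ring
    have h3 : (1 : ℝ) / 2 ≤ (1 + -(η / 2)) ^ k := by linarith
    have h4 : 2 ^ k * (1 / 2 : ℝ) ≤ α ^ k := by rw [h2]; gcongr
    have := mul_le_mul_of_nonneg_right h4 hη0.le
    linarith
  have hη2k' : 1 ≤ η * 2 ^ k := by
    rw [← hαη, mul_comm]
    gcongr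
  have hkxη : k * x * η ≤ 1 / 8 := by
    have h1 : (16 * k * x : ℝ) ≤ 2 ^ k := by exact_mod_cast hcon
    have := mul_le_mul_of_nonneg_left h1 hη0.le
    linarith
  have hxη : 3 * (x * η) ≤ 1 / 8 := by
    refine le_trans ?_ hkxη
    rw [mul_assoc]
    gcongr
  have hkη : k * η ≤ 1 / 8192 := by
    have : k * η * 1024 ≤ k * η * x := by gcongr
    linarith
  have hδη : δ = 2 - (k + 1) * η := by rw [hδ, hη]; ring
  have hδ1 : 1 ≤ δ := by
    rw [hδη]
    have : η ≤ k * η := le_mul_of_one_le_left hη0.le (by linarith)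
    linarith
  have hg0 : 0 < g := by linarith
  obtain ⟨d, hd⟩ : ∃ d, d = Real.log (2 * g) := ⟨_, rfl⟩
  have hd1 : d ≤ (k - 1) * η := by
    have h1 := Real.log_le_sub_one_of_pos (by positivity : 0 < 2 * g)
    have h2 : (2 * g - 1) * δ = (k - 1) * η := by
      rw [sub_mul, mul_assoc, hgδ, hδη, hη]; ring
    have h3 : (2 * g - 1) * 1 ≤ (2 * g - 1) * δ := by gcongr; linarith
    rw [hd]
    linarith
  have hd2 : (k - 1) * η / 2 ≤ d := by
    have h1 := Real.one_sub_inv_le_log_of_pos (by positivity : 0 < 2 * g)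
    have h2 : (k - 1) * η / 2 * (2 * (1 - η)) ≤ (1 - (2 * g)⁻¹) * (2 * (1 - η)) := by
      have e : (1 - (2 * g)⁻¹) * (2 * (1 - η)) = (k - 1) * η := by
        have : 1 - η = g * δ := by rw [hgδ, hη]; ring
        have e3 : (2 * g)⁻¹ * (2 * (g * δ)) = δ := by field_simp
        rw [sub_mul, this, e3, hgδ, hδη, hη]
        ring
      rw [e]
      have : 0 ≤ (k - 1) * η * η := by
        have : (0 : ℝ) ≤ k - 1 := by linarith
        positivity
      linarith
    have h3 := le_of_mul_le_mul_right h2 (by linarith)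
    rw [hd]
    linarith
  obtain ⟨c, hc⟩ : ∃ c, c = Real.log 2 - Real.log α := ⟨_, rfl⟩
  have hc0 : 0 ≤ c := by
    rw [hc, sub_nonneg]
    exact Real.log_le_log hα0 hα2.le
  have hc1 : c ≤ η := by
    rw [hc, ← Real.log_div (by norm_num) hα0.ne']
    have h1 := Real.log_le_sub_one_of_pos (by positivity : 0 < 2 / α)
    have h2 : 2 / α - 1 = η / α := by rw [hη]; field_simp
    have h3 : η / α ≤ η := div_le_self hη0.le (by linarith)
    linarith
  obtain ⟨e, he⟩ : ∃ e, e = Real.log (a / (g * α ^ m)) := ⟨_, rfl⟩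
  have hαm : α ^ k ≤ α ^ m := pow_le_pow_right₀ (by linarith) hkm
  have hdiff : |a / (g * α ^ m) - 1| ≤ 2 * η := by
    have : a / (g * α ^ m) - 1 = (a - g * α ^ m) / (g * α ^ m) := by field_simp
    rw [this, abs_div, abs_of_pos (by positivity : 0 < g * α ^ m), div_le_iff₀ (by positivity)]
    refine ha.trans ?_
    rw [← hαη]
    have : 1 / 2 * α ^ k ≤ g * α ^ m := by gcongr
    have := mul_le_mul_of_nonneg_right this hη0.le
    linarith
  have hη_small : η ≤ 1 / 8192 := by
    have : η ≤ k * η := le_mul_of_one_le_left hη0.le (by linarith)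
    linarith
  have he1 : |e| ≤ 4 * η := by
    rw [he]
    have := Real.abs_log_le_two_mul (hdiff.trans (by linarith))
    linarith
  have ha0 : a ≠ 0 := by
    rintro rfl
    rw [zero_div, zero_sub, abs_neg, abs_one] at hdiff
    linarith
  have hla : Real.log a = Real.log g + m * Real.log α + e := by
    rw [he, Real.log_div ha0 (by positivity), Real.log_mul (by positivity) (by positivity),
      Real.log_pow]
    ring
  have hlg : Real.log g = d - Real.log 2 := by
    rw [hd, Real.log_mul two_ne_zero hg0.ne']; ring
  obtain ⟨lam, hlam'⟩ : ∃ lam, lam = x * Real.log a - N * Real.log α - Real.log g := ⟨_, rfl⟩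
  rw [← hlam'] at hlam
  obtain ⟨Z, hZ⟩ : ∃ Z : ℤ, Z = x - 1 - (m * x - N) := ⟨_, rfl⟩
  have hZeq : Z * Real.log α = (x - 1) * (d - c) + x * e - lam := by
    rw [hlam', hZ, hla, hlg, hc]
    push_cast
    ring
  have hlamη : |lam| ≤ x * η := by
    refine hlam.trans ?_
    rw [div_le_iff₀ (by positivity)]
    have h1 : (2 : ℝ) ^ k ≤ 2 ^ x := pow_le_pow_right₀ one_le_two hkx
    have h2 : 1 ≤ η * 2 ^ x := hη2k'.trans (by gcongr)
    have := mul_le_mul_of_nonneg_left h2 (by linarith : (0 : ℝ) ≤ x)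
    linarith
  have hxe : |x * e| ≤ 4 * (x * η) := by
    rw [abs_mul, Nat.abs_cast]
    have := mul_le_mul_of_nonneg_left he1 (by linarith : (0 : ℝ) ≤ x)
    linarith
  obtain ⟨l1, l2⟩ := abs_le.1 hlamη
  obtain ⟨x1, x2⟩ := abs_le.1 hxe
  have hlower : (x - 1) * ((k - 3) * η / 2) ≤ (x - 1) * (d - c) := by
    have : (0 : ℝ) ≤ x - 1 := by linarith
    gcongr
    linarith
  have hupper : (x - 1) * (d - c) ≤ 1 / 8 := by
    calc (x - 1) * (d - c) ≤ (x - 1) * (k * η) := by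
          have : (0 : ℝ) ≤ x - 1 := by linarith
          gcongr
          linarith
      _ ≤ x * (k * η) := by gcongr; linarith
      _ ≤ 1 / 8 := by linarith
  have hlower0 : 0 ≤ (x - 1) * ((k - 3) * η / 2) := by
    have h1 : (0 : ℝ) ≤ x - 1 := by linarith
    have h2 : (0 : ℝ) ≤ k - 3 := by linarith
    positivity
  have hlα : 1 / 2 < Real.log α := by
    have h1 := Real.one_sub_inv_le_log_of_pos (by positivity : 0 < α / 2)
    rw [Real.log_div hα0.ne' two_ne_zero] at h1
    have h2 : (α / 2)⁻¹ ≤ 10 / 9 := by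
      rw [inv_le_comm₀ (by positivity) (by positivity)]; linarith
    have := Real.log_two_gt_d9
    linarith
  have hZabs : |(Z : ℝ)| < 1 := by
    have h1 : |(Z : ℝ) * Real.log α| < 1 / 2 := by
      rw [hZeq, abs_lt]
      constructor <;> linarith
    rw [abs_mul, abs_of_pos (by linarith : 0 < Real.log α)] at h1
    by_contra! h2
    have := mul_le_mul h2 hlα.le (by norm_num) (abs_nonneg _)
    linarith
  have hZ0 : Z = 0 := Int.abs_lt_one_iff.1 (by exact_mod_cast hZabs)
  rw [hZ0, Int.cast_zero, zero_mul] at hZeq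
  have hk14 : 14 ≤ k := by
    by_contra! h
    have h1 : 2 ^ k ≤ 2 ^ 13 := Nat.pow_le_pow_right (by norm_num) (by omega)
    have h2 : 16 * 3 * 1024 ≤ 16 * k * x := by gcongr
    omega
  have hk14' : (14 : ℝ) ≤ k := by exact_mod_cast hk14
  have h1 : (x - 1) * (11 * η / 2) ≤ (x - 1) * ((k - 3) * η / 2) := by
    have : (0 : ℝ) ≤ x - 1 := by linarith
    gcongr
    linarith
  have h2 : 1024 * η ≤ x * η := by gcongr
  linarith

end LinearForm

section Numerics

lemma mul_pow_four_lt {c W m x y : ℕ} (hc : c * m ^ 5 ≤ x) (hx : x < W * m)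
    (hy : y < 2 * x) : c * y ^ 4 < 16 * W ^ 5 := by
  have h1 : c * m ^ 4 < W := by
    refine lt_of_mul_lt_mul_right (a := m) ?_ (Nat.zero_le _)
    calc c * m ^ 4 * m = c * m ^ 5 := by ring
      _ < W * m := hc.trans_lt hx
  have hW : 0 < W := by omega
  calc c * y ^ 4 ≤ c * (2 * x) ^ 4 := by gcongr
    _ ≤ c * (2 * (W * m)) ^ 4 := by gcongr
    _ = 16 * W ^ 4 * (c * m ^ 4) := by ring
    _ < 16 * W ^ 4 * W := by gcongr
    _ = 16 * W ^ 5 := by ring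

lemma pow_mul_le_pow_of_le {r l₀ D E : ℕ} (h0 : D * l₀ ^ r ≤ E * 16 ^ l₀)
    (hl₀ : 0 < l₀) (hr : (l₀ + 1) ^ r ≤ 16 * l₀ ^ r) {ℓ : ℕ} (hℓ : l₀ ≤ ℓ) :
    D * ℓ ^ r ≤ E * 16 ^ ℓ := by
  induction ℓ, hℓ using Nat.le_induction with
  | base => exact h0
  | succ n hn ih =>
    have h1 : (n + 1) ^ r ≤ 16 * n ^ r := by
      refine Nat.le_of_mul_le_mul_left ?_ (pow_pos hl₀ r)
      calc l₀ ^ r * (n + 1) ^ r = (l₀ * (n + 1)) ^ r := (mul_pow _ _ _).symm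
        _ ≤ ((l₀ + 1) * n) ^ r := by
            gcongr ?_ ^ r
            rw [mul_add, add_mul]
            omega
        _ = (l₀ + 1) ^ r * n ^ r := mul_pow _ _ _
        _ ≤ 16 * l₀ ^ r * n ^ r := by gcongr
        _ = _ := by ring
    calc D * (n + 1) ^ r ≤ D * (16 * n ^ r) := by gcongr
      _ = 16 * (D * n ^ r) := by ring
      _ ≤ 16 * (E * 16 ^ n) := by gcongr
      _ = _ := by ring

lemma parameter_le_of_lt_twenty {k m x ℓ : ℕ} (hk : 3 ≤ k) (hk' : k < 20) (hkm : k ≤ m)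
    (hx : 9 * 10 ^ 13 * m ^ 5 ≤ x) (hℓ : 2 ^ ℓ < 2 * x) :
    524288 * (k ^ 3 * (k + 7) * m * (7 * k + 3) * ℓ ^ 3) ≤ x := by
  by_contra! hcon
  have h1 : (k + 7) * (7 * k + 3) ≤ 27 * k ^ 2 := by nlinarith
  have h2 : x < 14155776 * k ^ 5 * ℓ ^ 3 * m := by
    refine hcon.trans_le ?_
    calc 524288 * (k ^ 3 * (k + 7) * m * (7 * k + 3) * ℓ ^ 3) =
        524288 * (k ^ 3 * m * ℓ ^ 3) * ((k + 7) * (7 * k + 3)) := by ring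
      _ ≤ 524288 * (k ^ 3 * m * ℓ ^ 3) * (27 * k ^ 2) := by gcongr
      _ = _ := by ring
  have hℓ70 : 70 ≤ ℓ := by
    by_contra! h
    have h3 : 9 * 10 ^ 13 * m ^ 5 < 9 * 10 ^ 13 * m ^ 5 := by
      calc 9 * 10 ^ 13 * m ^ 5 < 14155776 * k ^ 5 * ℓ ^ 3 * m := hx.trans_lt h2
        _ = 14155776 * (k * k ^ 4) * ℓ ^ 3 * m := by ring
        _ ≤ 14155776 * (19 * m ^ 4) * 69 ^ 3 * m := by gcongr <;> omega
        _ = 14155776 * 19 * 69 ^ 3 * m ^ 5 := by ring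
        _ ≤ _ := Nat.mul_le_mul_right _ (by norm_num)
    exact lt_irrefl _ h3
  have h4 : x < 14155776 * 19 ^ 5 * ℓ ^ 3 * m := by
    refine h2.trans_le ?_
    gcongr
    omega
  have h5 := mul_pow_four_lt hx h4 hℓ
  have h6 := pow_mul_le_pow_of_le (r := 15) (l₀ := 70) (D := 16 * (14155776 * 19 ^ 5) ^ 5)
    (E := 9 * 10 ^ 13) (by norm_num) (by norm_num) (by norm_num) hℓ70
  have e1 : (2 ^ ℓ) ^ 4 = 16 ^ ℓ := by rw [← pow_mul, mul_comm, pow_mul]; norm_num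
  have e2 : 16 * (14155776 * 19 ^ 5 * ℓ ^ 3) ^ 5 = 16 * (14155776 * 19 ^ 5) ^ 5 * ℓ ^ 15 := by
    rw [mul_pow _ (ℓ ^ 3), ← pow_mul, ← mul_assoc]
  rw [e1, e2] at h5
  exact h6.not_gt h5

lemma parameter_le_of_twenty_le {k m x ℓ R : ℕ} (hkℓ : k ≤ 2 * ℓ) (hkm : k ≤ m)
    (hR : 4 * ((k + 7) * R) ≤ k ^ 2 * ℓ) (hx : 15 * 10 ^ 14 * m ^ 5 ≤ x) (hℓ : 2 ^ ℓ < 2 * x) :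
    524288 * (k ^ 3 * (k + 7) * m * R * ℓ ^ 3) ≤ x := by
  by_contra! hcon
  have h2 : x < 131072 * k ^ 5 * ℓ ^ 4 * m := by
    refine hcon.trans_le ?_
    calc 524288 * (k ^ 3 * (k + 7) * m * R * ℓ ^ 3) =
        131072 * (k ^ 3 * m * ℓ ^ 3) * (4 * ((k + 7) * R)) := by ring
      _ ≤ 131072 * (k ^ 3 * m * ℓ ^ 3) * (k ^ 2 * ℓ) := by gcongr
      _ = _ := by ring
  have hℓ90 : 90 ≤ ℓ := by
    by_contra! h
    have h3 : 15 * 10 ^ 14 * m ^ 5 < 15 * 10 ^ 14 * m ^ 5 := by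
      calc 15 * 10 ^ 14 * m ^ 5 < 131072 * k ^ 5 * ℓ ^ 4 * m := hx.trans_lt h2
        _ = 131072 * (k * k ^ 4) * ℓ ^ 4 * m := by ring
        _ ≤ 131072 * ((2 * 89) * m ^ 4) * 89 ^ 4 * m := by gcongr <;> omega
        _ = 131072 * 2 * 89 ^ 5 * m ^ 5 := by ring
        _ ≤ _ := Nat.mul_le_mul_right _ (by norm_num)
    exact lt_irrefl _ h3
  have h4 : x < 4194304 * ℓ ^ 9 * m := by
    refine h2.trans_le ?_
    calc 131072 * k ^ 5 * ℓ ^ 4 * m ≤ 131072 * (2 * ℓ) ^ 5 * ℓ ^ 4 * m := by gcongr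
      _ = _ := by ring
  have h5 := mul_pow_four_lt hx h4 hℓ
  have h6 := pow_mul_le_pow_of_le (r := 45) (l₀ := 90) (D := 16 * 4194304 ^ 5)
    (E := 15 * 10 ^ 14) (by norm_num) (by norm_num) (by norm_num) hℓ90
  have e1 : (2 ^ ℓ) ^ 4 = 16 ^ ℓ := by rw [← pow_mul, mul_comm, pow_mul]; norm_num
  have e2 : 16 * (4194304 * ℓ ^ 9) ^ 5 = 16 * 4194304 ^ 5 * ℓ ^ 45 := by
    rw [mul_pow _ (ℓ ^ 9), ← pow_mul, ← mul_assoc]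
  rw [e1, e2] at h5
  exact h6.not_gt h5

lemma le_two_mul_of_two_pow_lt {k x ℓ : ℕ} (hx : x ≤ 2 ^ ℓ) (hℓ : 7 ≤ ℓ)
    (h : 2 ^ k < 16 * k * x) : k ≤ 2 * ℓ := by
  by_contra! hcon
  have h1 : ∀ n : ℕ, 15 ≤ n → 128 * n ^ 2 ≤ 2 ^ n := by
    intro n hn
    induction n, hn using Nat.le_induction with
    | base => norm_num
    | succ n hn ih =>
      rw [pow_succ 2 n]
      nlinarith
  have h2 : 2 ^ k * 2 ^ k < 128 * k ^ 2 * 2 ^ k := by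
    calc 2 ^ k * 2 ^ k < (16 * k * x) * (16 * k * x) := by gcongr
      _ ≤ (16 * k * 2 ^ ℓ) * (16 * k * 2 ^ ℓ) := by gcongr
      _ = 128 * k ^ 2 * 2 ^ (2 * ℓ + 1) := by ring
      _ ≤ 128 * k ^ 2 * 2 ^ k := by gcongr <;> omega
  exact (h1 k (by omega)).not_gt (lt_of_mul_lt_mul_right h2 (Nat.zero_le _))

lemma le_of_log_pow_of_three_le {m : ℕ} {x : ℝ} (hm : 3 ≤ m)
    (h : 7.1 * 10 ^ 13 * (m : ℝ) ^ 5 * Real.log m ^ 3 ≤ x) : 9 * 10 ^ 13 * (m : ℝ) ^ 5 ≤ x := by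
  have h1 : (1.09 : ℝ) ≤ Real.log m := by
    have h2 : Real.log ((2 : ℝ) ^ 19) ≤ Real.log (3 ^ 12) :=
      Real.log_le_log (by norm_num) (by norm_num)
    rw [Real.log_pow, Real.log_pow] at h2
    have h3 : Real.log 3 ≤ Real.log m := Real.log_le_log (by norm_num) (by exact_mod_cast hm)
    have := Real.log_two_gt_d9
    norm_num at h2 this ⊢
    linarith
  refine le_trans ?_ h
  calc 9 * 10 ^ 13 * (m : ℝ) ^ 5 ≤ 7.1 * 10 ^ 13 * (m : ℝ) ^ 5 * 1.09 ^ 3 := by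
        have : (0 : ℝ) ≤ (m : ℝ) ^ 5 := by positivity
        norm_num
        linarith
    _ ≤ _ := by gcongr

lemma le_of_log_pow_of_twenty_le {m : ℕ} {x : ℝ} (hm : 20 ≤ m)
    (h : 7.1 * 10 ^ 13 * (m : ℝ) ^ 5 * Real.log m ^ 3 ≤ x) : 15 * 10 ^ 14 * (m : ℝ) ^ 5 ≤ x := by
  have h1 : (2.77 : ℝ) ≤ Real.log m := by
    have h2 : Real.log ((2 : ℝ) ^ 4) ≤ Real.log m :=
      Real.log_le_log (by norm_num) (by norm_num; exact_mod_cast (by omega : 16 ≤ m))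
    rw [Real.log_pow] at h2
    have := Real.log_two_gt_d9
    norm_num at h2 this ⊢
    linarith
  refine le_trans ?_ h
  calc 15 * 10 ^ 14 * (m : ℝ) ^ 5 ≤ 7.1 * 10 ^ 13 * (m : ℝ) ^ 5 * 2.77 ^ 3 := by
        have : (0 : ℝ) ≤ (m : ℝ) ^ 5 := by positivity
        norm_num
        linarith
    _ ≤ _ := by gcongr

lemma secondary_parameter_le {k m R L x : ℕ} (hm : 2 ≤ m) (hRk : k + 7 ≤ R)
    (h : 8192 * ((k + 7) * (m - 1) * R * L ^ 3) ≤ x) (hx : 65536 * 256 * m ^ 5 ≤ x) :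
    65536 * ((k + 7) * m ^ 2 * L ^ 2) ≤ x := by
  rcases le_or_gt (16 * m) (R * L) with h1 | h1
  · refine le_trans ?_ h
    calc 65536 * ((k + 7) * m ^ 2 * L ^ 2) = 4096 * ((k + 7) * m * L ^ 2 * (16 * m)) := by ring
      _ ≤ 4096 * ((k + 7) * (2 * (m - 1)) * L ^ 2 * (R * L)) := by gcongr; omega
      _ = _ := by ring
  · refine le_trans ?_ hx
    have h2 : (k + 7) * L ≤ R * L := by gcongr
    have h3 : L ≤ R * L := Nat.le_mul_of_pos_left _ (by omega)
    calc 65536 * ((k + 7) * m ^ 2 * L ^ 2) = 65536 * m ^ 2 * (((k + 7) * L) * L) := by ring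
      _ ≤ 65536 * m ^ 2 * ((16 * m) * (16 * m)) :=
          Nat.mul_le_mul_left _ (Nat.mul_le_mul (by omega) (by omega))
      _ = 65536 * 256 * m ^ 4 := by ring
      _ ≤ 65536 * 256 * m ^ 5 := by gcongr <;> omega

/-- Admissible values for the auxiliary parameters. -/
lemma exists_parameters {k m x ℓ : ℕ} (hk : 3 ≤ k) (hkm : k ≤ m) (hkℓ : k ≤ 2 * ℓ)
    (hx : 9 * 10 ^ 13 * m ^ 5 ≤ x) (hx' : 20 ≤ m → 15 * 10 ^ 14 * m ^ 5 ≤ x)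
    (hxℓ : x ≤ 2 ^ ℓ) (hℓ : 2 ^ ℓ < 2 * x) :
    ∃ κ R : ℕ, 3 * k + 1 ≤ 2 ^ κ ∧ R = 10 + (k - 1) * (1 + κ) ∧ k + 7 ≤ R ∧
      524288 * (k ^ 3 * (k + 7) * m * R * ℓ ^ 3) ≤ x := by
  rcases lt_or_ge k 20 with h | h
  · refine ⟨6, _, by norm_num; omega, rfl, by omega, ?_⟩
    rw [show 10 + (k - 1) * (1 + 6) = 7 * k + 3 by omega]
    exact parameter_le_of_lt_twenty hk h hkm hx hℓ
  · have hℓ72 : 72 ≤ ℓ := by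
      by_contra! hcon
      have h1 : 2 ^ ℓ ≤ 2 ^ 71 := Nat.pow_le_pow_right (by norm_num) (by omega)
      have h2 : 15 * 10 ^ 14 * 20 ^ 5 ≤ x := le_trans (by gcongr; omega) (hx' (by omega))
      omega
    obtain ⟨q, hq⟩ : ∃ q, q = ℓ / 6 := ⟨_, rfl⟩
    have h1 : ∀ q : ℕ, 10 ≤ q → 36 * q + 31 ≤ 2 ^ (q - 1) := by
      intro q hq
      induction q, hq using Nat.le_induction with
      | base => norm_num
      | succ n hn ih =>
        obtain ⟨n, rfl⟩ := Nat.exists_eq_add_of_le' (by omega : 1 ≤ n)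
        simp only [Nat.add_sub_cancel] at ih ⊢
        rw [pow_succ]
        omega
    have h2 := h1 q (by omega)
    refine ⟨q - 1, 10 + (k - 1) * (1 + (q - 1)), by omega, rfl, ?_, ?_⟩
    · have : (k - 1) * 2 ≤ (k - 1) * (1 + (q - 1)) := by gcongr; omega
      omega
    · refine parameter_le_of_twenty_le hkℓ hkm ?_ (hx' (by omega)) hℓ
      obtain ⟨k, rfl⟩ := Nat.exists_eq_add_of_le' (by omega : 1 ≤ k)
      rw [show 1 + (q - 1) = q by omega, Nat.add_sub_cancel]
      calc 4 * ((k + 1 + 7) * (10 + k * q)) ≤ 4 * ((k + 1 + 7) * (q + k * q)) := by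
            gcongr; omega
        _ = 4 * (k + 8) * (k + 1) * q := by ring
        _ ≤ 6 * (k + 1) * (k + 1) * q := by gcongr ?_ * (k + 1) * q; omega
        _ = (k + 1) ^ 2 * (6 * q) := by ring
        _ ≤ _ := by gcongr; omega

end Numerics

section Main

/-- A small linear form in the logarithms of `a`, `α` and `g` is impossible for large `x`. -/
lemma not_linearForm_small {k m N x a : ℕ} (hk : 3 ≤ k) (hkm : k ≤ m) (ha : 2 ≤ a)
    (ham : a ≤ 2 ^ (m - 1)) (hxN : x ≤ N) (hNx : N ≤ 2 * x * m) (hx : 9 * 10 ^ 13 * m ^ 5 ≤ x)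
    (hx' : 20 ≤ m → 15 * 10 ^ 14 * m ^ 5 ≤ x) {α g δ : ℝ} (hα : 9 / 5 < α) (hα2 : α < 2)
    (hroot : α ^ k = ∑ i ∈ range k, α ^ i) (hδ : δ = (k + 1) * α - 2 * k) (hδ0 : 0 < δ)
    (hδ2 : δ ≤ 2) (hgδ : g * δ = α - 1) (hg : 1 / 2 ≤ g) (hg1 : g ≤ 1)
    (hga : |a - g * α ^ m| ≤ 1)
    (hlam : |x * Real.log a - N * Real.log α - Real.log g| ≤ 4 / 2 ^ x) : False := by
  have hg0 : 0 < g := by linarith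
  have hm5 : m ≤ m ^ 5 := Nat.le_self_pow (by norm_num) m
  have hx3 : 9 * 10 ^ 13 * 3 ^ 5 ≤ x := le_trans (by gcongr; omega) hx
  obtain ⟨ℓ, hxℓ, hℓ⟩ : ∃ ℓ, x ≤ 2 ^ ℓ ∧ 2 ^ ℓ < 2 * x := by
    refine ⟨Nat.clog 2 x, Nat.le_pow_clog one_lt_two x, ?_⟩
    have h1 := Nat.pow_pred_clog_lt_self one_lt_two (x := x) (by omega)
    have h2 : 0 < Nat.clog 2 x := Nat.clog_pos one_lt_two (by omega)
    obtain ⟨c, hc⟩ := Nat.exists_eq_add_of_le' h2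
    rw [hc] at h1 ⊢
    simp only [Nat.pred_eq_sub_one, Nat.add_sub_cancel] at h1
    rw [pow_succ]
    omega
  have hℓ16 : 16 ≤ ℓ := by
    by_contra! h
    have : 2 ^ ℓ ≤ 2 ^ 15 := Nat.pow_le_pow_right (by norm_num) (by omega)
    omega
  have hkℓ : k ≤ 2 * ℓ := le_two_mul_of_two_pow_lt hxℓ (by omega)
    (two_pow_lt_of_abs_linearForm_le hk (by omega) (by omega) hkm hα hα2 hroot hδ hgδ hg hga hlam)
  obtain ⟨κ, R, hκ, hR, hRk, hpar⟩ := exists_parameters hk hkm hkℓ hx hx' hxℓ hℓ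
  have hα1 : 1 < α := by linarith
  have hα3 : 2 ≤ α ^ 2 := by nlinarith
  have hglog : |Real.log g| ≤ Real.log 2 := by
    rw [abs_of_nonpos (Real.log_nonpos hg0.le hg1), ← Real.log_inv]
    refine Real.log_le_log (by positivity) ?_
    rw [inv_le_comm₀ hg0 two_pos]
    linarith
  have hm1 : m - 1 + 1 = m := by omega
  have hx₁ : 8192 * ((k + 7) * (m - 1) * R * (4 * k * ℓ) ^ 3) ≤ x := by
    refine le_trans ?_ hpar
    calc 8192 * ((k + 7) * (m - 1) * R * (4 * k * ℓ) ^ 3) ≤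
        8192 * ((k + 7) * m * R * (4 * k * ℓ) ^ 3) := by gcongr; omega
      _ = _ := by ring
  have hx₂ := secondary_parameter_le (by omega) hRk hx₁
    (le_trans (Nat.mul_le_mul_right _ (by norm_num)) hx)
  obtain ⟨A, B, hA0, hA, hAB⟩ := exists_small_relation (p := m - 1) (by omega) hα1 hα2 hα3 hroot ha
    (by omega) ham hκ hδ hδ0 hδ2 hgδ hg0 hglog rfl hlam hR (by omega) rfl hxℓ hxN
    (by rwa [hm1]) hx₁ (by rwa [hm1])
  refine not_small_relation (p := m - 1) hk hα1 hα2 hroot ha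
    (by omega) ham hκ hδ hδ0 hδ2 hgδ hg0 hglog rfl hlam hR (by omega) rfl ?_ hxℓ hxN
    (by rwa [hm1]) hx₁ hA0 hA hAB
  calc 192 = 4 * 3 * 16 := by norm_num
    _ ≤ _ := by gcongr

/-- The coefficient of the dominant term of the Binet formula. -/
lemma exists_binet_coefficient {k : ℕ} (hk : 3 ≤ k) {α : ℝ} (hα : 9 / 5 < α) (hα2 : α < 2)
    (hroot : α ^ k = ∑ i ∈ range k, α ^ i) :
    ∃ g δ : ℝ, δ = (k + 1) * α - 2 * k ∧ 0 < δ ∧ δ ≤ 2 ∧ g * δ = α - 1 ∧ 1 / 2 ≤ g ∧ g ≤ 1 := by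
  have hk3 : (3 : ℝ) ≤ k := by exact_mod_cast hk
  have h1 := natCast_mul_two_sub_le_one hk hα hroot
  have h2 : 3 * (2 - α) ≤ k * (2 - α) := by gcongr
  have hδ0 : 0 < (k + 1) * α - 2 * k := by linarith
  refine ⟨(α - 1) / ((k + 1) * α - 2 * k), _, rfl, hδ0, by linarith,
    div_mul_cancel₀ _ hδ0.ne', ?_, ?_⟩
  · rw [le_div_iff₀ hδ0]
    linarith
  · rw [div_le_one hδ0]
    linarith

/-- If `x ≥ 2`, `3 ≤ k ≤ m` and `(F_{m+1}^{(k)})^x − (F_{m-1}^{(k)})^x = F_n^{(k)}`, then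
`x < 7.1 · 10^13 · m^5 · (log m)^3`. -/
theorem kFib_power_diff_exponent_bound
    (k : ℕ) (m n : ℤ) (x : ℕ)
    (hm : 0 < m) (hn : 0 < n) (hx : 2 ≤ x)
    (hk3 : 3 ≤ k) (hkm : (k : ℤ) ≤ m)
    (F : ℤ → ℤ)
    (hF0 : ∀ i : ℤ, 2 - (k : ℤ) ≤ i → i ≤ 0 → F i = 0)
    (hF1 : F 1 = 1)
    (hFrec : ∀ i : ℤ, 2 ≤ i → F i = ∑ j ∈ Finset.Icc (1 : ℤ) (k : ℤ), F (i - j))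
    (heq : (F (m + 1)) ^ x - (F (m - 1)) ^ x = F n) :
    (x : ℝ) < 7.1 * 10 ^ 13 * (m : ℝ) ^ 5 * (Real.log m) ^ 3 := by
  by_contra! hcon
  obtain ⟨α, hα, hα2, hroot⟩ := exists_dominant_root hk3
  obtain ⟨g, δ, hδ, hδ0, hδ2, hgδ, hg, hg1⟩ := exists_binet_coefficient hk3 hα hα2 hroot
  obtain ⟨hpos, hmono, hle, hdouble, hF4⟩ := kFib_growth hk3 hF0 hF1 hFrec
  have hbinet := kFib_abs_sub_le_one hk3 hF0 hF1 hFrec hα hroot hδ hgδ (by linarith) hg1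
  obtain ⟨M, rfl⟩ : ∃ M : ℕ, m = M + 3 := ⟨(m - 3).toNat, by omega⟩
  obtain ⟨N, rfl⟩ : ∃ N : ℕ, n = N + 1 := ⟨(n - 1).toNat, by omega⟩
  have ha4 : ∀ j : ℕ, 4 ≤ F (j + 4) := by
    intro j
    induction j with
    | zero => simp [hF4]
    | succ j ih =>
      refine ih.trans (le_trans (le_of_eq ?_) ((hmono (j + 3)).trans (le_of_eq ?_))) <;> congr 1
  obtain ⟨a, ha⟩ : ∃ a : ℕ, F (M + 3 + 1) = a := by
    have := ha4 M
    rw [show (M : ℤ) + 4 = M + 3 + 1 by ring] at this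
    exact ⟨(F (M + 3 + 1)).toNat, (Int.toNat_of_nonneg (by omega)).symm⟩
  obtain ⟨b, hb⟩ : ∃ b : ℕ, F (M + 3 - 1) = b := by
    have := hpos (M + 1)
    rw [show ((M + 1 : ℕ) : ℤ) + 1 = M + 3 - 1 by push_cast; ring] at this
    exact ⟨(F (M + 3 - 1)).toNat, (Int.toNat_of_nonneg (by omega)).symm⟩
  have ha4' : 4 ≤ a := by
    have := ha4 M
    rw [show (M : ℤ) + 4 = M + 3 + 1 by ring, ha] at this
    exact_mod_cast this
  have hb1 : 1 ≤ b := by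
    have := hpos (M + 1)
    rw [show ((M + 1 : ℕ) : ℤ) + 1 = M + 3 - 1 by push_cast; ring, hb] at this
    exact_mod_cast this
  have hab : 2 * b ≤ a := by
    have := hdouble (M + 1)
    rw [show ((M + 1 : ℕ) : ℤ) + 1 = M + 3 - 1 by push_cast; ring,
      show ((M + 1 : ℕ) : ℤ) + 3 = M + 3 + 1 by push_cast; ring, ha, hb] at this
    exact_mod_cast this
  have ham : a ≤ 2 ^ (M + 2) := by
    have := hle (M + 2)
    rw [show ((M + 2 : ℕ) : ℤ) + 2 = M + 3 + 1 by push_cast; ring, ha] at this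
    exact_mod_cast this
  rw [ha, hb] at heq
  have hbx : 2 * b ^ x ≤ a ^ x := by
    calc 2 * b ^ x ≤ 2 ^ x * b ^ x := by
          gcongr
          exact Nat.le_self_pow (by omega) 2
      _ = (2 * b) ^ x := (mul_pow _ _ _).symm
      _ ≤ a ^ x := by gcongr
  have hxN : x ≤ N := by
    have h1 : F (N + 1) ≤ 2 ^ N := (hmono N).trans (hle N)
    have h2 : 2 * 2 ^ x ≤ a ^ x := by
      calc 2 * 2 ^ x ≤ 2 ^ x * 2 ^ x := by
            gcongr
            exact Nat.le_self_pow (by omega) 2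
        _ = 4 ^ x := by rw [← mul_pow]; norm_num
        _ ≤ a ^ x := by gcongr
    rw [← heq] at h1
    have h3 : 2 ^ x ≤ 2 ^ N := by zify at *; linarith
    exact (Nat.pow_le_pow_iff_right one_lt_two).1 h3
  have hNx : N ≤ 2 * x * (M + 3) := by
    have h1 : ∀ j : ℕ, 2 ^ j ≤ F (2 * j + 1) := by
      intro j
      induction j with
      | zero => simp [hF1]
      | succ j ih =>
        have := hdouble (2 * j)
        push_cast at this ⊢
        rw [show 2 * ((j : ℤ) + 1) + 1 = 2 * j + 3 by ring, pow_succ]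
        linarith
    have h2 : 2 ^ (N / 2) ≤ F (N + 1) := by
      refine (h1 _).trans ?_
      rcases Nat.even_or_odd' N with ⟨c, rfl | rfl⟩
      · rw [show 2 * c / 2 = c by omega]; push_cast; rfl
      · rw [show (2 * c + 1) / 2 = c by omega]
        have := hmono (2 * c)
        push_cast at this ⊢
        rwa [add_assoc, one_add_one_eq_two]
    have h3 : 2 ^ (N / 2) ≤ 2 ^ ((M + 2) * x) := by
      rw [pow_mul]
      have h4 : a ^ x ≤ (2 ^ (M + 2)) ^ x := by gcongr
      have h5 : (0 : ℤ) ≤ (b : ℤ) ^ x := by positivity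
      rw [← heq] at h2
      zify at *
      linarith
    have h6 := (Nat.pow_le_pow_iff_right one_lt_two).1 h3
    have h7 : 2 * x * (M + 3) = 2 * ((M + 2) * x) + 2 * x := by ring
    omega
  have hlam := abs_linearForm_le (α := α) (g := g) (a := a) (b := b) (x := x) (N := N)
    (by linarith) (by linarith) (by exact_mod_cast hb1) (by exact_mod_cast hab) hx (by
      have := hbinet N
      rw [← heq] at this
      exact_mod_cast this)
  have hcast : (((M + 3 : ℕ) : ℤ) : ℝ) = ((M + 3 : ℕ) : ℝ) := Int.cast_natCast _
  have hcon' : 7.1 * 10 ^ 13 * ((M + 3 : ℕ) : ℝ) ^ 5 * Real.log ((M + 3 : ℕ) : ℝ) ^ 3 ≤ x := by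
    push_cast at hcon ⊢
    exact hcon
  refine not_linearForm_small (m := M + 3) hk3 (by omega) (by omega) ham hxN hNx
    (by exact_mod_cast le_of_log_pow_of_three_le (by omega) hcon')
    (fun h => by exact_mod_cast le_of_log_pow_of_twenty_le h hcon')
    hα hα2 hroot hδ hδ0 hδ2 hgδ hg hg1 ?_ hlam
  have := hbinet (M + 3)
  push_cast at this
  rw [ha] at this
  exact_mod_cast this

end Main
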